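/- arXiv:1403.1668 — 2 statements merged into one kernel-verified Lean document; each statement's English description precedes it below -/
import Mathlib

section
/- Let γ ≥ 0, m₀ > 1/2, and assume η ∈ ℋ^{γ+3} satisfies condition (H). Then there exists C > 0 such that for every T ≥ 0, every n ∈ {±1}, every continuous function F : [0,T] → ℂ, and every continuous solution ζ : [0,T] → ℂ of the Volterra equation ζ(t) = ∫₀^t K(n, t−σ) ζ(σ) dσ + F(t) on [0,T], one has sup_{t∈[0,T]} ⟨t⟩^γ |ζ(t)| ≤ C sup_{t∈[0,T]} ⟨t⟩^γ |F(t)|, with C independent of T and F. -/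
open MeasureTheory Real Set

noncomputable section

/-- The measure on `𝕋 × ℝ`, with `𝕋 = ℝ/2πℤ` modeled as `(0, 2π] × ℝ ⊆ ℝ × ℝ`. -/
def μTR : Measure (ℝ × ℝ) := (volume.restrict (Set.Ioc 0 (2 * π))).prod volume

/-- Partial derivative in the first (space) variable. -/
def pX (f : ℝ → ℝ → ℂ) : ℝ → ℝ → ℂ := fun x v => deriv (fun x' => f x' v) x

/-- Partial derivative in the second (velocity) variable. -/
def pV (f : ℝ → ℝ → ℂ) : ℝ → ℝ → ℂ := fun x v => deriv (fun v' => f x v') v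

/-- The weighted integrand `(1+v²)^{m₀} |∂ₓᵖ ∂ᵥ^q f|²`. -/
def wInt (m0 : ℝ) (p q : ℕ) (f : ℝ → ℝ → ℂ) : ℝ × ℝ → ℝ :=
  fun z => (1 + z.2 ^ 2) ^ m0 * ‖(pX^[p] (pV^[q] f)) z.1 z.2‖ ^ 2

/-- Square of the weighted Sobolev norm: `‖f‖_{ℋⁿ}² = ∑_{p+q ≤ n} ∫ (1+v²)^{m₀}|∂ₓᵖ∂ᵥ^q f|²`. -/
def HnormSq (m0 : ℝ) (n : ℕ) (f : ℝ → ℝ → ℂ) : ℝ :=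
  ∑ p ∈ Finset.range (n + 1), ∑ q ∈ Finset.range (n + 1 - p), ∫ z, wInt m0 p q f z ∂μTR

/-- The weighted Sobolev norm `‖f‖_{ℋⁿ}`. -/
def Hnorm (m0 : ℝ) (n : ℕ) (f : ℝ → ℝ → ℂ) : ℝ := Real.sqrt (HnormSq m0 n f)

/-- Membership in the weighted Sobolev space `ℋⁿ` on `𝕋 × ℝ`. -/
def MemH (m0 : ℝ) (n : ℕ) (f : ℝ → ℝ → ℂ) : Prop :=
  ContDiff ℝ n (Function.uncurry f) ∧
  (∀ v, Function.Periodic (fun x => f x v) (2 * π)) ∧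
  ∀ p q : ℕ, p + q ≤ n → Integrable (wInt m0 p q f) μTR

/-- The Fourier coefficient `f̂ₖ(ξ) = (1/2π) ∫_{𝕋×ℝ} f(x,v) e^{-ikx-iξv} dx dv`. -/
def fHat (f : ℝ → ℝ → ℂ) (k : ℤ) (ξ : ℝ) : ℂ :=
  (1 / (2 * π)) * ∫ z, f z.1 z.2 * Complex.exp (-Complex.I * ((k : ℝ) * z.1 + ξ * z.2)) ∂μTR

/-- The Japanese bracket `⟨t⟩ = (1+t²)^{1/2}`. -/
def jap (t : ℝ) : ℝ := Real.sqrt (1 + t ^ 2)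

/-- The Fourier transform `η̂₀(ξ)` of a spatially homogeneous state `η = η(v)`. -/
def etaHat (η : ℝ → ℂ) (ξ : ℝ) : ℂ := fHat (fun _ v => η v) 0 ξ

/-- Fourier coefficients of the HMF kernel `P(x) = cos x`: `p_{±1} = 1/2`, `pₙ = 0` otherwise. -/
def pcoef (n : ℤ) : ℂ := if n = 1 ∨ n = -1 then 1 / 2 else 0

/-- The kernel `K(n,t) = -n pₙ · nt · η̂₀(nt) 1_{t ≥ 0}`. -/
def Kker (η : ℝ → ℂ) (n : ℤ) (t : ℝ) : ℂ :=
  if 0 ≤ t then -(n : ℂ) * pcoef n * ((n : ℂ) * t) * etaHat η ((n : ℝ) * t) else 0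

/-- The Fourier transform `K̂(n,τ) = ∫_ℝ e^{-iτt} K(n,t) dt`, for complex `τ`. -/
def KhatC (η : ℝ → ℂ) (n : ℤ) (τ : ℂ) : ℂ :=
  ∫ t : ℝ, Complex.exp (-Complex.I * τ * (t : ℂ)) * Kker η n t

/-- The Penrose stability condition (H). -/
def Penrose (m0 : ℝ) (η : ℝ → ℂ) : Prop :=
  MemH m0 5 (fun _ v => (1 + (v : ℂ) ^ 2) * η v) ∧
  ∃ κ > 0, ∀ n : ℤ, n = 1 ∨ n = -1 → ∀ τ : ℂ, τ.im ≤ 0 → κ ≤ ‖1 - KhatC η n τ‖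

/-- The Poisson bracket `{f,h} = ∂ₓf ∂ᵥh - ∂ᵥf ∂ₓh`. -/
def pbracket (f h : ℝ → ℝ → ℂ) : ℝ → ℝ → ℂ :=
  fun x v => pX f x v * pV h x v - pV f x v * pX h x v

/-- The filtered HMF mean-field potential `φ(t,g)(x,v) = ∫ cos(x-y+t(v-u)) g(t,y,u) dy du`. -/
def phiHMF (g : ℝ → ℝ → ℝ → ℂ) (t : ℝ) : ℝ → ℝ → ℂ :=
  fun x v => ∫ z, (Real.cos (x - z.1 + t * (v - z.2)) : ℂ) * g t z.1 z.2 ∂μTR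

/-- `g` solves the filtered Vlasov-HMF equation `∂ₜg = {φ(t,g), η} + ε{φ(t,g), g}`. -/
def IsVHMF (ε : ℝ) (η : ℝ → ℂ) (g : ℝ → ℝ → ℝ → ℂ) : Prop :=
  ∀ t x v, HasDerivAt (fun τ => g τ x v)
    (pbracket (phiHMF g t) (fun _ w => η w) x v + ε * pbracket (phiHMF g t) (g t) x v) t

/-- Global smoothness (in all variables) of `g = g(t,x,v)`. -/
def SmoothG (g : ℝ → ℝ → ℝ → ℂ) : Prop :=
  ∀ n : ℕ, ContDiff ℝ n fun p : ℝ × ℝ × ℝ => g p.1 p.2.1 p.2.2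

/-- `ζₖ(t) = ĝₖ(t, kt)`. -/
def zeta (g : ℝ → ℝ → ℝ → ℂ) (k : ℤ) (t : ℝ) : ℂ := fHat (g t) k ((k : ℝ) * t)

/-- The bound `Q_{T,s}(g) ≤ R`, where
`Q_{T,s}(g) = sup_{[0,T]} ‖g(t)‖_{ℋˢ}/⟨t⟩³ + sup_{[0,T]} max_{k=±1} ⟨t⟩^{s-1}|ζₖ(t)| + sup_{[0,T]} ‖g(t)‖_{ℋ^{s-4}}`. -/
def Qle (m0 : ℝ) (s : ℕ) (g : ℝ → ℝ → ℝ → ℂ) (T R : ℝ) : Prop :=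
  ∃ A B C : ℝ, A + B + C ≤ R ∧
    (∀ t ∈ Set.Icc (0 : ℝ) T, Hnorm m0 s (g t) / jap t ^ 3 ≤ A) ∧
    (∀ t ∈ Set.Icc (0 : ℝ) T, ∀ k : ℤ, k = 1 ∨ k = -1 → jap t ^ (s - 1) * ‖zeta g k t‖ ≤ B) ∧
    (∀ t ∈ Set.Icc (0 : ℝ) T, Hnorm m0 (s - 4) (g t) ≤ C)

open FourierTransform Filter Topology
open scoped ENNReal NNReal SchwartzMap Convolution ContDiff

/-- The convolution `∫ K(t - s) f(s) ds`. -/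
def convol (K f : ℝ → ℂ) (t : ℝ) : ℂ := ∫ s, K (t - s) * f s

lemma convol_eq_convolution (K f : ℝ → ℂ) :
    convol K f = K ⋆[ContinuousLinearMap.mul ℂ ℂ] f := by
  ext t
  rw [convolution_mul_swap]; rfl

lemma integrable_convol {K f : ℝ → ℂ} (hK : Integrable K) (hf : Integrable f) :
    Integrable (convol K f) := by
  rw [convol_eq_convolution]
  exact hK.integrable_convolution _ hf

lemma fourier_convol {K f : ℝ → ℂ} (hK : Integrable K) (hf : Integrable f) (w : ℝ) :
    𝓕 (convol K f) w = 𝓕 K w * 𝓕 f w := by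
  rw [convol_eq_convolution]
  exact Real.fourier_mul_convolution_eq hK hf w

lemma norm_fourier_le {K : ℝ → ℂ} (w : ℝ) : ‖𝓕 K w‖ ≤ ∫ t, ‖K t‖ :=
  VectorFourier.norm_fourierIntegral_le_integral_norm _ _ _ _ _

lemma continuous_fourier {K : ℝ → ℂ} (hK : Integrable K) : Continuous (𝓕 K) :=
  VectorFourier.fourierIntegral_continuous Real.continuous_fourierChar
    (by exact continuous_inner) hK

lemma integral_fourier_mul {f g : ℝ → ℂ} (hf : Integrable f) (hg : Integrable g) :
    ∫ w, 𝓕 f w * g w = ∫ t, f t * 𝓕 g t := by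
  simpa using! VectorFourier.integral_fourierIntegral_smul_eq_flip (L := innerₗ ℝ)
    Real.continuous_fourierChar continuous_inner hf hg

/-- On `L¹ ∩ L²` the integral Fourier transform agrees with the `L²` one. -/
lemma fourier_ae_eq {f : ℝ → ℂ} (hf : Integrable f) {g : Lp ℂ 2 (volume : Measure ℝ)}
    (hfg : f =ᵐ[volume] g) : 𝓕 f =ᵐ[volume] (𝓕 g : Lp ℂ 2 (volume : Measure ℝ)) := by
  refine ae_eq_of_integral_contDiff_smul_eq (continuous_fourier hf).locallyIntegrable
    ((Lp.memLp _).locallyIntegrable (by norm_num)) fun φ hφ hφc => ?_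
  have h1 : HasCompactSupport (Complex.ofRealCLM ∘ φ) := hφc.comp_left rfl
  have h2 : ContDiff ℝ ∞ (Complex.ofRealCLM ∘ φ) := by fun_prop
  set ψ : 𝓢(ℝ, ℂ) := h1.toSchwartzMap h2
  have hψ : ∀ x, ψ x = (φ x : ℂ) := fun x => by simp [ψ]
  have h3 := DFunLike.congr_fun (Lp.fourier_toTemperedDistribution_eq g) ψ
  rw [TemperedDistribution.fourier_apply, Lp.toTemperedDistribution_apply,
    Lp.toTemperedDistribution_apply] at h3
  simp only [Complex.real_smul, ← hψ]
  simp only [smul_eq_mul] at h3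
  rw [← h3]
  have h4 := integral_fourier_mul hf ψ.integrable (g := ψ)
  simp only [mul_comm (ψ _)]
  rw [h4]
  refine integral_congr_ae ?_
  filter_upwards [hfg] with x hx
  rw [hx, mul_comm, SchwartzMap.fourier_coe]

/-- An `L¹` function whose Fourier transform is that of an `L²` function equals it. -/
lemma ae_eq_of_fourier_ae_eq {f : ℝ → ℂ} (hf : Integrable f) {g : Lp ℂ 2 (volume : Measure ℝ)}
    (hfg : 𝓕 f =ᵐ[volume] (𝓕 g : Lp ℂ 2 (volume : Measure ℝ))) : f =ᵐ[volume] g := by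
  refine ae_eq_of_integral_contDiff_smul_eq hf.locallyIntegrable
    ((Lp.memLp _).locallyIntegrable (by norm_num)) fun φ hφ hφc => ?_
  have h1 : HasCompactSupport (Complex.ofRealCLM ∘ φ) := hφc.comp_left rfl
  have h2 : ContDiff ℝ ∞ (Complex.ofRealCLM ∘ φ) := by fun_prop
  set ψ : 𝓢(ℝ, ℂ) := h1.toSchwartzMap h2
  have hψ : ∀ x, ψ x = (φ x : ℂ) := fun x => by simp [ψ]
  have h3 := DFunLike.congr_fun (Lp.fourier_toTemperedDistribution_eq g) (𝓕⁻ ψ)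
  rw [TemperedDistribution.fourier_apply, Lp.toTemperedDistribution_apply,
    Lp.toTemperedDistribution_apply, fourier_fourierInv_eq] at h3
  simp only [Complex.real_smul, ← hψ]
  simp only [smul_eq_mul] at h3
  rw [h3]
  have h4 := integral_fourier_mul hf (𝓕⁻ ψ : 𝓢(ℝ, ℂ)).integrable
  rw [← SchwartzMap.fourier_coe, fourier_fourierInv_eq] at h4
  simp only [mul_comm (ψ _)]
  rw [← h4]
  refine integral_congr_ae ?_
  filter_upwards [hfg] with x hx
  rw [hx, mul_comm]

lemma memLp_fourier {f : ℝ → ℂ} (hf : Integrable f) (hf2 : MemLp f 2) : MemLp (𝓕 f) 2 :=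
  (memLp_congr_ae (fourier_ae_eq hf hf2.coeFn_toLp.symm)).2 (Lp.memLp _)

lemma memLp_top_fourier {K : ℝ → ℂ} (hK : Integrable K) : MemLp (𝓕 K) ∞ :=
  memLp_top_of_bound (continuous_fourier hK).aestronglyMeasurable _
    (Filter.Eventually.of_forall norm_fourier_le)

/-- Convolution with an `L¹` kernel as an operator on `L²`, defined as a Fourier multiplier. -/
def convOp (K : ℝ → ℂ) (hK : Integrable K) :
    Lp ℂ 2 (volume : Measure ℝ) →L[ℂ] Lp ℂ 2 (volume : Measure ℝ) :=
  (Lp.fourierTransformₗᵢ ℝ ℂ).symm.toContinuousLinearEquiv.toContinuousLinearMap ∘L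
    ((ContinuousLinearMap.mul ℂ ℂ).holderL volume ∞ 2 2 (memLp_top_fourier hK).toLp ∘L
      (Lp.fourierTransformₗᵢ ℝ ℂ).toContinuousLinearEquiv.toContinuousLinearMap)

lemma fourier_convOp {K : ℝ → ℂ} (hK : Integrable K) (f : Lp ℂ 2 (volume : Measure ℝ)) :
    (𝓕 (convOp K hK f) : Lp ℂ 2 (volume : Measure ℝ)) =ᵐ[volume]
      fun w => 𝓕 K w * (𝓕 f : Lp ℂ 2 (volume : Measure ℝ)) w := by
  have h : (𝓕 (convOp K hK f) : Lp ℂ 2 (volume : Measure ℝ)) =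
      (ContinuousLinearMap.mul ℂ ℂ).holder 2 ((memLp_top_fourier hK).toLp)
        (𝓕 f : Lp ℂ 2 (volume : Measure ℝ)) :=
    (Lp.fourierTransformₗᵢ ℝ ℂ).apply_symm_apply _
  rw [h]
  filter_upwards [(ContinuousLinearMap.mul ℂ ℂ).coeFn_holder (r := 2)
    ((memLp_top_fourier hK).toLp) (𝓕 f : Lp ℂ 2 (volume : Measure ℝ)),
    (memLp_top_fourier hK).coeFn_toLp] with w h1 h2
  rw [h1, h2]; rfl

lemma le_norm_sub_convOp {K : ℝ → ℂ} (hK : Integrable K) {κ : ℝ} (hκ : 0 < κ)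
    (h : ∀ w, κ ≤ ‖1 - 𝓕 K w‖) (f : Lp ℂ 2 (volume : Measure ℝ)) :
    κ * ‖f‖ ≤ ‖f - convOp K hK f‖ := by
  rw [← Lp.norm_fourier_eq f, ← Lp.norm_fourier_eq (f - convOp K hK f)]
  have : ‖(𝓕 f : Lp ℂ 2 (volume : Measure ℝ))‖ ≤
      κ⁻¹ * ‖(𝓕 (f - convOp K hK f) : Lp ℂ 2 (volume : Measure ℝ))‖ := by
    refine Lp.norm_le_mul_norm_of_ae_le_mul ?_
    rw [show (𝓕 (f - convOp K hK f) : Lp ℂ 2 (volume : Measure ℝ)) = 𝓕 f - 𝓕 (convOp K hK f)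
      from (Lp.fourierTransformₗᵢ ℝ ℂ).map_sub _ _]
    filter_upwards [Lp.coeFn_sub (𝓕 f : Lp ℂ 2 (volume : Measure ℝ)) (𝓕 (convOp K hK f)),
      fourier_convOp hK f] with w h1 h2
    rw [h1, Pi.sub_apply, h2, ← one_sub_mul, norm_mul, ← mul_assoc]
    refine le_mul_of_one_le_left (norm_nonneg _) ?_
    rw [inv_mul_eq_div, one_le_div hκ]
    exact h w
  rwa [inv_mul_eq_div, le_div_iff₀ hκ, mul_comm] at this

lemma norm_convOp_sub_le {K L : ℝ → ℂ} (hK : Integrable K) (hL : Integrable L) :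
    ‖convOp K hK - convOp L hL‖ ≤ ∫ t, ‖K t - L t‖ := by
  refine ContinuousLinearMap.opNorm_le_bound _ (integral_nonneg fun _ => norm_nonneg _) fun f => ?_
  rw [sub_apply, ← Lp.norm_fourier_eq f,
    ← Lp.norm_fourier_eq (convOp K hK f - _)]
  refine Lp.norm_le_mul_norm_of_ae_le_mul ?_
  rw [show (𝓕 (convOp K hK f - convOp L hL f) : Lp ℂ 2 (volume : Measure ℝ)) =
    𝓕 (convOp K hK f) - 𝓕 (convOp L hL f) from (Lp.fourierTransformₗᵢ ℝ ℂ).map_sub _ _]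
  filter_upwards [Lp.coeFn_sub (𝓕 (convOp K hK f) : Lp ℂ 2 (volume : Measure ℝ))
    (𝓕 (convOp L hL f)), fourier_convOp hK f, fourier_convOp hL f] with w h1 h2 h3
  rw [h1, Pi.sub_apply, h2, h3, ← sub_mul, norm_mul]
  refine mul_le_mul_of_nonneg_right ?_ (norm_nonneg _)
  have : 𝓕 K w - 𝓕 L w = 𝓕 (fun t => K t - L t) w := by
    rw [Real.fourier_eq, Real.fourier_eq, Real.fourier_eq, ← integral_sub]
    · simp only [smul_sub]
    · exact (Real.fourierIntegral_convergent_iff w).2 hK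
    · exact (Real.fourierIntegral_convergent_iff w).2 hL
  rw [this]
  exact norm_fourier_le w

lemma norm_convOp_le {K : ℝ → ℂ} (hK : Integrable K) : ‖convOp K hK‖ ≤ ∫ t, ‖K t‖ := by
  refine ContinuousLinearMap.opNorm_le_bound _ (integral_nonneg fun _ => norm_nonneg _) fun f => ?_
  rw [← Lp.norm_fourier_eq f, ← Lp.norm_fourier_eq (convOp K hK f)]
  refine Lp.norm_le_mul_norm_of_ae_le_mul ?_
  filter_upwards [fourier_convOp hK f] with w h2
  rw [h2, norm_mul]
  exact mul_le_mul_of_nonneg_right (norm_fourier_le w) (norm_nonneg _)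

lemma memLp_comp_sub_left {p : ℝ≥0∞} {K : ℝ → ℂ} (hK : MemLp K p) (t : ℝ) :
    MemLp (fun s => K (t - s)) p :=
  hK.comp_measurePreserving (Measure.measurePreserving_sub_left volume t)

lemma integrable_convol_integrand {K f : ℝ → ℂ} (hK : MemLp K 2) (hf : MemLp f 2) (t : ℝ) :
    Integrable (fun s => K (t - s) * f s) :=
  (memLp_comp_sub_left hK t).integrable_mul hf

lemma convOp_ae_eq_convol_of_integrable {K : ℝ → ℂ} (hK : Integrable K)
    {f : Lp ℂ 2 (volume : Measure ℝ)} (hf : Integrable f) :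
    convOp K hK f =ᵐ[volume] convol K f := by
  symm
  refine ae_eq_of_fourier_ae_eq (integrable_convol hK hf) ?_
  filter_upwards [fourier_convOp hK f, fourier_ae_eq hf (Filter.EventuallyEq.refl _ _)] with w h1 h2
  rw [h1, fourier_convol hK hf, h2]

lemma tendsto_convol {K : ℝ → ℂ} (hK : MemLp K 2) {f : ℕ → Lp ℂ 2 (volume : Measure ℝ)}
    {g : Lp ℂ 2 (volume : Measure ℝ)} (h : Tendsto f atTop (𝓝 g)) (t : ℝ) :
    Tendsto (fun n => convol K (f n) t) atTop (𝓝 (convol K g t)) := by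
  have hL (u : Lp ℂ 2 (volume : Measure ℝ)) : convol K u t =
      (ContinuousLinearMap.mul ℂ ℂ).lpPairing volume 2 2 (memLp_comp_sub_left hK t).toLp u := by
    rw [ContinuousLinearMap.lpPairing_eq_integral]
    refine integral_congr_ae ?_
    filter_upwards [(memLp_comp_sub_left hK t).coeFn_toLp] with s hs
    rw [hs]; rfl
  simp only [hL]
  exact (ContinuousLinearMap.continuous _).continuousAt.tendsto.comp h

lemma convOp_ae_eq_convol {K : ℝ → ℂ} (hK : Integrable K) (hK2 : MemLp K 2)
    (f : Lp ℂ 2 (volume : Measure ℝ)) : convOp K hK f =ᵐ[volume] convol K f := by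
  refine DenseRange.induction_on (p := fun f : Lp ℂ 2 (volume : Measure ℝ) =>
      convOp K hK f =ᵐ[volume] convol K f)
    (SchwartzMap.denseRange_toLpCLM (p := 2) ENNReal.ofNat_ne_top) f ?_ ?_
  · refine isSeqClosed_iff_isClosed.1 fun u g hu hug => ?_
    have h1 : Tendsto (fun n => convOp K hK (u n)) atTop (𝓝 (convOp K hK g)) :=
      (convOp K hK).continuous.continuousAt.tendsto.comp hug
    obtain ⟨ns, hns, h2⟩ := (tendstoInMeasure_of_tendsto_Lp h1).exists_seq_tendsto_ae
    have h3 : ∀ᵐ t, ∀ n, convOp K hK (u n) t = convol K (u n) t := ae_all_iff.2 hu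
    filter_upwards [h2, h3] with t h4 h5
    simp only [h5] at h4
    exact tendsto_nhds_unique h4 ((tendsto_convol hK2 hug t).comp hns.tendsto_atTop)
  · intro φ
    refine convOp_ae_eq_convol_of_integrable hK ?_
    exact φ.integrable.congr (φ.coeFn_toLp 2 volume).symm

lemma isUnit_of_isUnit_of_bounded_below {X E : Type*} [TopologicalSpace X] [PreconnectedSpace X]
    [NormedAddCommGroup E] [NormedSpace ℂ E] [CompleteSpace E] {A : X → E →L[ℂ] E}
    (hA : Continuous A) {κ : ℝ} (hκ : 0 < κ) (h : ∀ a x, κ * ‖x‖ ≤ ‖A a x‖) {b : X}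
    (hb : IsUnit (A b)) (a : X) : IsUnit (A a) := by
  have hopen : IsOpen {a | IsUnit (A a)} := Units.isOpen.preimage hA
  have hclosed : IsClosed {a | IsUnit (A a)} := by
    refine isClosed_of_closure_subset fun a ha => ?_
    have hnear : ∀ᶠ c in 𝓝 a, ‖A a - A c‖ < κ := by
      have h1 : ContinuousAt (fun c => ‖A a - A c‖) a := by fun_prop
      refine h1.eventually (gt_mem_nhds ?_)
      simpa using hκ
    obtain ⟨c, ⟨u, hu⟩, hc⟩ := ((mem_closure_iff_frequently.1 ha).and_eventually hnear).exists
    have h2 : ‖(↑u⁻¹ : E →L[ℂ] E)‖ ≤ κ⁻¹ := by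
      refine ContinuousLinearMap.opNorm_le_bound _ (by positivity) fun x => ?_
      have h3 := h c ((↑u⁻¹ : E →L[ℂ] E) x)
      rw [← hu, ← mul_apply_eq_comp, u.mul_inv] at h3
      rw [inv_mul_eq_div, le_div_iff₀ hκ, mul_comm]
      simpa using h3
    have h4 : A a = A c * (1 + (↑u⁻¹ : E →L[ℂ] E) * (A a - A c)) := by
      rw [mul_add, ← mul_assoc, ← hu, u.mul_inv]; simp
    have h5 : ‖-((↑u⁻¹ : E →L[ℂ] E) * (A a - A c))‖ < 1 := by
      rw [norm_neg]
      calc _ ≤ ‖(↑u⁻¹ : E →L[ℂ] E)‖ * ‖A a - A c‖ := norm_mul_le _ _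
        _ ≤ κ⁻¹ * ‖A a - A c‖ := by gcongr
        _ < κ⁻¹ * κ := by gcongr
        _ = 1 := inv_mul_cancel₀ hκ.ne'
    have h6 := (Units.oneSub _ h5).isUnit
    rw [Units.val_oneSub, sub_neg_eq_add] at h6
    show IsUnit (A a)
    rw [h4]
    exact (hu ▸ u.isUnit).mul h6
  have : {a | IsUnit (A a)} = univ := IsClopen.eq_univ ⟨hclosed, hopen⟩ ⟨b, hb⟩
  exact this.ge (mem_univ a)

/-- Method of continuity for a family of operators `1 - T a` uniformly bounded below. -/
lemma exists_sub_eq_of_bounded_below {X E : Type*} [TopologicalSpace X] [PreconnectedSpace X]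
    [NormedAddCommGroup E] [NormedSpace ℂ E] [CompleteSpace E] (T : X → E →L[ℂ] E)
    {δ : X → X → ℝ} (hδ : ∀ b, Tendsto (fun a => δ a b) (𝓝 b) (𝓝 0))
    (hT : ∀ a b, ‖T a - T b‖ ≤ δ a b) {κ : ℝ} (hκ : 0 < κ)
    (h : ∀ a x, κ * ‖x‖ ≤ ‖x - T a x‖) {b : X} (hb : ‖T b‖ < 1) (a : X) (F : E) :
    ∃ u, u - T a u = F := by
  have hA : Continuous fun a => 1 - T a := by
    refine continuous_const.sub (continuous_iff_continuousAt.2 fun b => ?_)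
    exact tendsto_iff_norm_sub_tendsto_zero.2
      (squeeze_zero (fun _ => norm_nonneg _) (fun a => hT a b) (hδ b))
  obtain ⟨v, hv⟩ := isUnit_of_isUnit_of_bounded_below hA hκ (fun a x => h a x)
    (isUnit_one_sub_of_norm_lt_one hb) a
  refine ⟨(↑v⁻¹ : E →L[ℂ] E) F, ?_⟩
  have h1 : (1 - T a) ((↑v⁻¹ : E →L[ℂ] E) F) = F := by
    rw [← hv, ← mul_apply_eq_comp, v.mul_inv]; rfl
  exact h1

/-- The subspace of `L²` functions vanishing on the negative half-line. -/
def causalLp : Submodule ℂ (Lp ℂ 2 (volume : Measure ℝ)) :=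
  (LpToLpRestrictCLM ℝ ℂ ℂ volume 2 (Iio 0)).ker

lemma mem_causalLp {f : Lp ℂ 2 (volume : Measure ℝ)} :
    f ∈ causalLp ↔ ∀ᵐ t, t < 0 → f t = 0 := by
  rw [causalLp, LinearMap.mem_ker, ContinuousLinearMap.coe_coe, Lp.eq_zero_iff_ae_eq_zero]
  have h := LpToLpRestrictCLM_coeFn ℂ (Iio 0) f
  have h2 : (∀ᵐ t, t < 0 → f t = 0) ↔ f =ᵐ[volume.restrict (Iio 0)] (0 : ℝ → ℂ) := by
    rw [EventuallyEq, ae_restrict_iff' measurableSet_Iio]; rfl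
  rw [h2]
  exact ⟨fun h1 => h.symm.trans h1, fun h1 => h.trans h1⟩

instance : CompleteSpace causalLp :=
  (ContinuousLinearMap.isClosed_ker (LpToLpRestrictCLM ℝ ℂ ℂ volume 2 (Iio 0))).completeSpace_coe

lemma convol_eq_zero_of_neg {K f : ℝ → ℂ} (hK : ∀ t < 0, K t = 0)
    (hf : ∀ᵐ t, t < 0 → f t = 0) {t : ℝ} (ht : t < 0) : convol K f t = 0 := by
  refine integral_eq_zero_of_ae ?_
  filter_upwards [hf] with s hs
  rcases lt_or_ge s 0 with h | h
  · simp [hs h]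
  · simp [hK (t - s) (by linarith)]

lemma convOp_mem_causalLp {K : ℝ → ℂ} (hK : Integrable K) (hK2 : MemLp K 2)
    (hK0 : ∀ t < 0, K t = 0) {f : Lp ℂ 2 (volume : Measure ℝ)} (hf : f ∈ causalLp) :
    convOp K hK f ∈ causalLp := by
  rw [mem_causalLp] at hf ⊢
  filter_upwards [convOp_ae_eq_convol hK hK2 f] with t ht h0
  rw [ht, convol_eq_zero_of_neg hK0 hf h0]

/-- The function `f` damped by `e^{-at}`. -/
def damp (a : ℝ) (f : ℝ → ℂ) (t : ℝ) : ℂ := (Real.exp (-a * t) : ℂ) * f t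

lemma norm_damp_le {K : ℝ → ℂ} (hK0 : ∀ t < 0, K t = 0) {a : ℝ} (ha : 0 ≤ a) (t : ℝ) :
    ‖damp a K t‖ ≤ ‖K t‖ := by
  rcases lt_or_ge t 0 with h | h
  · simp [damp, hK0 t h]
  · rw [damp, norm_mul, Complex.norm_real, Real.norm_of_nonneg (Real.exp_pos _).le]
    refine mul_le_of_le_one_left (norm_nonneg _) (Real.exp_le_one_iff.2 ?_)
    nlinarith [mul_nonneg ha h]

lemma aestronglyMeasurable_damp {f : ℝ → ℂ} (hf : AEStronglyMeasurable f) (a : ℝ) :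
    AEStronglyMeasurable (damp a f) := by
  refine AEStronglyMeasurable.mul (Continuous.aestronglyMeasurable ?_) hf
  fun_prop

lemma memLp_damp {p : ℝ≥0∞} {K : ℝ → ℂ} (hK : MemLp K p) (hK0 : ∀ t < 0, K t = 0) {a : ℝ}
    (ha : 0 ≤ a) : MemLp (damp a K) p :=
  hK.of_le (aestronglyMeasurable_damp hK.1 a) (Eventually.of_forall (norm_damp_le hK0 ha))

lemma integrable_damp {K : ℝ → ℂ} (hK : Integrable K) (hK0 : ∀ t < 0, K t = 0) {a : ℝ}
    (ha : 0 ≤ a) : Integrable (damp a K) :=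
  hK.mono (aestronglyMeasurable_damp hK.1 a) (Eventually.of_forall (norm_damp_le hK0 ha))

lemma damp_zero (f : ℝ → ℂ) : damp 0 f = f := by ext; simp [damp]

lemma damp_of_neg {K : ℝ → ℂ} (hK0 : ∀ t < 0, K t = 0) (a : ℝ) : ∀ t < 0, damp a K t = 0 :=
  fun t ht => by simp [damp, hK0 t ht]

/-- The restriction of `convOp` to causal functions. -/
def causalConvOp (K : ℝ → ℂ) (hK : Integrable K) (hK2 : MemLp K 2) (hK0 : ∀ t < 0, K t = 0) :
    causalLp →L[ℂ] causalLp :=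
  (convOp K hK ∘L causalLp.subtypeL).codRestrict causalLp
    fun f => convOp_mem_causalLp hK hK2 hK0 f.2

lemma norm_causalConvOp_sub_le {K L : ℝ → ℂ} (hK : Integrable K) (hK2 : MemLp K 2)
    (hK0 : ∀ t < 0, K t = 0) (hL : Integrable L) (hL2 : MemLp L 2) (hL0 : ∀ t < 0, L t = 0) :
    ‖causalConvOp K hK hK2 hK0 - causalConvOp L hL hL2 hL0‖ ≤ ∫ t, ‖K t - L t‖ := by
  refine ContinuousLinearMap.opNorm_le_bound _ (integral_nonneg fun _ => norm_nonneg _) fun f => ?_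
  have h : ‖convOp K hK f.1 - convOp L hL f.1‖ ≤ (∫ t, ‖K t - L t‖) * ‖f.1‖ :=
    ((convOp K hK - convOp L hL).le_opNorm f.1).trans
      (mul_le_mul_of_nonneg_right (norm_convOp_sub_le hK hL) (norm_nonneg _))
  exact h

lemma norm_causalConvOp_le {K : ℝ → ℂ} (hK : Integrable K) (hK2 : MemLp K 2)
    (hK0 : ∀ t < 0, K t = 0) : ‖causalConvOp K hK hK2 hK0‖ ≤ ∫ t, ‖K t‖ := by
  refine ContinuousLinearMap.opNorm_le_bound _ (integral_nonneg fun _ => norm_nonneg _) fun f => ?_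
  exact ((convOp K hK).le_opNorm f.1).trans
      (mul_le_mul_of_nonneg_right (norm_convOp_le hK) (norm_nonneg _))

lemma tendsto_integral_norm_damp {K : ℝ → ℂ} (hK : Integrable K) (hK0 : ∀ t < 0, K t = 0) :
    Tendsto (fun a : ℝ≥0 => ∫ t, ‖damp a K t‖) atTop (𝓝 0) := by
  rw [← integral_zero ℝ ℝ (μ := volume)]
  refine tendsto_integral_filter_of_dominated_convergence (fun t => ‖K t‖)
    (Eventually.of_forall fun a => (aestronglyMeasurable_damp hK.1 a).norm)
    (Eventually.of_forall fun a => Eventually.of_forall fun t => ?_) hK.norm ?_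
  · rw [norm_norm]; exact norm_damp_le hK0 a.2 t
  · filter_upwards [compl_mem_ae_iff.2 (measure_singleton (0 : ℝ))] with t ht
    rcases lt_or_gt_of_ne (show t ≠ 0 from ht) with h | h
    · simp [damp, hK0 t h]
    · have h1 : Tendsto (fun a : ℝ≥0 => Real.exp (-a * t)) atTop (𝓝 0) := by
        refine Real.tendsto_exp_atBot.comp ?_
        simp only [neg_mul]
        exact tendsto_neg_atTop_atBot.comp
          ((NNReal.tendsto_coe_atTop.2 tendsto_id).atTop_mul_const h)
      have h2 := h1.mul_const ‖K t‖
      rw [zero_mul] at h2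
      refine h2.congr fun a => ?_
      rw [damp, norm_mul, Complex.norm_real, Real.norm_of_nonneg (Real.exp_pos _).le]

/-- Solvability of the causal convolution equation `u - K * u = F` in `L²`, under the
non-vanishing of `1 - K̂` in the closed half-plane. -/
lemma exists_causal_solution {K : ℝ → ℂ} (hK : Integrable K) (hK2 : MemLp K 2)
    (hK0 : ∀ t < 0, K t = 0) {κ : ℝ} (hκ : 0 < κ)
    (h : ∀ a : ℝ, 0 ≤ a → ∀ w, κ ≤ ‖1 - 𝓕 (damp a K) w‖)
    {F : Lp ℂ 2 (volume : Measure ℝ)} (hF : F ∈ causalLp) :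
    ∃ u ∈ causalLp, u - convOp K hK u = F := by
  have hδ : ∀ b : ℝ≥0,
      Tendsto (fun a : ℝ≥0 => ∫ t, ‖damp a K t - damp b K t‖) (𝓝 b) (𝓝 0) := fun b => by
    have : Tendsto (fun a : ℝ≥0 => ∫ t, ‖damp a K t - damp b K t‖) (𝓝 b)
        (𝓝 (∫ t, ‖damp b K t - damp b K t‖)) := by
      refine tendsto_integral_filter_of_dominated_convergence (fun t => ‖K t‖ + ‖K t‖)
        (Eventually.of_forall fun a => ((aestronglyMeasurable_damp hK.1 a).sub
          (aestronglyMeasurable_damp hK.1 b)).norm)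
        (Eventually.of_forall fun a => Eventually.of_forall fun t => ?_)
        (hK.norm.add hK.norm) (Eventually.of_forall fun t => ?_)
      · rw [norm_norm]
        refine (norm_sub_le _ _).trans ?_
        gcongr
        exacts [norm_damp_le hK0 a.2 t, norm_damp_le hK0 b.2 t]
      · have : Continuous fun a : ℝ≥0 => ‖damp a K t - damp b K t‖ := by
          unfold damp; fun_prop
        exact this.tendsto b
    simpa using this
  obtain ⟨b, hb⟩ := ((tendsto_integral_norm_damp hK hK0).eventually
    (gt_mem_nhds one_pos)).exists
  obtain ⟨u, hu⟩ := exists_sub_eq_of_bounded_below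
    (fun a : ℝ≥0 => causalConvOp (damp a K) (integrable_damp hK hK0 a.2)
      (memLp_damp hK2 hK0 a.2) (damp_of_neg hK0 a)) hδ
    (fun a b => norm_causalConvOp_sub_le _ _ _ _ _ _) hκ
    (fun a x => le_norm_sub_convOp (integrable_damp hK hK0 a.2) hκ (h a a.2) x.1)
    ((norm_causalConvOp_le _ _ _).trans_lt hb) 0 ⟨F, hF⟩
  refine ⟨u, u.2, ?_⟩
  have h3 : convOp (damp (0 : ℝ≥0) K) (integrable_damp hK hK0 (0 : ℝ≥0).2) = convOp K hK := by
    congr 1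
    exact damp_zero K
  rw [← h3]
  exact congrArg Subtype.val hu

lemma convol_congr {K f g : ℝ → ℂ} (h : f =ᵐ[volume] g) : convol K f = convol K g := by
  ext t
  refine integral_congr_ae ?_
  filter_upwards [h] with s hs
  rw [hs]

lemma convOp_toLp_ae_eq {K f : ℝ → ℂ} (hK : Integrable K) (hK2 : MemLp K 2) (hf : MemLp f 2) :
    convOp K hK hf.toLp =ᵐ[volume] convol K f := by
  have := convOp_ae_eq_convol hK hK2 hf.toLp
  rwa [convol_congr hf.coeFn_toLp] at this

lemma memLp_convol {K f : ℝ → ℂ} (hK : Integrable K) (hK2 : MemLp K 2) (hf : MemLp f 2) :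
    MemLp (convol K f) 2 :=
  (memLp_congr_ae (convOp_toLp_ae_eq hK hK2 hf)).1 (Lp.memLp _)

lemma ae_eq_zero_of_ae_eq_convol {K f : ℝ → ℂ} (hK : Integrable K) (hK2 : MemLp K 2) {κ : ℝ}
    (hκ : 0 < κ) (h : ∀ w, κ ≤ ‖1 - 𝓕 K w‖) (hf : MemLp f 2) (hfK : f =ᵐ[volume] convol K f) :
    f =ᵐ[volume] 0 := by
  have h1 := le_norm_sub_convOp hK hκ h hf.toLp
  have h2 : hf.toLp = convOp K hK hf.toLp :=
    Lp.ext ((hf.coeFn_toLp.trans hfK).trans (convOp_toLp_ae_eq hK hK2 hf).symm)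
  rw [← h2, sub_self, norm_zero] at h1
  have h3 : ‖hf.toLp‖ = 0 := by nlinarith [norm_nonneg hf.toLp]
  have h4 := hf.coeFn_toLp.symm
  rw [norm_eq_zero.1 h3] at h4
  exact h4.trans (Lp.coeFn_zero _ _ _)

lemma exists_memLp_causal_solution {K : ℝ → ℂ} (hK : Integrable K) (hK2 : MemLp K 2)
    (hK0 : ∀ t < 0, K t = 0) {κ : ℝ} (hκ : 0 < κ)
    (h : ∀ a : ℝ, 0 ≤ a → ∀ w, κ ≤ ‖1 - 𝓕 (damp a K) w‖)
    {G : ℝ → ℂ} (hG : MemLp G 2) (hG0 : ∀ t < 0, G t = 0) :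
    ∃ u : ℝ → ℂ, MemLp u 2 ∧ (∀ t < 0, u t = 0) ∧ ∀ᵐ t, u t = convol K u t + G t := by
  obtain ⟨u, hu, hKu⟩ := exists_causal_solution hK hK2 hK0 hκ h (F := hG.toLp) <| by
    rw [mem_causalLp]
    filter_upwards [hG.coeFn_toLp] with t ht h0
    rw [ht, hG0 t h0]
  have hv : (u : ℝ → ℂ) =ᵐ[volume] fun t => if t < 0 then 0 else u t := by
    filter_upwards [mem_causalLp.1 hu] with t ht
    split_ifs with h0
    exacts [ht h0, rfl]
  refine ⟨_, (memLp_congr_ae hv).1 (Lp.memLp u), fun t ht => if_pos ht, ?_⟩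
  rw [← convol_congr hv]
  have h1 := Lp.coeFn_sub u (convOp K hK u)
  rw [hKu] at h1
  filter_upwards [h1, hv, hG.coeFn_toLp, convOp_ae_eq_convol hK hK2 u] with t h1 h2 h3 h4
  rw [← h2, ← h3, h1, Pi.sub_apply, h4]
  ring

lemma damp_convol (a : ℝ) (K f : ℝ → ℂ) (t : ℝ) :
    convol (damp a K) (damp a f) t = damp a (convol K f) t := by
  simp only [convol, damp]
  rw [← integral_const_mul]
  congr 1 with s
  rw [show (-a * t) = -a * (t - s) + -a * s by ring, Real.exp_add]
  push_cast
  ring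

lemma memLp_damp_pow_mul {r : ℝ → ℂ} (hr : MemLp r 2) (hr0 : ∀ t < 0, r t = 0) (j : ℕ) :
    MemLp (damp 1 fun t => (t : ℂ) ^ j * r t) 2 := by
  refine (hr.const_mul (j.factorial : ℂ)).of_le (aestronglyMeasurable_damp
    ((Continuous.aestronglyMeasurable (by fun_prop)).mul hr.1) 1)
    (Eventually.of_forall fun t => ?_)
  rcases lt_or_ge t 0 with h | h
  · simp [damp, hr0 t h]
  · have h1 := Real.pow_div_factorial_le_exp t h j
    have h2 : t ^ j * Real.exp (-t) ≤ j.factorial := by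
      rw [Real.exp_neg, ← div_eq_mul_inv, div_le_iff₀ (Real.exp_pos _)]
      rw [div_le_iff₀ (by positivity)] at h1
      linarith
    simp only [damp, norm_mul, norm_pow, Complex.norm_real, Complex.norm_natCast, neg_mul, one_mul,
      Real.norm_of_nonneg (Real.exp_pos _).le, Real.norm_of_nonneg h]
    rw [← mul_assoc, mul_comm (Real.exp _)]
    exact mul_le_mul_of_nonneg_right h2 (norm_nonneg _)

lemma integrable_of_damp {K f : ℝ → ℂ} {a : ℝ} (hK : MemLp (damp a K) 2)
    (hf : MemLp (damp a f) 2) (t : ℝ) : Integrable fun s => K (t - s) * f s := by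
  refine ((integrable_convol_integrand hK hf t).const_mul (Real.exp (a * t) : ℂ)).congr
    (Eventually.of_forall fun s => ?_)
  have h : (Real.exp (a * t) * (Real.exp (-a * (t - s)) * Real.exp (-a * s)) : ℂ) = 1 := by
    norm_cast
    rw [← Real.exp_add, ← Real.exp_add, Real.exp_eq_one_iff]
    ring
  simp only [damp]
  linear_combination K (t - s) * f s * h

/-- Leibniz formula for the moments of a convolution. -/
lemma convol_pow_mul {K r : ℝ → ℂ} {j : ℕ} {t : ℝ}
    (h : ∀ i ≤ j, Integrable fun s => (((t - s : ℝ) : ℂ) ^ (j - i) * K (t - s)) *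
      ((s : ℂ) ^ i * r s)) :
    (t : ℂ) ^ j * convol K r t = convol K (fun s => (s : ℂ) ^ j * r s) t +
      ∑ i ∈ Finset.range j, (j.choose i : ℂ) *
        convol (fun s => (s : ℂ) ^ (j - i) * K s) (fun s => (s : ℂ) ^ i * r s) t := by
  have h1 : ∀ s : ℝ, (t : ℂ) ^ j * (K (t - s) * r s) = ∑ i ∈ Finset.range (j + 1),
      (j.choose i : ℂ) * ((((t - s : ℝ) : ℂ) ^ (j - i) * K (t - s)) * ((s : ℂ) ^ i * r s)) := by
    intro s
    have h2 : (t : ℂ) = s + (t - s : ℝ) := by push_cast; ring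
    conv_lhs => rw [h2, add_pow, Finset.sum_mul]
    refine Finset.sum_congr rfl fun i _ => ?_
    ring
  rw [convol, ← integral_const_mul]
  simp_rw [h1]
  rw [integral_finsetSum _ fun i hi => (h i (by grind)).const_mul _, Finset.sum_range_succ,
    add_comm]
  simp [convol, integral_const_mul]

/-- Moments of the kernel are inherited by the solution of the resolvent equation. -/
lemma memLp_pow_mul_resolvent {K r : ℝ → ℂ} {N : ℕ}
    (hK : ∀ j ≤ N, Integrable fun t : ℝ => (t : ℂ) ^ j * K t)
    (hK2 : ∀ j ≤ N, MemLp (fun t : ℝ => (t : ℂ) ^ j * K t) 2)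
    (hK0 : ∀ t < 0, K t = 0) {κ : ℝ} (hκ : 0 < κ)
    (h : ∀ a : ℝ, 0 ≤ a → ∀ w, κ ≤ ‖1 - 𝓕 (damp a K) w‖)
    (hr : MemLp r 2) (hr0 : ∀ t < 0, r t = 0) (hrK : ∀ᵐ t, r t = convol K r t + K t) (j : ℕ) :
    j ≤ N → MemLp (fun t : ℝ => (t : ℂ) ^ j * r t) 2 := by
  have hKi : Integrable K := by simpa using hK 0 (Nat.zero_le _)
  have hK2' : MemLp K 2 := by simpa using hK2 0 (Nat.zero_le _)
  induction j using Nat.strong_induction_on with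
  | _ j ih =>
  intro hj
  set v : ℝ → ℂ := fun t => (t : ℂ) ^ j * r t with hv
  set S : ℝ → ℂ := fun t => ∑ i ∈ Finset.range j, (j.choose i : ℂ) *
        convol (fun s => (s : ℂ) ^ (j - i) * K s) (fun s => (s : ℂ) ^ i * r s) t with hS
  have hS2 : MemLp S 2 := by
    refine memLp_finsetSum (Finset.range j) fun i hi => ?_
    rw [Finset.mem_range] at hi
    exact (memLp_convol (hK _ (by omega)) (hK2 _ (by omega)) (ih i hi (by omega))).const_mul _
  have hS0 : ∀ t < 0, S t = 0 := fun t ht => Finset.sum_eq_zero fun i _ => by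
    rw [convol_eq_zero_of_neg (fun s hs => by simp [hK0 s hs])
      (Eventually.of_forall fun s hs => by simp [hr0 s hs]) ht, mul_zero]
  obtain ⟨u, hu, hu0, huK⟩ := exists_memLp_causal_solution hKi hK2' hK0 hκ h
    (G := fun t => (t : ℂ) ^ j * K t + S t) ((hK2 j hj).add hS2)
    (fun t ht => by simp [hK0 t ht, hS0 t ht])
  have hKd : MemLp (damp 1 K) 2 := memLp_damp hK2' hK0 zero_le_one
  have hud : MemLp (damp 1 u) 2 := memLp_damp hu hu0 zero_le_one
  have hvd : MemLp (damp 1 v) 2 := memLp_damp_pow_mul hr hr0 j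
  have hvK : ∀ t : ℝ, (t : ℂ) ^ j * convol K r t = convol K v t + S t := fun t => by
    refine convol_pow_mul fun i hi => ?_
    rcases hi.lt_or_eq with hi | rfl
    · exact integrable_convol_integrand (hK2 (j - i) (by omega)) (ih i hi (by omega)) t
    · simpa using integrable_of_damp hKd hvd t
  have hd : (fun t => damp 1 u t - damp 1 v t) =ᵐ[volume] 0 := by
    refine ae_eq_zero_of_ae_eq_convol (integrable_damp hKi hK0 zero_le_one) hKd hκ
      (h 1 zero_le_one) (hud.sub hvd) ?_
    filter_upwards [huK, hrK] with t h1 h2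
    have h3 : convol (damp 1 K) (fun t => damp 1 u t - damp 1 v t) t =
        damp 1 (convol K u) t - damp 1 (convol K v) t := by
      rw [← damp_convol, ← damp_convol]
      simp only [convol, mul_sub]
      exact integral_sub (integrable_convol_integrand hKd hud t)
        (integrable_convol_integrand hKd hvd t)
    rw [h3]
    simp only [damp]
    have h4 : v t = convol K v t + S t + (t : ℂ) ^ j * K t := by
      rw [← hvK, hv]; simp only; conv_lhs => rw [h2]
      ring
    rw [h1, h4]
    ring
  refine (memLp_congr_ae ?_).1 hu
  filter_upwards [hd] with t ht
  simp only [damp, Pi.zero_apply, ← mul_sub, mul_eq_zero, Complex.ofReal_eq_zero,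
    (Real.exp_pos _).ne', false_or] at ht
  exact sub_eq_zero.1 ht

lemma integrable_of_memLp_two_of_mul {f : ℝ → ℂ} (h0 : MemLp f 2)
    (h1 : MemLp (fun t : ℝ => (t : ℂ) * f t) 2) : Integrable f := by
  have hw : MemLp (fun t : ℝ => (1 + |t|)⁻¹) 2 := by
    have hc : Continuous fun t : ℝ => (1 + |t|)⁻¹ :=
      Continuous.inv₀ (by fun_prop) fun t => by positivity
    rw [memLp_two_iff_integrable_sq hc.aestronglyMeasurable]
    refine integrable_inv_one_add_sq.mono (hc.pow 2).aestronglyMeasurable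
      (Eventually.of_forall fun t => ?_)
    rw [Real.norm_of_nonneg (by positivity), Real.norm_of_nonneg (by positivity), inv_pow]
    gcongr
    nlinarith [abs_nonneg t, sq_abs t]
  have hg : MemLp (fun t => ‖f t‖ + ‖(t : ℂ) * f t‖) 2 := h0.norm.add h1.norm
  refine (hw.integrable_mul hg).mono h0.1 (Eventually.of_forall fun t => ?_)
  simp only [Pi.mul_apply, norm_mul, Complex.norm_real, Real.norm_eq_abs]
  rw [show ‖f t‖ + |t| * ‖f t‖ = (1 + |t|) * ‖f t‖ by ring,
    abs_of_nonneg (show 0 ≤ (1 + |t|) * ‖f t‖ by positivity), abs_of_nonneg (by positivity),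
    inv_mul_cancel_left₀ (by positivity)]

/-- Existence of an integrable resolvent kernel with moments. -/
lemma exists_resolvent {K : ℝ → ℂ} {γ : ℕ}
    (hK2 : ∀ j ≤ γ + 2, MemLp (fun t : ℝ => (t : ℂ) ^ j * K t) 2)
    (hK0 : ∀ t < 0, K t = 0) {κ : ℝ} (hκ : 0 < κ)
    (h : ∀ a : ℝ, 0 ≤ a → ∀ w, κ ≤ ‖1 - 𝓕 (damp a K) w‖) :
    ∃ r : ℝ → ℂ, (∀ t < 0, r t = 0) ∧ (∀ᵐ t, r t = convol K r t + K t) ∧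
      Integrable r ∧ Integrable fun t : ℝ => (t : ℂ) ^ γ * r t := by
  have hK : ∀ j ≤ γ + 1, Integrable fun t : ℝ => (t : ℂ) ^ j * K t := fun j hj => by
    refine integrable_of_memLp_two_of_mul (hK2 j (by omega)) ?_
    simpa only [← mul_assoc, ← pow_succ'] using hK2 (j + 1) (by omega)
  have hKi : Integrable K := by simpa using hK 0 (by omega)
  have hK2' : MemLp K 2 := by simpa using hK2 0 (by omega)
  obtain ⟨r, hr, hr0, hrK⟩ := exists_memLp_causal_solution hKi hK2' hK0 hκ h hK2' hK0
  have hm := memLp_pow_mul_resolvent hK (fun j hj => hK2 j (by omega)) hK0 hκ h hr hr0 hrK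
  refine ⟨r, hr0, hrK, integrable_of_memLp_two_of_mul hr (by simpa using hm 1 (by omega)),
    integrable_of_memLp_two_of_mul (hm γ (by omega)) ?_⟩
  simpa only [← mul_assoc, ← pow_succ'] using hm (γ + 1) le_rfl

lemma jap_pos (t : ℝ) : 0 < jap t := Real.sqrt_pos.2 (by positivity)

lemma continuous_jap : Continuous jap := by unfold jap; fun_prop

lemma jap_le (t : ℝ) : jap t ≤ 1 + |t| := by
  rw [jap, Real.sqrt_le_left (by positivity)]
  nlinarith [abs_nonneg t, sq_abs t]

lemma jap_le_mul (t s : ℝ) : jap t ≤ 2 * (jap (t - s) * jap s) := by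
  rw [jap, jap, jap, ← Real.sqrt_mul (by positivity), Real.sqrt_le_left (by positivity), mul_pow,
    Real.sq_sqrt (by positivity)]
  nlinarith [sq_nonneg (t - s - s), sq_nonneg ((t - s) * s), sq_nonneg (t - s), sq_nonneg s]

lemma integrable_jap_pow_mul {r : ℝ → ℂ} {γ : ℕ} (hr : Integrable r)
    (hr2 : Integrable fun t : ℝ => (t : ℂ) ^ γ * r t) :
    Integrable fun t => jap t ^ γ * ‖r t‖ := by
  refine ((hr.norm.add hr2.norm).const_mul (2 ^ (γ - 1) : ℝ)).mono
    ((continuous_jap.pow γ).aestronglyMeasurable.mul hr.1.norm) (Eventually.of_forall fun t => ?_)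
  have h1 : jap t ^ γ ≤ 2 ^ (γ - 1) * (1 + |t| ^ γ) := by
    have := add_pow_le zero_le_one (abs_nonneg t) γ
    rw [one_pow] at this
    exact (pow_le_pow_left₀ (jap_pos t).le (jap_le t) γ).trans this
  have := jap_pos t
  simp only [Pi.add_apply, norm_mul, norm_pow, Complex.norm_real]
  rw [Real.norm_of_nonneg (by positivity), norm_norm, Real.norm_of_nonneg (by positivity),
    Real.norm_of_nonneg (by positivity), Real.norm_eq_abs]
  calc _ ≤ 2 ^ (γ - 1) * (1 + |t| ^ γ) * ‖r t‖ := by gcongr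
    _ = _ := by ring

lemma fourier_add_apply {f g : ℝ → ℂ} (hf : Integrable f) (hg : Integrable g) (w : ℝ) :
    𝓕 (fun t => f t + g t) w = 𝓕 f w + 𝓕 g w := by
  simp only [Real.fourier_eq, smul_add]
  exact integral_add ((Real.fourierIntegral_convergent_iff w).2 hf)
    ((Real.fourierIntegral_convergent_iff w).2 hg)

lemma ae_eq_of_fourier_eq {f g : ℝ → ℂ} (hf : Integrable f) (hg : Integrable g)
    (h : 𝓕 f = 𝓕 g) : f =ᵐ[volume] g := by
  have h1 : (fun t => f t - g t) =ᵐ[volume] (0 : Lp ℂ 2 (volume : Measure ℝ)) := by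
    refine ae_eq_of_fourier_ae_eq (hf.sub hg) ?_
    have h2 : 𝓕 f = 𝓕 (fun t => f t - g t) + 𝓕 g := by
      ext w
      have := fourier_add_apply (hf.sub hg) hg w
      simpa using! this
    have h3 : 𝓕 (fun t => f t - g t) = 0 := by rwa [h, right_eq_add] at h2
    change 𝓕 (fun t => f t - g t) =ᵐ[volume] _
    rw [h3, show (𝓕 (0 : Lp ℂ 2 (volume : Measure ℝ)) : Lp ℂ 2 (volume : Measure ℝ)) = 0 from
      (Lp.fourierTransformₗᵢ ℝ ℂ).map_zero]
    exact (Lp.coeFn_zero _ _ _).symm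
  filter_upwards [h1, Lp.coeFn_zero ℂ 2 (volume : Measure ℝ)] with t h1 h2
  rw [h2] at h1
  exact sub_eq_zero.1 h1

/-- Inversion of `z ↦ z - K * z` through the resolvent kernel. -/
lemma ae_eq_add_convol_resolvent {K r z G : ℝ → ℂ} (hK : Integrable K) (hr : Integrable r)
    (hrK : ∀ᵐ t, r t = convol K r t + K t) (hz : Integrable z)
    (hG : ∀ t, z t = convol K z t + G t) :
    ∀ᵐ t, z t = G t + convol r G t := by
  have hGi : Integrable G := (hz.sub (integrable_convol hK hz)).congr
    (Eventually.of_forall fun t => by simp [hG t])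
  refine ae_eq_of_fourier_eq hz (hGi.add (integrable_convol hr hGi)) ?_
  ext w
  have h1 : 𝓕 r w = 𝓕 K w * 𝓕 r w + 𝓕 K w := by
    conv_lhs => rw [Real.fourier_congr_ae hrK]
    rw [fourier_add_apply (integrable_convol hK hr) hK, fourier_convol hK hr]
  have h2 : 𝓕 z w = 𝓕 K w * 𝓕 z w + 𝓕 G w := by
    conv_lhs => rw [show z = fun t => convol K z t + G t from funext hG]
    rw [fourier_add_apply (integrable_convol hK hz) hGi, fourier_convol hK hz]
  have h3 := fourier_add_apply hGi (integrable_convol hr hGi) w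
  rw [fourier_convol hr hGi] at h3
  refine Eq.trans ?_ h3.symm
  linear_combination (1 + 𝓕 r w) * h2 - 𝓕 z w * h1

/-- Weighted pointwise bound for `F + r * F`. -/
lemma jap_pow_mul_norm_add_convol_le {r G : ℝ → ℂ} {γ : ℕ} (hr0 : ∀ t < 0, r t = 0)
    (hr : Integrable fun t => jap t ^ γ * ‖r t‖) {T B : ℝ} (hB : 0 ≤ B) (hG0 : ∀ t < 0, G t = 0)
    (hG : ∀ t ∈ Icc 0 T, jap t ^ γ * ‖G t‖ ≤ B) {t : ℝ} (ht : t ∈ Icc 0 T) :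
    jap t ^ γ * ‖G t + convol r G t‖ ≤ (1 + 2 ^ γ * ∫ s, jap s ^ γ * ‖r s‖) * B := by
  have hp := jap_pos t
  have h1 : ∀ s, ‖(jap t ^ γ : ℂ) * (r (t - s) * G s)‖ ≤
      2 ^ γ * B * (jap (t - s) ^ γ * ‖r (t - s)‖) := fun s => by
    have hp1 := jap_pos (t - s)
    have hp2 := jap_pos s
    rcases lt_or_ge s 0 with h | h
    · rw [hG0 s h]; simp; positivity
    rcases lt_or_ge t s with h' | h'
    · rw [hr0 (t - s) (by linarith)]; simp
    have h2 := hG s ⟨h, h'.trans ht.2⟩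
    have h3 : jap t ^ γ ≤ 2 ^ γ * (jap (t - s) ^ γ * jap s ^ γ) := by
      rw [← mul_pow, ← mul_pow]
      exact pow_le_pow_left₀ hp.le (jap_le_mul t s) γ
    rw [norm_mul, norm_mul, norm_pow, Complex.norm_real, Real.norm_of_nonneg hp.le]
    calc _ ≤ 2 ^ γ * (jap (t - s) ^ γ * jap s ^ γ) * (‖r (t - s)‖ * ‖G s‖) := by gcongr
      _ = 2 ^ γ * (jap s ^ γ * ‖G s‖) * (jap (t - s) ^ γ * ‖r (t - s)‖) := by ring
      _ ≤ _ := by gcongr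
  have h4 : ‖(jap t ^ γ : ℂ) * convol r G t‖ ≤ 2 ^ γ * B * ∫ s, jap s ^ γ * ‖r s‖ := by
    rw [convol, ← integral_const_mul,
      ← integral_sub_left_eq_self (fun s => jap s ^ γ * ‖r s‖) volume t, ← integral_const_mul]
    exact norm_integral_le_of_norm_le ((hr.comp_sub_left t).const_mul _) (Eventually.of_forall h1)
  rw [norm_mul, norm_pow, Complex.norm_real, Real.norm_of_nonneg hp.le] at h4
  calc _ ≤ jap t ^ γ * (‖G t‖ + ‖convol r G t‖) := by gcongr; exact norm_add_le _ _
    _ ≤ _ := by linarith [hG t ht]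

lemma convol_indicator_Icc {K f : ℝ → ℂ} (hK0 : ∀ t < 0, K t = 0) {t T : ℝ} (ht : t ∈ Icc 0 T) :
    convol K ((Icc 0 T).indicator f) t = ∫ s in (0 : ℝ)..t, K (t - s) * f s := by
  rw [intervalIntegral.integral_of_le ht.1, ← integral_Icc_eq_integral_Ioc,
    ← integral_indicator measurableSet_Icc, convol]
  congr 1 with s
  by_cases h : s ∈ Icc 0 t
  · rw [indicator_of_mem h, indicator_of_mem (Icc_subset_Icc_right ht.2 h)]
  · rw [indicator_of_notMem h]
    by_cases h' : s ∈ Icc 0 T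
    · rw [hK0, zero_mul]
      simp only [mem_Icc, not_and, not_le] at h h'
      linarith [h h'.1]
    · rw [indicator_of_notMem h', mul_zero]

lemma le_of_ae_le_on_Icc {g : ℝ → ℝ} {T M : ℝ} (hT : 0 < T) (hg : ContinuousOn g (Icc 0 T))
    (h : ∀ᵐ t, t ∈ Icc 0 T → g t ≤ M) {t : ℝ} (ht : t ∈ Icc 0 T) : g t ≤ M := by
  have h1 := Measure.eqOn_Icc_of_ae_eq (volume : Measure ℝ) hT.ne
    (f := fun t => max (g t) M) (g := fun _ => M) ?_ (hg.sup continuousOn_const)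
    continuousOn_const ht
  · exact (le_max_left _ _).trans h1.le
  · rw [EventuallyEq, ae_restrict_iff' measurableSet_Icc]
    filter_upwards [h] with t h ht
    exact max_eq_right (h ht)

/-- Weighted estimate for a scalar Volterra equation whose kernel satisfies the Paley–Wiener
condition and has enough moments. -/
lemma exists_volterra_bound {K : ℝ → ℂ} {γ : ℕ}
    (hK2 : ∀ j ≤ γ + 2, MemLp (fun t : ℝ => (t : ℂ) ^ j * K t) 2)
    (hK0 : ∀ t < 0, K t = 0) {κ : ℝ} (hκ : 0 < κ)
    (h : ∀ a : ℝ, 0 ≤ a → ∀ w, κ ≤ ‖1 - 𝓕 (damp a K) w‖) :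
    ∃ C > 0, ∀ T : ℝ, 0 ≤ T → ∀ F ζ : ℝ → ℂ, ContinuousOn ζ (Icc 0 T) →
      (∀ t ∈ Icc (0 : ℝ) T, ζ t = (∫ σ in (0 : ℝ)..t, K (t - σ) * ζ σ) + F t) →
      ∀ B : ℝ, (∀ t ∈ Icc (0 : ℝ) T, jap t ^ γ * ‖F t‖ ≤ B) →
        ∀ t ∈ Icc (0 : ℝ) T, jap t ^ γ * ‖ζ t‖ ≤ C * B := by
  obtain ⟨r, hr0, hrK, hr, hrγ⟩ := exists_resolvent hK2 hK0 hκ h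
  have hK : Integrable K := integrable_of_memLp_two_of_mul (by simpa using hK2 0 (by omega))
    (by simpa using hK2 1 (by omega))
  have hI : 0 ≤ ∫ s, jap s ^ γ * ‖r s‖ :=
    integral_nonneg fun s => mul_nonneg (pow_nonneg (jap_pos s).le _) (norm_nonneg _)
  refine ⟨1 + 2 ^ γ * ∫ s, jap s ^ γ * ‖r s‖, by positivity, ?_⟩
  intro T hT F ζ hζ hV B hB t ht
  have hB0 : 0 ≤ B :=
    (mul_nonneg (pow_nonneg (jap_pos 0).le _) (norm_nonneg _)).trans (hB 0 ⟨le_rfl, hT⟩)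
  rcases hT.eq_or_lt with rfl | hT
  · obtain rfl : t = 0 := le_antisymm ht.2 ht.1
    have h1 := hV 0 ht
    rw [intervalIntegral.integral_same, zero_add] at h1
    rw [h1]
    refine (hB 0 ht).trans (le_mul_of_one_le_left hB0 ?_)
    linarith [mul_nonneg (pow_nonneg (zero_le_two (α := ℝ)) γ) hI]
  refine le_of_ae_le_on_Icc (g := fun t => jap t ^ γ * ‖ζ t‖) hT
    ((continuous_jap.pow γ).continuousOn.mul hζ.norm) ?_ ht
  set z := (Icc 0 T).indicator ζ with hz
  set G : ℝ → ℂ := fun t => z t - convol K z t with hG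
  have hzi : Integrable z := (integrable_indicator_iff measurableSet_Icc).2 hζ.integrableOn_Icc
  have hz0 : ∀ t < 0, z t = 0 := fun t ht => indicator_of_notMem (fun h => ht.not_ge h.1) _
  have hG0 : ∀ t < 0, G t = 0 := fun t ht => by
    simp only [hG]
    rw [convol_eq_zero_of_neg hK0 (Eventually.of_forall hz0) ht, hz0 t ht, sub_zero]
  have hGF : ∀ t ∈ Icc 0 T, G t = F t := fun t ht => by
    simp only [hG]
    rw [hz, convol_indicator_Icc hK0 ht, indicator_of_mem ht, hV t ht, add_sub_cancel_left]
  filter_upwards [ae_eq_add_convol_resolvent hK hr hrK hzi (G := G) (fun t => by simp [hG])]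
    with t h1 ht
  have h2 := jap_pow_mul_norm_add_convol_le hr0 (integrable_jap_pow_mul hr hrγ) hB0 hG0
    (fun t ht => by rw [hGF t ht]; exact hB t ht) ht
  rwa [← h1, hz, indicator_of_mem ht] at h2

lemma iterate_pV_const (η : ℝ → ℂ) (q : ℕ) :
    pV^[q] (fun _ v => η v) = fun _ v => iteratedDeriv q η v := by
  induction q with
  | zero => simp
  | succ q ih => rw [Function.iterate_succ_apply', ih, iteratedDeriv_succ]; rfl

lemma MemH.contDiff_of_const {m0 : ℝ} {N : ℕ} {η : ℝ → ℂ} (hη : MemH m0 N fun _ v => η v) :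
    ContDiff ℝ N η :=
  hη.1.comp (contDiff_prodMk_right (0 : ℝ))

lemma MemH.continuous_iteratedDeriv {m0 : ℝ} {N : ℕ} {η : ℝ → ℂ}
    (hη : MemH m0 N fun _ v => η v) {q : ℕ} (hq : q ≤ N) : Continuous (iteratedDeriv q η) :=
  hη.contDiff_of_const.continuous_iteratedDeriv q (by exact_mod_cast hq)

lemma MemH.integrable_weight_mul {m0 : ℝ} {N : ℕ} {η : ℝ → ℂ} (hη : MemH m0 N fun _ v => η v)
    {q : ℕ} (hq : q ≤ N) :
    Integrable fun v : ℝ => (1 + v ^ 2) ^ m0 * ‖iteratedDeriv q η v‖ ^ 2 := by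
  have h1 := hη.2.2 0 q (by omega)
  have : (ae (volume.restrict (Ioc 0 (2 * π)))).NeBot := by
    rw [ae_neBot, Ne, Measure.restrict_eq_zero]
    simp [Real.pi_pos]
  obtain ⟨x, hx⟩ := (Integrable.prod_right_ae h1).exists
  simpa only [wInt, Function.iterate_zero, id_eq, iterate_pV_const] using hx

lemma MemH.memLp_iteratedDeriv {m0 : ℝ} (hm0 : 0 ≤ m0) {N : ℕ} {η : ℝ → ℂ}
    (hη : MemH m0 N fun _ v => η v) {q : ℕ} (hq : q ≤ N) : MemLp (iteratedDeriv q η) 2 := by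
  have hc := (hη.continuous_iteratedDeriv hq).aestronglyMeasurable (μ := volume)
  rw [memLp_two_iff_integrable_sq_norm hc]
  refine (hη.integrable_weight_mul hq).mono (hc.norm.pow 2) (Eventually.of_forall fun v => ?_)
  rw [Real.norm_of_nonneg (by positivity), Real.norm_of_nonneg (by positivity)]
  exact le_mul_of_one_le_left (by positivity)
    (Real.one_le_rpow (by nlinarith [sq_nonneg v]) hm0)

lemma MemH.integrable_iteratedDeriv {m0 : ℝ} (hm0 : 1 / 2 < m0) {N : ℕ} {η : ℝ → ℂ}
    (hη : MemH m0 N fun _ v => η v) {q : ℕ} (hq : q ≤ N) : Integrable (iteratedDeriv q η) := by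
  have hc := (hη.continuous_iteratedDeriv hq).aestronglyMeasurable (μ := volume)
  have h1 := integrable_rpow_neg_one_add_norm_sq (E := ℝ) (μ := volume) (r := 2 * m0)
    (by simp; linarith)
  refine (h1.add (hη.integrable_weight_mul hq)).mono hc (Eventually.of_forall fun v => ?_)
  have hw : 0 < (1 + v ^ 2) ^ m0 := by positivity
  simp only [Pi.add_apply, Real.norm_eq_abs, sq_abs]
  rw [abs_of_nonneg (by positivity), show -(2 * m0) / 2 = -m0 by ring,
    Real.rpow_neg (by positivity)]
  set w := (1 + v ^ 2) ^ m0
  have h2 : w * ‖iteratedDeriv q η v‖ ≤ w * (w⁻¹ + w * ‖iteratedDeriv q η v‖ ^ 2) := by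
    rw [mul_add, mul_inv_cancel₀ hw.ne']
    nlinarith [sq_nonneg (w * ‖iteratedDeriv q η v‖ - 1)]
  exact le_of_mul_le_mul_left h2 hw

lemma etaHat_eq_fourier (η : ℝ → ℂ) (ξ : ℝ) : etaHat η ξ = 𝓕 η (ξ / (2 * π)) := by
  have h := integral_fun_snd (μ := volume.restrict (Ioc 0 (2 * π))) (ν := (volume : Measure ℝ))
    fun v => η v * Complex.exp (-Complex.I * (ξ * v))
  simp only [etaHat, fHat, μTR, Int.cast_zero, Complex.ofReal_zero, zero_mul, zero_add]
  rw [h, Real.fourier_real_eq_integral_exp_smul]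
  have h2 : (volume.restrict (Ioc 0 (2 * π))).real univ = 2 * π := by
    simp [measureReal_def, Real.pi_pos.le]
  rw [h2, Complex.real_smul, ← mul_assoc]
  push_cast
  rw [one_div_mul_cancel (by simp), one_mul]
  congr 1 with v
  rw [smul_eq_mul, mul_comm]
  congr 2
  field_simp

lemma Kker_eq {n : ℤ} (hn : n = 1 ∨ n = -1) (η : ℝ → ℂ) (t : ℝ) :
    Kker η n t = if 0 ≤ t then -(1 / 2) * t * 𝓕 η (n / (2 * π) * t) else 0 := by
  have h2 : (n : ℂ) * n = 1 := by rcases hn with rfl | rfl <;> norm_num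
  rw [Kker, pcoef, if_pos hn, etaHat_eq_fourier, show (n : ℝ) * t / (2 * π) = n / (2 * π) * t by
    ring]
  congr 1
  linear_combination (-(1 / 2) * t * 𝓕 η (n / (2 * π) * t)) * h2

lemma Kker_of_neg (η : ℝ → ℂ) (n : ℤ) : ∀ t < 0, Kker η n t = 0 :=
  fun _ ht => if_neg ht.not_ge

lemma MemH.memLp_pow_mul_Kker {m0 : ℝ} (hm0 : 1 / 2 < m0) {N : ℕ} {η : ℝ → ℂ}
    (hη : MemH m0 N fun _ v => η v) {n : ℤ} (hn : n = 1 ∨ n = -1) {j : ℕ} (hj : j + 1 ≤ N) :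
    MemLp (fun t : ℝ => (t : ℂ) ^ j * Kker η n t) 2 := by
  have hn1 : |(n : ℝ)| = 1 := by rcases hn with rfl | rfl <;> norm_num
  have hc : (n : ℝ) / (2 * π) ≠ 0 :=
    div_ne_zero (abs_pos.1 (hn1 ▸ one_pos)) (by positivity)
  have hη0 : Integrable η := by simpa using hη.integrable_iteratedDeriv hm0 (Nat.zero_le N)
  have h1 := memLp_fourier (hη.integrable_iteratedDeriv hm0 hj)
    (hη.memLp_iteratedDeriv (by linarith) hj)
  have hm : Continuous fun t : ℝ => 𝓕 (iteratedDeriv (j + 1) η) (n / (2 * π) * t) :=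
    (continuous_fourier (hη.integrable_iteratedDeriv hm0 hj)).comp
    (continuous_const_mul ((n : ℝ) / (2 * π)))
  have h2 : MemLp (fun t : ℝ => 𝓕 (iteratedDeriv (j + 1) η) (n / (2 * π) * t)) 2 := by
    rw [memLp_two_iff_integrable_sq_norm hm.aestronglyMeasurable]
    exact ((memLp_two_iff_integrable_sq_norm h1.1).1 h1).comp_mul_left' hc
  have hK : Measurable (Kker η n) := by
    rw [funext (Kker_eq hn η)]
    refine Measurable.ite measurableSet_Ici ?_ measurable_const
    exact (Continuous.mul (by fun_prop)
      ((continuous_fourier hη0).comp (continuous_const_mul _))).measurable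
  refine h2.of_le ((Measurable.mul (by fun_prop) hK).aestronglyMeasurable)
    (Eventually.of_forall fun t => ?_)
  rw [Kker_eq hn]
  split_ifs with ht
  · have h3 := congrFun (Real.fourier_iteratedDeriv (N := (N : ℕ∞)) (n := j + 1)
      (by exact_mod_cast hη.contDiff_of_const)
      (fun q hq => hη.integrable_iteratedDeriv hm0 (by exact_mod_cast hq))
      (by exact_mod_cast hj)) (n / (2 * π) * t)
    rw [h3, norm_smul, norm_pow]
    have h4 : ‖(2 * π * Complex.I * ((n / (2 * π) * t : ℝ) : ℂ))‖ = |t| := by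
      have hπ := Real.pi_pos
      simp only [norm_mul, Complex.norm_I, Complex.norm_real, Real.norm_eq_abs, abs_mul, abs_div,
        hn1, abs_of_pos hπ, Complex.norm_ofNat, abs_two]
      field_simp
    rw [h4]
    simp only [norm_mul, norm_pow, norm_neg, Complex.norm_real, Real.norm_eq_abs]
    rw [pow_succ]
    have h5 : ‖(1 / 2 : ℂ)‖ = 1 / 2 := by norm_num
    rw [h5]
    have : 0 ≤ |t| ^ j * |t| * ‖𝓕 η (n / (2 * π) * t)‖ := by positivity
    linarith
  · simp

lemma KhatC_eq_fourier_damp (η : ℝ → ℂ) (n : ℤ) (a w : ℝ) :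
    KhatC η n (2 * π * w - a * Complex.I) = 𝓕 (damp a (Kker η n)) w := by
  rw [KhatC, Real.fourier_real_eq_integral_exp_smul]
  congr 1 with t
  rw [damp, smul_eq_mul, ← mul_assoc, Complex.ofReal_exp, ← Complex.exp_add]
  congr 2
  push_cast
  linear_combination (a * t : ℂ) * Complex.I_sq

/-- **Lemma (Volterra estimate).** Let `γ ≥ 0`, `m₀ > 1/2`, and assume `η ∈ ℋ^{γ+3}`
satisfies (H). Then there exists `C > 0` such that for every `T ≥ 0`, every `n = ±1`, and
all continuous `F, ζ : [0,T] → ℂ` solving the Volterra equation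
`ζ(t) = ∫₀ᵗ K(n,t-σ) ζ(σ) dσ + F(t)` on `[0,T]`, one has
`sup_{[0,T]} ⟨t⟩^γ |ζ(t)| ≤ C sup_{[0,T]} ⟨t⟩^γ |F(t)|` (with `C` independent of `T`, `F`). -/
theorem volterra_estimate (γ : ℕ) (m0 : ℝ) (hm0 : 1 / 2 < m0)
    (η : ℝ → ℂ) (hη : MemH m0 (γ + 3) fun _ v => η v) (hP : Penrose m0 η) :
    ∃ C > 0, ∀ T : ℝ, 0 ≤ T → ∀ n : ℤ, n = 1 ∨ n = -1 →
      ∀ F ζ : ℝ → ℂ, ContinuousOn F (Set.Icc 0 T) → ContinuousOn ζ (Set.Icc 0 T) →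
        (∀ t ∈ Set.Icc (0 : ℝ) T, ζ t = (∫ σ in (0 : ℝ)..t, Kker η n (t - σ) * ζ σ) + F t) →
        ∀ B : ℝ, (∀ t ∈ Set.Icc (0 : ℝ) T, jap t ^ γ * ‖F t‖ ≤ B) →
          ∀ t ∈ Set.Icc (0 : ℝ) T, jap t ^ γ * ‖ζ t‖ ≤ C * B := by
  obtain ⟨κ, hκ, hκP⟩ := hP.2
  have key (n : ℤ) (hn : n = 1 ∨ n = -1) := exists_volterra_bound (K := Kker η n) (γ := γ)
    (fun j hj => hη.memLp_pow_mul_Kker hm0 hn (by omega)) (Kker_of_neg η n) hκ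
    fun a ha w => by
      rw [← KhatC_eq_fourier_damp]
      exact hκP n hn _ (by simpa using ha)
  obtain ⟨C₁, hC₁, h₁⟩ := key 1 (Or.inl rfl)
  obtain ⟨C₂, hC₂, h₂⟩ := key (-1) (Or.inr rfl)
  refine ⟨max C₁ C₂, lt_max_of_lt_left hC₁, fun T hT n hn F ζ _ hζ hV B hB t ht => ?_⟩
  have hB0 : 0 ≤ B :=
    (mul_nonneg (pow_nonneg (jap_pos t).le _) (norm_nonneg _)).trans (hB t ht)
  rcases hn with rfl | rfl
  · exact (h₁ T hT F ζ hζ hV B hB t ht).trans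
      (mul_le_mul_of_nonneg_right (le_max_left _ _) hB0)
  · exact (h₂ T hT F ζ hζ hV B hB t ht).trans
      (mul_le_mul_of_nonneg_right (le_max_right _ _) hB0)
end
end

section
/- Let γ ≥ 0 be an integer and m₀ ≥ 1 an integer. There exists a constant C, depending only on γ and m₀, such that for all nonnegative integers p, q, m with p + q ≤ γ and m ≤ m₀, all σ ≥ 0, all g(σ,·,·), and all h(σ,·,·) in the relevant spaces, the following hold, where D^{m,p,q} is the operator acting in Fourier variables (k,ξ) by k^p ξ^q ∂_ξ^m, L_σ[g]h = {φ(σ,g), h}, ζ_k(σ) = ĝ_k(σ, kσ), and m_{σ,γ}(ζ) = ⟨σ⟩^γ max_{k∈{±1}} |ζ_k(σ)|: (i) ‖[D^{m,p,q}, L_σ[g]] h‖_{L²(𝕋×ℝ)} ≤ C ( m_{σ,γ+1}(ζ) ‖h(σ)‖_{ℋ¹} + m_{σ,2}(ζ) ‖h(σ)‖_{ℋ^γ} ); (ii) ‖D^{m,p,q}( L_σ[g] h )‖_{L²(𝕋×ℝ)} ≤ C ( m_{σ,γ+1}(ζ) ‖h(σ)‖_{ℋ¹} + m_{σ,2}(ζ)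 ‖h(σ)‖_{ℋ^{γ+1}} ). -/
open MeasureTheory Real Set

noncomputable section

/-- Fourier side of the transport operator `L_σ[g]h = {φ(σ,g), h}`:
`(F(L_σ[g]h))ₙ(ξ) = ∑_{k=±1} k pₖ ζₖ(σ) ĥ_{n-k}(ξ-kσ)(nσ - ξ)` with `ζₖ(σ) = ĝₖ(σ,kσ)`. -/
def FL (g h : ℝ → ℝ → ℂ) (σ : ℝ) (n : ℤ) (ξ : ℝ) : ℂ :=
  ∑ k ∈ ({1, -1} : Finset ℤ),
    (k : ℂ) * pcoef k * fHat g k ((k : ℝ) * σ) * fHat h (n - k) (ξ - (k : ℝ) * σ) *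
      ((n : ℂ) * (σ : ℂ) - (ξ : ℂ))

/-- The operator `D^{m,p,q}` acting in Fourier variables `(k,ξ)` by `k^p ξ^q ∂_ξ^m`. -/
def DF (p q m : ℕ) (u : ℤ → ℝ → ℂ) (n : ℤ) (ξ : ℝ) : ℂ :=
  (n : ℂ) ^ p * (ξ : ℂ) ^ q * iteratedDeriv m (u n) ξ

/-- Fourier side of `L_σ[g](D^{m,p,q}h)`. -/
def FLD (g h : ℝ → ℝ → ℂ) (σ : ℝ) (p q m : ℕ) (n : ℤ) (ξ : ℝ) : ℂ :=
  ∑ k ∈ ({1, -1} : Finset ℤ),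
    (k : ℂ) * pcoef k * fHat g k ((k : ℝ) * σ) *
      (((n - k : ℤ) : ℂ) ^ p * ((ξ - (k : ℝ) * σ : ℝ) : ℂ) ^ q *
        iteratedDeriv m (fun ξ' : ℝ => fHat h (n - k) ξ') (ξ - (k : ℝ) * σ)) *
      ((n : ℂ) * (σ : ℂ) - (ξ : ℂ))

/-- The `L²(𝕋 × ℝ)` norm computed on the Fourier side (Plancherel). -/
def L2F (u : ℤ → ℝ → ℂ) : ℝ := Real.sqrt (∑' n : ℤ, ∫ ξ : ℝ, ‖u n ξ‖ ^ 2)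

/-- `m_{σ,γ}(ζ) = ⟨σ⟩^γ max_{k=±1} |ζₖ(σ)|`, where `ζₖ(σ) = ĝₖ(σ,kσ)`. -/
def mzeta (g : ℝ → ℝ → ℂ) (σ : ℝ) (γ : ℕ) : ℝ :=
  jap σ ^ γ * max ‖fHat g 1 σ‖ ‖fHat g (-1) (-σ)‖

section

open FourierTransform SchwartzMap
open scoped ContDiff ENNReal

/-- Plancherel's identity for the Fourier integral of a function in `L¹ ∩ L²`. -/
lemma eLpNorm_fourier_eq {f : ℝ → ℂ} (h1 : Integrable f) (h2 : MemLp f 2) :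
    eLpNorm (𝓕 f) 2 volume = eLpNorm f 2 volume := by
  set G : Lp ℂ 2 (volume : Measure ℝ) := 𝓕 (h2.toLp f) with hG
  have hGn : eLpNorm G 2 volume = eLpNorm f 2 volume := by
    have := Lp.norm_fourier_eq (h2.toLp f)
    rw [Lp.norm_def, Lp.norm_def, ENNReal.toReal_eq_toReal_iff' (Lp.eLpNorm_ne_top _)
      (Lp.eLpNorm_ne_top _)] at this
    rw [hG, this]
    exact eLpNorm_congr_ae h2.coeFn_toLp
  have hc : Continuous (𝓕 f) :=
    VectorFourier.fourierIntegral_continuous Real.continuous_fourierChar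
      (by exact continuous_inner) h1
  have hae : 𝓕 f =ᵐ[volume] G := by
    refine ae_eq_of_integral_contDiff_smul_eq hc.locallyIntegrable
      ((Lp.memLp G).locallyIntegrable (by norm_num)) ?_
    intro φ hφ hφc
    let Φ : ℝ → ℂ := fun x => (φ x : ℂ)
    have hΦc : HasCompactSupport Φ := hφc.comp_left (g := fun x : ℝ => (x : ℂ)) (by simp)
    have hΦ : ContDiff ℝ ∞ Φ := Complex.ofRealCLM.contDiff.comp hφ
    let S : 𝓢(ℝ, ℂ) := hΦc.toSchwartzMap hΦ
    have e1 := congrArg (fun T => T S) (Lp.fourier_toTemperedDistribution_eq (h2.toLp f))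
    simp only [TemperedDistribution.fourier_apply, Lp.toTemperedDistribution_apply] at e1
    have e2 : ∫ x, (𝓕 S) x • f x = ∫ x, S x • 𝓕 f x := by
      have := VectorFourier.integral_bilin_fourierIntegral_eq_flip (μ := volume)
        (ν := volume) (ContinuousLinearMap.lsmul ℂ ℂ : ℂ →L[ℂ] ℂ →L[ℂ] ℂ) (L := innerₗ ℝ)
        Real.continuous_fourierChar (by exact continuous_inner) S.integrable h1
      simpa [SchwartzMap.fourier_coe] using! this
    have e3 : ∫ x, (𝓕 S) x • (h2.toLp f) x = ∫ x, (𝓕 S) x • f x := by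
      refine integral_congr_ae ?_
      filter_upwards [h2.coeFn_toLp] with x hx
      rw [hx]
    rw [e3, e2] at e1
    simpa [S, Φ] using e1
  rw [eLpNorm_congr_ae hae, hGn]

/-- The Fourier integral on the line, `∫ c(v) e^{-iξv} dv`. -/
def lineFourier (c : ℝ → ℂ) (ξ : ℝ) : ℂ := ∫ v : ℝ, c v * Complex.exp (-Complex.I * (ξ * v))

lemma norm_cexp_neg_I_mul (ξ v : ℝ) : ‖Complex.exp (-Complex.I * (ξ * v))‖ = 1 := by
  have : -Complex.I * (ξ * v) = ((-(ξ * v) : ℝ) : ℂ) * Complex.I := by push_cast; ring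
  rw [this, Complex.norm_exp_ofReal_mul_I]

lemma continuous_cexp_neg_I_mul (ξ : ℝ) :
    Continuous fun v : ℝ => Complex.exp (-Complex.I * (ξ * v)) := by fun_prop

lemma integrable_mul_cexp {c : ℝ → ℂ} (hc : Integrable c) (ξ : ℝ) :
    Integrable fun v : ℝ => c v * Complex.exp (-Complex.I * (ξ * v)) := by
  refine hc.mul_bdd (c := 1) (continuous_cexp_neg_I_mul ξ).aestronglyMeasurable ?_
  exact Filter.Eventually.of_forall fun v => (norm_cexp_neg_I_mul ξ v).le

lemma lineFourier_eq_fourier (c : ℝ → ℂ) (ξ : ℝ) :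
    lineFourier c ξ = 𝓕 c ((2 * π)⁻¹ * ξ) := by
  rw [Real.fourier_real_eq_integral_exp_smul, lineFourier]
  refine integral_congr_ae (Filter.Eventually.of_forall fun v => ?_)
  simp only [smul_eq_mul]
  rw [mul_comm]
  congr 2
  have : (π : ℂ) ≠ 0 := by exact_mod_cast pi_ne_zero
  push_cast
  field_simp

lemma continuous_lineFourier {c : ℝ → ℂ} (hc : Integrable c) : Continuous (lineFourier c) := by
  have h : Continuous (𝓕 c) :=
    VectorFourier.fourierIntegral_continuous Real.continuous_fourierChar
      (by exact continuous_inner) hc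
  have : lineFourier c = fun ξ => 𝓕 c ((2 * π)⁻¹ * ξ) := funext (lineFourier_eq_fourier c)
  rw [this]
  fun_prop

lemma lintegral_comp_mul_left_real (f : ℝ → ℝ≥0∞) (a : ℝ) (ha : 0 < a) :
    ∫⁻ x, f (a * x) = ENNReal.ofReal a⁻¹ * ∫⁻ x, f x := by
  have h := lintegral_map_equiv (μ := volume) f (MeasurableEquiv.mulLeft₀ a ha.ne')
  have e : Measure.map (MeasurableEquiv.mulLeft₀ a ha.ne') (volume : Measure ℝ) =
      ENNReal.ofReal a⁻¹ • volume := by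
    have := Real.map_volume_mul_left ha.ne'
    rw [abs_of_pos (inv_pos.2 ha)] at this
    exact this
  rw [e, lintegral_smul_measure] at h
  exact h.symm

lemma eLpNorm_two_sq (f : ℝ → ℂ) : eLpNorm f 2 volume ^ 2 = ∫⁻ x, ‖f x‖ₑ ^ 2 := by
  rw [eLpNorm_eq_lintegral_rpow_enorm_toReal (by norm_num) (by norm_num)]
  simp only [ENNReal.toReal_ofNat, ENNReal.rpow_ofNat, one_div]
  rw [← ENNReal.rpow_natCast, ← ENNReal.rpow_mul]
  norm_num

lemma lintegral_lineFourier_sq_le {c : ℝ → ℂ} (hc : Integrable c) :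
    ∫⁻ ξ, ‖lineFourier c ξ‖ₑ ^ 2 ≤ ENNReal.ofReal (2 * π) * ∫⁻ v, ‖c v‖ₑ ^ 2 := by
  by_cases h : ∫⁻ v, ‖c v‖ₑ ^ 2 = ⊤
  · rw [h, ENNReal.mul_top (by simp [pi_pos])]; exact le_top
  · have h2 : MemLp c 2 := by
      refine ⟨hc.1, ?_⟩
      by_contra hh
      rw [not_lt, top_le_iff] at hh
      rw [← eLpNorm_two_sq, hh] at h
      simp at h
    have hp := eLpNorm_fourier_eq hc h2
    have := lintegral_comp_mul_left_real (fun w => ‖𝓕 c w‖ₑ ^ 2) (2 * π)⁻¹ (by positivity)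
    simp_rw [lineFourier_eq_fourier]
    rw [this, ← eLpNorm_two_sq, ← eLpNorm_two_sq, hp, inv_inv]

lemma hasDerivAt_lineFourier {c : ℝ → ℂ} (hc : Integrable c)
    (hc' : Integrable fun v : ℝ => -Complex.I * v * c v) (ξ : ℝ) :
    HasDerivAt (lineFourier c) (lineFourier (fun v => -Complex.I * v * c v) ξ) ξ := by
  have := hasDerivAt_integral_of_dominated_loc_of_deriv_le (μ := volume) (𝕜 := ℝ)
    (F := fun (ξ : ℝ) (v : ℝ) => c v * Complex.exp (-Complex.I * (ξ * v)))
    (F' := fun (ξ : ℝ) (v : ℝ) => -Complex.I * v * c v * Complex.exp (-Complex.I * (ξ * v)))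
    (x₀ := ξ) (s := Set.univ) (bound := fun v => ‖-Complex.I * v * c v‖) Filter.univ_mem
    (Filter.Eventually.of_forall fun ξ => (integrable_mul_cexp hc ξ).1)
    (integrable_mul_cexp hc ξ) (integrable_mul_cexp hc' ξ).1
    (Filter.Eventually.of_forall fun v x _ => by rw [norm_mul, norm_cexp_neg_I_mul, mul_one])
    hc'.norm
    (Filter.Eventually.of_forall fun v x _ => by
      have h1 : HasDerivAt (fun x : ℝ => -Complex.I * (x * v)) (-Complex.I * (1 * v)) x :=
        ((Complex.ofRealCLM.hasDerivAt (x := x)).mul_const (v : ℂ)).const_mul _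
      have h2 := (h1.cexp).const_mul (c v)
      refine h2.congr_deriv ?_
      ring)
  exact this.2

lemma hasDerivAt_lineFourier_pow_mul {c : ℝ → ℂ} {j : ℕ}
    (hc : Integrable fun v : ℝ => (-Complex.I * v) ^ j * c v)
    (hc' : Integrable fun v : ℝ => (-Complex.I * v) ^ (j + 1) * c v) (ξ : ℝ) :
    HasDerivAt (lineFourier fun v => (-Complex.I * v) ^ j * c v)
      (lineFourier (fun v => (-Complex.I * v) ^ (j + 1) * c v) ξ) ξ := by
  have e : (fun v : ℝ => -Complex.I * v * ((-Complex.I * v) ^ j * c v)) =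
      fun v : ℝ => (-Complex.I * v) ^ (j + 1) * c v := by ext v; ring
  have := hasDerivAt_lineFourier hc (by rw [e]; exact hc') ξ
  rwa [e] at this

lemma iteratedDeriv_lineFourier {c : ℝ → ℂ} (N : ℕ)
    (hc : ∀ j ≤ N, Integrable fun v : ℝ => (-Complex.I * v) ^ j * c v) :
    ∀ j ≤ N, iteratedDeriv j (lineFourier c) =
      lineFourier fun v => (-Complex.I * v) ^ j * c v := by
  intro j
  induction j with
  | zero => intro _; simp
  | succ j ih =>
    intro hj
    rw [iteratedDeriv_succ, ih (by omega)]
    ext ξ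
    exact (hasDerivAt_lineFourier_pow_mul (hc j (by omega)) (hc (j + 1) hj) ξ).deriv

lemma differentiable_iteratedDeriv_lineFourier {c : ℝ → ℂ} (N : ℕ)
    (hc : ∀ j ≤ N, Integrable fun v : ℝ => (-Complex.I * v) ^ j * c v) :
    ∀ j < N, Differentiable ℝ (iteratedDeriv j (lineFourier c)) := by
  intro j hj ξ
  rw [iteratedDeriv_lineFourier N hc j hj.le]
  exact (hasDerivAt_lineFourier_pow_mul (hc j (by omega)) (hc (j + 1) hj) ξ).differentiableAt

/-- The variation of a `C¹` function is at most the integral of the norm of its derivative. -/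
lemma eVariationOn_Icc_le_lintegral {F F' : ℝ → ℂ} (hF : ∀ x, HasDerivAt F (F' x) x)
    (hF' : Continuous F') {a b : ℝ} (hab : a ≤ b) :
    eVariationOn F (Icc a b) ≤ ∫⁻ x in Icc a b, ‖F' x‖ₑ := by
  have hn : ∀ x y, IntervalIntegrable (fun t => ‖F' t‖) volume x y :=
    fun x y => hF'.norm.intervalIntegrable x y
  let φ : ℝ → ℝ := fun x => ∫ t in a..x, ‖F' t‖
  have hφ : ∀ x y, φ y - φ x = ∫ t in x..y, ‖F' t‖ := fun x y =>
    intervalIntegral.integral_interval_sub_left (hn _ _) (hn _ _)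
  have hmono : MonotoneOn φ (Icc a b) := fun x _ y _ hxy => by
    have : 0 ≤ φ y - φ x := by
      rw [hφ]; exact intervalIntegral.integral_nonneg hxy fun _ _ => norm_nonneg _
    linarith
  have hle : eVariationOn F (Icc a b) ≤ eVariationOn φ (Icc a b) := by
    refine iSup_mono fun p => Finset.sum_le_sum fun i _ => ?_
    have hi : (p.2 : ℕ → ℝ) i ≤ (p.2 : ℕ → ℝ) (i + 1) := p.2.2.1 (Nat.le_succ i)
    rw [edist_dist, edist_dist]
    refine ENNReal.ofReal_le_ofReal ?_
    rw [dist_eq_norm, Real.dist_eq, hφ,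
      ← intervalIntegral.integral_eq_sub_of_hasDerivAt (fun x _ => hF x)
        (hF'.intervalIntegrable _ _)]
    exact (intervalIntegral.norm_integral_le_integral_norm hi).trans (le_abs_self _)
  have hv := hmono.eVariationOn_eq (left_mem_Icc.2 hab) (right_mem_Icc.2 hab)
  rw [inter_self] at hv
  rw [hv, hφ, intervalIntegral.integral_of_le hab, ← integral_Icc_eq_integral_Ioc,
    ofReal_integral_eq_lintegral_ofReal (hF'.norm.integrableOn_Icc)
      (Filter.Eventually.of_forall fun _ => norm_nonneg _)] at hle
  simpa only [ofReal_norm] using hle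

lemma enorm_le_one_add_sq (z : ℂ) : ‖z‖ₑ ≤ 1 + ‖z‖ₑ ^ 2 := by
  rcases le_total ‖z‖ₑ 1 with h | h
  · exact h.trans le_self_add
  · calc ‖z‖ₑ = ‖z‖ₑ * 1 := (mul_one _).symm
      _ ≤ ‖z‖ₑ * ‖z‖ₑ := by gcongr
      _ = ‖z‖ₑ ^ 2 := (sq _).symm
      _ ≤ _ := le_add_self

/-- If `u ∈ L¹` and `v u ∈ L²`, then the Fourier integral of `u` has locally bounded variation. -/
lemma locallyBoundedVariationOn_lineFourier {u : ℝ → ℂ} (hu : Integrable u)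
    (hvu : ∫⁻ v, ‖-Complex.I * v * u v‖ₑ ^ 2 ≠ ⊤) :
    LocallyBoundedVariationOn (lineFourier u) univ := by
  intro a b _ _
  rw [univ_inter]
  rcases lt_or_ge b a with hab | hab
  · simp [Icc_eq_empty_of_lt hab, BoundedVariationOn]
  set M : ℝ≥0∞ := ENNReal.ofReal (b - a) +
    ENNReal.ofReal (2 * π) * ∫⁻ v, ‖-Complex.I * v * u v‖ₑ ^ 2 with hM
  have hMtop : M ≠ ⊤ := by
    rw [hM]
    exact ENNReal.add_ne_top.2 ⟨by simp, ENNReal.mul_ne_top ENNReal.ofReal_ne_top hvu⟩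
  let w : ℕ → ℝ → ℂ := fun n => (Icc (-(n : ℝ)) n).indicator u
  have hw : ∀ n, Integrable (w n) := fun n => hu.indicator measurableSet_Icc
  have hw' : ∀ n, Integrable fun v : ℝ => -Complex.I * v * w n v := by
    intro n
    have h1 : IntegrableOn (fun v : ℝ => -Complex.I * v * u v) (Icc (-(n : ℝ)) n) := by
      refine hu.integrableOn.continuousOn_mul (Continuous.continuousOn (by fun_prop)) isCompact_Icc
    have h2 := h1.integrable_indicator measurableSet_Icc
    refine h2.congr (Filter.Eventually.of_forall fun v => ?_)
    simp only [w, indicator]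
    split_ifs <;> simp
  have hbound : ∀ n, eVariationOn (lineFourier (w n)) (Icc a b) ≤ M := by
    intro n
    refine (eVariationOn_Icc_le_lintegral (hasDerivAt_lineFourier (hw n) (hw' n))
      (continuous_lineFourier (hw' n)) hab).trans ?_
    refine (lintegral_mono fun x => enorm_le_one_add_sq _).trans ?_
    rw [lintegral_add_left measurable_const, hM]
    refine add_le_add (by simp) ?_
    refine (setLIntegral_le_lintegral _ _).trans
      ((lintegral_lineFourier_sq_le (hw' n)).trans ?_)
    gcongr with v
    simp only [w, indicator]
    split_ifs <;> simp
  have hlim : ∀ ξ, Filter.Tendsto (fun n => lineFourier (w n) ξ) Filter.atTop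
      (nhds (lineFourier u ξ)) := by
    intro ξ
    refine tendsto_integral_of_dominated_convergence (fun v => ‖u v‖)
      (fun n => (integrable_mul_cexp (hw n) ξ).1) hu.norm
      (fun n => Filter.Eventually.of_forall fun v => ?_)
      (Filter.Eventually.of_forall fun v => ?_)
    · rw [norm_mul, norm_cexp_neg_I_mul, mul_one]
      exact norm_indicator_le_norm_self _ _
    · refine tendsto_const_nhds.congr' ?_
      filter_upwards [Filter.eventually_ge_atTop ⌈|v|⌉₊] with n hn
      have h1 : |v| ≤ n := (Nat.le_ceil _).trans (by exact_mod_cast hn)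
      have : v ∈ Icc (-(n : ℝ)) n := ⟨(abs_le.1 h1).1, (abs_le.1 h1).2⟩
      simp only [w, indicator_of_mem this]
  refine ne_top_of_le_ne_top hMtop ?_
  by_contra hcon
  rw [not_le] at hcon
  obtain ⟨n, hn⟩ := (eVariationOn.lowerSemicontinuous_aux (fun x _ => hlim x) hcon).exists
  exact absurd (hbound n) (not_le.2 hn)

lemma ae_differentiableAt_lineFourier {u : ℝ → ℂ} (hu : Integrable u)
    (hvu : ∫⁻ v, ‖-Complex.I * v * u v‖ₑ ^ 2 ≠ ⊤) :
    ∀ᵐ ξ, DifferentiableAt ℝ (lineFourier u) ξ :=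
  (locallyBoundedVariationOn_lineFourier hu hvu).ae_differentiableAt

lemma norm_cexp_sub_one_le (x : ℝ) : ‖Complex.exp (-Complex.I * x) - 1‖ ≤ |x| := by
  have := Real.norm_exp_I_mul_ofReal_sub_one_le (x := -x)
  simpa using this

lemma lintegral_deriv_lineFourier_sq_le {u : ℝ → ℂ} (hu : Integrable u)
    (hvu : ∫⁻ v, ‖-Complex.I * v * u v‖ₑ ^ 2 ≠ ⊤) :
    ∫⁻ ξ, ‖deriv (lineFourier u) ξ‖ₑ ^ 2 ≤
      ENNReal.ofReal (2 * π) * ∫⁻ v, ‖-Complex.I * v * u v‖ₑ ^ 2 := by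
  let s : ℕ → ℝ := fun n => (n : ℝ) + 1
  let w : ℕ → ℝ → ℂ := fun n v =>
    (s n : ℂ) * (Complex.exp (-Complex.I * ((s n)⁻¹ * v : ℝ)) - 1) * u v
  have hs : ∀ n, 0 < s n := fun n => by positivity
  have hwle : ∀ n v, ‖w n v‖ ≤ ‖-Complex.I * v * u v‖ := by
    intro n v
    simp only [w]
    rw [norm_mul, norm_mul, norm_mul (-Complex.I * (v : ℂ))]
    refine mul_le_mul_of_nonneg_right ?_ (norm_nonneg _)
    refine (mul_le_mul_of_nonneg_left (norm_cexp_sub_one_le _) (norm_nonneg _)).trans ?_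
    rw [abs_mul, abs_of_pos (inv_pos.2 (hs n)), Complex.norm_real, Real.norm_of_nonneg (hs n).le]
    simp [(hs n).ne']
  have hw : ∀ n, Integrable (w n) := by
    intro n
    refine hu.bdd_mul (c := s n * 2) (Continuous.aestronglyMeasurable (by fun_prop)) ?_
    refine Filter.Eventually.of_forall fun v => ?_
    rw [norm_mul, Complex.norm_real, Real.norm_of_nonneg (hs n).le]
    refine mul_le_mul_of_nonneg_left ((norm_sub_le _ _).trans ?_) (hs n).le
    have := norm_cexp_neg_I_mul (s n)⁻¹ v
    push_cast at this ⊢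
    rw [this]; norm_num
  have heq : ∀ n ξ, lineFourier (w n) ξ =
      s n • (lineFourier u (ξ + (s n)⁻¹) - lineFourier u ξ) := by
    intro n ξ
    simp only [lineFourier]
    rw [← integral_sub (integrable_mul_cexp hu _) (integrable_mul_cexp hu _), ← integral_smul]
    refine integral_congr_ae (Filter.Eventually.of_forall fun v => ?_)
    have : Complex.exp (-Complex.I * (((ξ + (s n)⁻¹ : ℝ) : ℂ) * v)) =
        Complex.exp (-Complex.I * ((s n)⁻¹ * v : ℝ)) * Complex.exp (-Complex.I * (ξ * v)) := by
      rw [← Complex.exp_add]; congr 1; push_cast; ring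
    simp only [w, this, Complex.real_smul]
    ring
  have hlim : ∀ᵐ ξ, ‖deriv (lineFourier u) ξ‖ₑ ^ 2 =
      Filter.liminf (fun n => ‖lineFourier (w n) ξ‖ₑ ^ 2) Filter.atTop := by
    filter_upwards [ae_differentiableAt_lineFourier hu hvu] with ξ hξ
    have h1 := hξ.hasDerivAt.tendsto_slope_zero_right
    have h2 : Filter.Tendsto (fun n => (s n)⁻¹) Filter.atTop (nhdsWithin 0 (Ioi 0)) := by
      refine tendsto_nhdsWithin_iff.2 ⟨?_, Filter.Eventually.of_forall fun n => inv_pos.2 (hs n)⟩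
      simpa [s, one_div] using tendsto_one_div_add_atTop_nhds_zero_nat (𝕜 := ℝ)
    have h3 := h1.comp h2
    have h4 : Filter.Tendsto (fun n => lineFourier (w n) ξ) Filter.atTop
        (nhds (deriv (lineFourier u) ξ)) := by
      refine h3.congr fun n => ?_
      simp [heq]
    exact ((ENNReal.continuous_pow 2).tendsto _ |>.comp h4.enorm).liminf_eq.symm
  rw [lintegral_congr_ae hlim]
  refine (lintegral_liminf_le fun n => ?_).trans ?_
  · exact ((continuous_lineFourier (hw n)).enorm.measurable).pow_const 2
  · refine Filter.liminf_le_of_le (by isBoundedDefault) fun b hb => ?_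
    obtain ⟨n, hn⟩ := hb.exists
    refine hn.trans ((lintegral_lineFourier_sq_le (hw n)).trans ?_)
    gcongr with v
    exact enorm_le_iff_norm_le.2 (hwle n v)

/-- The weighted energy `∫ (1+v²)^N |c(v)|² dv`. -/
def lineEnergy (N : ℕ) (c : ℝ → ℂ) : ℝ≥0∞ :=
  ∫⁻ v, ENNReal.ofReal ((1 + v ^ 2) ^ N) * ‖c v‖ₑ ^ 2

lemma norm_neg_I_mul_pow_sq_le (v : ℝ) {j N : ℕ} (hj : j ≤ N) :
    ‖(-Complex.I * v) ^ j‖ ^ 2 ≤ (1 + v ^ 2) ^ N := by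
  have h1 : ‖(-Complex.I * v) ^ j‖ ^ 2 = (v ^ 2) ^ j := by
    rw [norm_pow]
    simp only [norm_mul, norm_neg, Complex.norm_I, one_mul, Complex.norm_real, norm_eq_abs]
    rw [← pow_mul, mul_comm, pow_mul, sq_abs]
  rw [h1]
  calc (v ^ 2) ^ j ≤ (1 + v ^ 2) ^ j := by gcongr; linarith
    _ ≤ (1 + v ^ 2) ^ N := pow_le_pow_right₀ (by nlinarith [sq_nonneg v]) hj

lemma le_add_of_sq_le_mul {x a b : ℝ} (ha : 0 ≤ a) (hb : 0 ≤ b) (h : x ^ 2 ≤ a * b) :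
    x ≤ a + b :=
  abs_le_of_sq_le_sq' (by nlinarith) (by positivity) |>.2

lemma norm_pow_mul_le_weight (v : ℝ) (z : ℂ) {j N : ℕ} (hj : j ≤ N) :
    ‖(-Complex.I * v) ^ j * z‖ ≤ (1 + v ^ 2) ^ (N + 1) * ‖z‖ ^ 2 + (1 + v ^ 2)⁻¹ := by
  have h0 : 0 < 1 + v ^ 2 := by positivity
  refine le_add_of_sq_le_mul (by positivity) (by positivity) ?_
  rw [norm_mul, mul_pow]
  calc _ ≤ (1 + v ^ 2) ^ N * ‖z‖ ^ 2 := by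
        gcongr; exact norm_neg_I_mul_pow_sq_le v hj
    _ = _ := by field_simp; ring

lemma integrable_pow_mul_of_lineEnergy {N : ℕ} {c : ℝ → ℂ} (hc : AEStronglyMeasurable c)
    (hE : lineEnergy (N + 1) c ≠ ⊤) {j : ℕ} (hj : j ≤ N) :
    Integrable fun v : ℝ => (-Complex.I * v) ^ j * c v := by
  have h1 : Integrable fun v : ℝ => (1 + v ^ 2) ^ (N + 1) * ‖c v‖ ^ 2 := by
    refine ⟨(Continuous.aestronglyMeasurable (by fun_prop)).mul (hc.norm.pow 2), ?_⟩
    rw [HasFiniteIntegral]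
    refine lt_of_le_of_lt (le_of_eq ?_) (lt_top_iff_ne_top.2 hE)
    refine lintegral_congr fun v => ?_
    rw [Real.enorm_of_nonneg (by positivity), ENNReal.ofReal_mul (by positivity),
      ENNReal.ofReal_pow (norm_nonneg _), ofReal_norm]
  refine (h1.add integrable_inv_one_add_sq).mono'
    ((Continuous.aestronglyMeasurable (by fun_prop)).mul hc) ?_
  exact Filter.Eventually.of_forall fun v => norm_pow_mul_le_weight v _ hj

lemma lintegral_pow_mul_sq_le_lineEnergy {N : ℕ} (c : ℝ → ℂ) {j : ℕ} (hj : j ≤ N) :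
    ∫⁻ v : ℝ, ‖(-Complex.I * v) ^ j * c v‖ₑ ^ 2 ≤ lineEnergy N c := by
  refine lintegral_mono fun v => ?_
  rw [enorm_mul, mul_pow]
  gcongr
  rw [← ofReal_norm, ← ENNReal.ofReal_pow (norm_nonneg _)]
  exact ENNReal.ofReal_le_ofReal (norm_neg_I_mul_pow_sq_le v hj)

/-- `F` has `N` everywhere differentiable derivatives (counting order `0`), and the derivative of
order `N` is almost everywhere differentiable. -/
def AEDiffOrder (N : ℕ) (F : ℝ → ℂ) : Prop :=
  (∀ j < N, Differentiable ℝ (iteratedDeriv j F)) ∧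
    ∀ᵐ ξ, DifferentiableAt ℝ (iteratedDeriv N F) ξ

lemma neg_I_mul_pow_mul_succ (c : ℝ → ℂ) (N : ℕ) (v : ℝ) :
    -Complex.I * v * ((-Complex.I * v) ^ N * c v) = (-Complex.I * v) ^ (N + 1) * c v := by ring

lemma aeDiffOrder_lineFourier {N : ℕ} {c : ℝ → ℂ} (hc : AEStronglyMeasurable c)
    (hE : lineEnergy (N + 1) c ≠ ⊤) : AEDiffOrder N (lineFourier c) := by
  have hi := fun j (hj : j ≤ N) => integrable_pow_mul_of_lineEnergy hc hE hj
  refine ⟨differentiable_iteratedDeriv_lineFourier N hi, ?_⟩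
  rw [iteratedDeriv_lineFourier N hi N le_rfl]
  refine ae_differentiableAt_lineFourier (hi N le_rfl) ?_
  simp_rw [neg_I_mul_pow_mul_succ]
  exact ne_top_of_le_ne_top hE (lintegral_pow_mul_sq_le_lineEnergy c le_rfl)

lemma lintegral_iteratedDeriv_lineFourier_sq_le {N : ℕ} {c : ℝ → ℂ}
    (hc : AEStronglyMeasurable c) (hE : lineEnergy (N + 1) c ≠ ⊤) {j : ℕ} (hj : j ≤ N + 1) :
    ∫⁻ ξ, ‖iteratedDeriv j (lineFourier c) ξ‖ₑ ^ 2 ≤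
      ENNReal.ofReal (2 * π) * lineEnergy (N + 1) c := by
  have hi := fun j (hj : j ≤ N) => integrable_pow_mul_of_lineEnergy hc hE hj
  refine le_trans ?_ (mul_le_mul_right (lintegral_pow_mul_sq_le_lineEnergy c hj) _)
  rcases Nat.lt_or_ge N j with h | h
  · obtain rfl : j = N + 1 := by omega
    rw [iteratedDeriv_succ, iteratedDeriv_lineFourier N hi N le_rfl]
    have h2 := lintegral_deriv_lineFourier_sq_le (hi N le_rfl)
    simp_rw [neg_I_mul_pow_mul_succ] at h2
    exact h2 (ne_top_of_le_ne_top hE (lintegral_pow_mul_sq_le_lineEnergy c le_rfl))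
  · rw [iteratedDeriv_lineFourier N hi j h]
    exact lintegral_lineFourier_sq_le (hi j h)

lemma ae_comp_sub_right {p : ℝ → Prop} (h : ∀ᵐ ξ, p ξ) (s : ℝ) : ∀ᵐ ξ, p (ξ - s) :=
  (measurePreserving_sub_right volume s).quasiMeasurePreserving.ae h

lemma hasDerivAt_translate_comb {f₁ f₂ : ℝ → ℂ} {ξ s₁ s₂ : ℝ} (a₁ a₂ : ℂ)
    (h₁ : DifferentiableAt ℝ f₁ (ξ - s₁)) (h₂ : DifferentiableAt ℝ f₂ (ξ - s₂)) :
    HasDerivAt (fun ξ => a₁ * f₁ (ξ - s₁) + a₂ * f₂ (ξ - s₂))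
      (a₁ * deriv f₁ (ξ - s₁) + a₂ * deriv f₂ (ξ - s₂)) ξ :=
  ((h₁.hasDerivAt.comp_sub_const ξ s₁).const_mul a₁).add
    ((h₂.hasDerivAt.comp_sub_const ξ s₂).const_mul a₂)

lemma iteratedDeriv_translate_comb {N : ℕ} {F₁ F₂ : ℝ → ℂ} (h₁ : AEDiffOrder N F₁)
    (h₂ : AEDiffOrder N F₂) (a₁ a₂ : ℂ) (s₁ s₂ : ℝ) {m : ℕ} (hm : m ≤ N) :
    iteratedDeriv m (fun ξ => a₁ * F₁ (ξ - s₁) + a₂ * F₂ (ξ - s₂)) =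
      fun ξ => a₁ * iteratedDeriv m F₁ (ξ - s₁) + a₂ * iteratedDeriv m F₂ (ξ - s₂) := by
  induction m with
  | zero => simp
  | succ m ih =>
    rw [iteratedDeriv_succ, ih (by omega)]
    ext ξ
    simp only [iteratedDeriv_succ]
    exact (hasDerivAt_translate_comb a₁ a₂ (h₁.1 m (by omega) _) (h₂.1 m (by omega) _)).deriv

lemma AEDiffOrder.translate_comb {N : ℕ} {F₁ F₂ : ℝ → ℂ} (h₁ : AEDiffOrder N F₁)
    (h₂ : AEDiffOrder N F₂) (a₁ a₂ : ℂ) (s₁ s₂ : ℝ) :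
    AEDiffOrder N (fun ξ => a₁ * F₁ (ξ - s₁) + a₂ * F₂ (ξ - s₂)) := by
  refine ⟨fun j hj ξ => ?_, ?_⟩
  · rw [iteratedDeriv_translate_comb h₁ h₂ a₁ a₂ s₁ s₂ hj.le]
    exact (hasDerivAt_translate_comb a₁ a₂ (h₁.1 j hj _) (h₂.1 j hj _)).differentiableAt
  · rw [iteratedDeriv_translate_comb h₁ h₂ a₁ a₂ s₁ s₂ le_rfl]
    filter_upwards [ae_comp_sub_right h₁.2 s₁, ae_comp_sub_right h₂.2 s₂] with ξ k₁ k₂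
    exact (hasDerivAt_translate_comb a₁ a₂ k₁ k₂).differentiableAt

lemma ae_iteratedDeriv_translate_comb {N : ℕ} {F₁ F₂ : ℝ → ℂ} (h₁ : AEDiffOrder N F₁)
    (h₂ : AEDiffOrder N F₂) (a₁ a₂ : ℂ) (s₁ s₂ : ℝ) {m : ℕ} (hm : m ≤ N + 1) :
    ∀ᵐ ξ, iteratedDeriv m (fun ξ => a₁ * F₁ (ξ - s₁) + a₂ * F₂ (ξ - s₂)) ξ =
      a₁ * iteratedDeriv m F₁ (ξ - s₁) + a₂ * iteratedDeriv m F₂ (ξ - s₂) := by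
  rcases Nat.lt_or_ge N m with h | h
  · obtain rfl : m = N + 1 := by omega
    simp only [iteratedDeriv_succ]
    rw [iteratedDeriv_translate_comb h₁ h₂ a₁ a₂ s₁ s₂ le_rfl]
    filter_upwards [ae_comp_sub_right h₁.2 s₁, ae_comp_sub_right h₂.2 s₂] with ξ k₁ k₂
    exact (hasDerivAt_translate_comb a₁ a₂ k₁ k₂).deriv
  · rw [iteratedDeriv_translate_comb h₁ h₂ a₁ a₂ s₁ s₂ h]
    exact Filter.Eventually.of_forall fun _ => rfl

lemma hasDerivAt_leibniz_affine {f g : ℝ → ℂ} {ξ : ℝ} (b c : ℂ) (hf : DifferentiableAt ℝ f ξ)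
    (hg : DifferentiableAt ℝ g ξ) :
    HasDerivAt (fun ξ : ℝ => f ξ * (b - ξ) - c * g ξ)
      (deriv f ξ * (b - ξ) - (f ξ + c * deriv g ξ)) ξ := by
  have h1 : HasDerivAt (fun ξ : ℝ => b - (ξ : ℂ)) (-1) ξ := by
    simpa using (Complex.ofRealCLM.hasDerivAt (x := ξ)).const_sub b
  refine ((hf.hasDerivAt.mul h1).sub (hg.hasDerivAt.const_mul c)).congr_deriv ?_
  ring

lemma hasDerivAt_leibniz_step {N : ℕ} {H : ℝ → ℂ} (h : AEDiffOrder N H) (b : ℂ) {m : ℕ}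
    (hm : m ≤ N) {ξ : ℝ} (hξ : DifferentiableAt ℝ (iteratedDeriv m H) ξ) :
    HasDerivAt (fun ξ : ℝ => iteratedDeriv m H ξ * (b - ξ) - m * iteratedDeriv (m - 1) H ξ)
      (iteratedDeriv (m + 1) H ξ * (b - ξ) - (m + 1 : ℕ) * iteratedDeriv m H ξ) ξ := by
  rcases Nat.eq_zero_or_pos m with rfl | hpos
  · refine (hasDerivAt_leibniz_affine b 0 hξ hξ).congr_deriv ?_ |>.congr_of_eventuallyEq ?_
    · simp [iteratedDeriv_succ]
    · exact Filter.Eventually.of_forall fun _ => by simp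
  · obtain ⟨k, rfl⟩ : ∃ k, m = k + 1 := ⟨m - 1, by omega⟩
    refine (hasDerivAt_leibniz_affine b ((k + 1 : ℕ) : ℂ) hξ
      (h.1 k (by omega) ξ)).congr_deriv ?_
    simp only [iteratedDeriv_succ]
    push_cast
    ring

lemma iteratedDeriv_mul_affine {N : ℕ} {H : ℝ → ℂ} (h : AEDiffOrder N H) (b : ℂ) {m : ℕ}
    (hm : m ≤ N) :
    iteratedDeriv m (fun ξ : ℝ => H ξ * (b - ξ)) =
      fun ξ : ℝ => iteratedDeriv m H ξ * (b - ξ) - m * iteratedDeriv (m - 1) H ξ := by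
  induction m with
  | zero => simp
  | succ m ih =>
    rw [iteratedDeriv_succ, ih (by omega)]
    ext ξ
    exact (hasDerivAt_leibniz_step h b (by omega) (h.1 m (by omega) ξ)).deriv

lemma ae_iteratedDeriv_mul_affine {N : ℕ} {H : ℝ → ℂ} (h : AEDiffOrder N H) (b : ℂ) {m : ℕ}
    (hm : m ≤ N + 1) :
    ∀ᵐ ξ : ℝ, iteratedDeriv m (fun ξ : ℝ => H ξ * (b - ξ)) ξ =
      iteratedDeriv m H ξ * (b - ξ) - m * iteratedDeriv (m - 1) H ξ := by
  rcases Nat.lt_or_ge N m with h' | h'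
  · obtain rfl : m = N + 1 := by omega
    rw [iteratedDeriv_succ, iteratedDeriv_mul_affine h b le_rfl]
    filter_upwards [h.2] with ξ k
    exact (hasDerivAt_leibniz_step h b le_rfl k).deriv
  · rw [iteratedDeriv_mul_affine h b h']
    exact Filter.Eventually.of_forall fun _ => rfl

/-- The weighted energy `∫ (1+v²)^N |f(x,v)|² dx dv` on `𝕋 × ℝ`. -/
def stripEnergy (N : ℕ) (f : ℝ → ℝ → ℂ) : ℝ≥0∞ :=
  ∫⁻ z, ENNReal.ofReal ((1 + z.2 ^ 2) ^ N) * ‖f z.1 z.2‖ₑ ^ 2 ∂μTR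

/-- The Fourier coefficient in the space variable. -/
def spaceCoeff (f : ℝ → ℝ → ℂ) (l : ℤ) (v : ℝ) : ℂ :=
  (1 / (2 * π)) * ∫ x in Ioc 0 (2 * π), f x v * Complex.exp (-Complex.I * ((l : ℝ) * x))

lemma integrable_of_stripEnergy {N : ℕ} {f : ℝ → ℝ → ℂ} (hf : Continuous (Function.uncurry f))
    (hE : stripEnergy (N + 1) f ≠ ⊤) : Integrable (fun z : ℝ × ℝ => f z.1 z.2) μTR := by
  have hf' : Continuous fun z : ℝ × ℝ => f z.1 z.2 := hf
  have h1 : Integrable (fun z : ℝ × ℝ => (1 + z.2 ^ 2) ^ (N + 1) * ‖f z.1 z.2‖ ^ 2) μTR := by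
    refine ⟨Continuous.aestronglyMeasurable (by fun_prop), ?_⟩
    rw [HasFiniteIntegral]
    refine lt_of_le_of_lt (le_of_eq ?_) (lt_top_iff_ne_top.2 hE)
    refine lintegral_congr fun v => ?_
    rw [Real.enorm_of_nonneg (by positivity), ENNReal.ofReal_mul (by positivity),
      ENNReal.ofReal_pow (norm_nonneg _), ofReal_norm]
  have h2 : Integrable (fun z : ℝ × ℝ => (1 + z.2 ^ 2)⁻¹) μTR :=
    integrable_inv_one_add_sq.comp_snd (volume.restrict (Set.Ioc 0 (2 * π)))
  refine (h1.add h2).mono' hf'.aestronglyMeasurable ?_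
  refine Filter.Eventually.of_forall fun z => ?_
  simpa using norm_pow_mul_le_weight z.2 (f z.1 z.2) (Nat.zero_le N)

lemma cexp_neg_I_mul_add (l ξ x v : ℝ) : Complex.exp (-Complex.I * (l * x + ξ * v)) =
    Complex.exp (-Complex.I * (l * x)) * Complex.exp (-Complex.I * (ξ * v)) := by
  rw [← Complex.exp_add]; congr 1; ring

lemma integrable_mul_cexp_strip {f : ℝ → ℝ → ℂ}
    (hf : Integrable (fun z : ℝ × ℝ => f z.1 z.2) μTR) (l : ℤ) (ξ : ℝ) :
    Integrable (fun z : ℝ × ℝ =>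
      f z.1 z.2 * Complex.exp (-Complex.I * ((l : ℝ) * z.1 + ξ * z.2))) μTR := by
  refine hf.mul_bdd (c := 1) (Continuous.aestronglyMeasurable (by fun_prop)) ?_
  refine Filter.Eventually.of_forall fun z => ?_
  rw [cexp_neg_I_mul_add, norm_mul, norm_cexp_neg_I_mul, norm_cexp_neg_I_mul, mul_one]

lemma fHat_eq_lineFourier {f : ℝ → ℝ → ℂ}
    (hf : Integrable (fun z : ℝ × ℝ => f z.1 z.2) μTR) (l : ℤ) :
    fHat f l = lineFourier (spaceCoeff f l) := by
  ext ξ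
  rw [fHat, lineFourier, μTR, integral_prod_symm _ (integrable_mul_cexp_strip hf l ξ),
    ← integral_const_mul]
  refine integral_congr_ae (Filter.Eventually.of_forall fun v => ?_)
  simp only [spaceCoeff]
  rw [mul_assoc, ← integral_mul_const]
  congr 1
  refine integral_congr_ae (Filter.Eventually.of_forall fun x => ?_)
  simp only
  rw [cexp_neg_I_mul_add, mul_assoc]

lemma fHat_eq_integral_lineFourier {f : ℝ → ℝ → ℂ}
    (hf : Integrable (fun z : ℝ × ℝ => f z.1 z.2) μTR) (l : ℤ) (ξ : ℝ) :
    fHat f l ξ = (1 / (2 * π)) * ∫ x in Ioc 0 (2 * π),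
      Complex.exp (-Complex.I * ((l : ℝ) * x)) * lineFourier (f x) ξ := by
  rw [fHat, μTR, integral_prod _ (integrable_mul_cexp_strip hf l ξ)]
  congr 1
  refine integral_congr_ae (Filter.Eventually.of_forall fun x => ?_)
  simp only [lineFourier]
  rw [← integral_const_mul]
  refine integral_congr_ae (Filter.Eventually.of_forall fun v => ?_)
  simp only
  rw [cexp_neg_I_mul_add]
  ring

lemma stronglyMeasurable_spaceCoeff {f : ℝ → ℝ → ℂ} (hf : Continuous (Function.uncurry f))
    (l : ℤ) : StronglyMeasurable (spaceCoeff f l) := by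
  have hf' : Continuous fun z : ℝ × ℝ => f z.1 z.2 := hf
  have h : Continuous fun z : ℝ × ℝ =>
      f z.1 z.2 * Complex.exp (-Complex.I * ((l : ℝ) * z.1)) := by fun_prop
  exact (StronglyMeasurable.integral_prod_left (μ := volume.restrict (Ioc 0 (2 * π)))
    (h.stronglyMeasurable (α := ℝ × ℝ))).const_mul _

lemma spaceCoeff_eq_fourierCoeffOn (f : ℝ → ℝ → ℂ) (l : ℤ) (v : ℝ) :
    spaceCoeff f l v = fourierCoeffOn two_pi_pos (fun x => f x v) l := by
  rw [fourierCoeffOn_eq_integral, spaceCoeff, intervalIntegral.integral_of_le two_pi_pos.le,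
    Complex.real_smul]
  congr 1
  · push_cast; ring
  · refine integral_congr_ae (Filter.Eventually.of_forall fun x => ?_)
    have : (π : ℂ) ≠ 0 := by exact_mod_cast pi_ne_zero
    simp only [fourier_coe_apply, smul_eq_mul]
    rw [mul_comm]
    congr 2
    push_cast
    field_simp
    ring

lemma tsum_spaceCoeff_sq_le {f : ℝ → ℝ → ℂ} (hf : Continuous (Function.uncurry f)) (v : ℝ) :
    ∑' l : ℤ, ‖spaceCoeff f l v‖ₑ ^ 2 ≤ ∫⁻ x in Ioc 0 (2 * π), ‖f x v‖ₑ ^ 2 := by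
  have hc : Continuous fun x => f x v := hf.comp (by fun_prop : Continuous fun x : ℝ => (x, v))
  have hL2 : MemLp (fun x => f x v) 2 (volume.restrict (Ioc 0 (2 * π))) :=
    (memLp_two_iff_integrable_sq_norm hc.aestronglyMeasurable).2
      (((hc.norm.pow 2).integrableOn_Icc).mono_set Ioc_subset_Icc_self)
  have hs := hasSum_sq_fourierCoeffOn two_pi_pos hL2
  have e : ∀ l, ‖spaceCoeff f l v‖ₑ ^ 2 =
      ENNReal.ofReal (‖fourierCoeffOn two_pi_pos (fun x => f x v) l‖ ^ 2) := fun l => by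
    rw [spaceCoeff_eq_fourierCoeffOn, ENNReal.ofReal_pow (norm_nonneg _), ofReal_norm]
  simp_rw [e]
  rw [← ENNReal.ofReal_tsum_of_nonneg (fun _ => by positivity) hs.summable, hs.tsum_eq]
  have hi : IntegrableOn (fun x => ‖f x v‖ ^ 2) (Ioc 0 (2 * π)) :=
    ((hc.norm.pow 2).integrableOn_Icc).mono_set Ioc_subset_Icc_self
  have e2 : ∫⁻ x in Ioc 0 (2 * π), ‖f x v‖ₑ ^ 2 =
      ENNReal.ofReal (∫ x in Ioc 0 (2 * π), ‖f x v‖ ^ 2) := by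
    rw [ofReal_integral_eq_lintegral_ofReal hi
      (Filter.Eventually.of_forall fun _ => by positivity)]
    refine lintegral_congr fun x => ?_
    rw [ENNReal.ofReal_pow (norm_nonneg _), ofReal_norm]
  rw [e2, intervalIntegral.integral_of_le two_pi_pos.le, smul_eq_mul]
  refine ENNReal.ofReal_le_ofReal (mul_le_of_le_one_left ?_ ?_)
  · exact integral_nonneg fun _ => by positivity
  · rw [sub_zero]
    exact inv_le_one_of_one_le₀ (by nlinarith [pi_gt_three])

lemma tsum_lineEnergy_spaceCoeff_le {f : ℝ → ℝ → ℂ} (hf : Continuous (Function.uncurry f))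
    (N : ℕ) : ∑' l : ℤ, lineEnergy N (spaceCoeff f l) ≤ stripEnergy N f := by
  have hf' : Continuous fun z : ℝ × ℝ => f z.1 z.2 := hf
  have hw : Measurable fun v : ℝ => ENNReal.ofReal ((1 + v ^ 2) ^ N) := by fun_prop
  simp only [lineEnergy]
  have hmm : ∀ l, AEMeasurable fun v =>
      ENNReal.ofReal ((1 + v ^ 2) ^ N) * ‖spaceCoeff f l v‖ₑ ^ 2 := fun l =>
    (hw.mul ((stronglyMeasurable_spaceCoeff hf l).enorm.pow_const 2)).aemeasurable
  rw [← lintegral_tsum hmm]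
  simp_rw [ENNReal.tsum_mul_left]
  have hm : Measurable fun z : ℝ × ℝ => ENNReal.ofReal ((1 + z.2 ^ 2) ^ N) * ‖f z.1 z.2‖ₑ ^ 2 :=
    Measurable.mul (by fun_prop) (hf'.measurable.enorm.pow_const 2)
  rw [stripEnergy, μTR, lintegral_prod_symm _ hm.aemeasurable]
  refine lintegral_mono fun v => ?_
  simp only
  rw [lintegral_const_mul _ ?_]
  · exact mul_le_mul_right (tsum_spaceCoeff_sq_le hf v) _
  · have : Continuous fun x => f x v := hf.comp (by fun_prop : Continuous fun x : ℝ => (x, v))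
    exact this.measurable.enorm.pow_const 2

lemma lineEnergy_spaceCoeff_ne_top {f : ℝ → ℝ → ℂ} (hf : Continuous (Function.uncurry f))
    {N : ℕ} (hE : stripEnergy N f ≠ ⊤) (l : ℤ) : lineEnergy N (spaceCoeff f l) ≠ ⊤ :=
  ne_top_of_le_ne_top hE ((ENNReal.le_tsum l).trans (tsum_lineEnergy_spaceCoeff_le hf N))

lemma aeDiffOrder_fHat {N : ℕ} {f : ℝ → ℝ → ℂ} (hf : Continuous (Function.uncurry f))
    (hE : stripEnergy (N + 1) f ≠ ⊤) (l : ℤ) : AEDiffOrder N (fHat f l) := by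
  rw [fHat_eq_lineFourier (integrable_of_stripEnergy hf hE)]
  exact aeDiffOrder_lineFourier (stronglyMeasurable_spaceCoeff hf l).aestronglyMeasurable
    (lineEnergy_spaceCoeff_ne_top hf hE l)

lemma tsum_lintegral_iteratedDeriv_fHat_le {N : ℕ} {f : ℝ → ℝ → ℂ}
    (hf : Continuous (Function.uncurry f)) (hE : stripEnergy (N + 1) f ≠ ⊤) {j : ℕ}
    (hj : j ≤ N + 1) :
    ∑' l : ℤ, ∫⁻ ξ, ‖iteratedDeriv j (fHat f l) ξ‖ₑ ^ 2 ≤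
      ENNReal.ofReal (2 * π) * stripEnergy (N + 1) f := by
  refine le_trans ?_ (mul_le_mul_right (tsum_lineEnergy_spaceCoeff_le hf (N + 1)) _)
  rw [← ENNReal.tsum_mul_left]
  refine ENNReal.tsum_le_tsum fun l => ?_
  rw [fHat_eq_lineFourier (integrable_of_stripEnergy hf hE)]
  exact lintegral_iteratedDeriv_lineFourier_sq_le
    (stronglyMeasurable_spaceCoeff hf l).aestronglyMeasurable
    (lineEnergy_spaceCoeff_ne_top hf hE l) hj

lemma fHat_pX {f : ℝ → ℝ → ℂ} (hf : Integrable (fun z : ℝ × ℝ => f z.1 z.2) μTR)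
    (hd : ∀ v, Differentiable ℝ fun x => f x v) (hcf : ∀ v, Continuous fun x => f x v)
    (hc : ∀ v, Continuous fun x => pX f x v)
    (hper : ∀ v, Function.Periodic (fun x => f x v) (2 * π))
    (hf' : Integrable (fun z : ℝ × ℝ => pX f z.1 z.2) μTR) (l : ℤ) (ξ : ℝ) :
    fHat (pX f) l ξ = Complex.I * l * fHat f l ξ := by
  have key : ∀ v, spaceCoeff (pX f) l v = Complex.I * l * spaceCoeff f l v := by
    intro v
    have hder : ∀ x, HasDerivAt (fun x : ℝ => f x v * Complex.exp (-Complex.I * ((l : ℝ) * x)))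
        (pX f x v * Complex.exp (-Complex.I * ((l : ℝ) * x)) -
          Complex.I * l * (f x v * Complex.exp (-Complex.I * ((l : ℝ) * x)))) x := by
      intro x
      have h1 : HasDerivAt (fun x : ℝ => -Complex.I * (((l : ℝ) : ℂ) * x))
          (-Complex.I * (((l : ℝ) : ℂ) * 1)) x :=
        ((Complex.ofRealCLM.hasDerivAt (x := x)).const_mul _).const_mul _
      refine ((hd v x).hasDerivAt.mul h1.cexp).congr_deriv ?_
      simp only [pX]
      push_cast
      ring
    have hcv := hcf v
    have hc2 := hc v
    have i1 : IntervalIntegrable (fun x : ℝ => pX f x v * Complex.exp (-Complex.I * ((l : ℝ) * x)))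
        volume 0 (2 * π) := Continuous.intervalIntegrable (by fun_prop) _ _
    have i2 : IntervalIntegrable (fun x : ℝ => Complex.I * l *
        (f x v * Complex.exp (-Complex.I * ((l : ℝ) * x))))
        volume 0 (2 * π) := Continuous.intervalIntegrable (by fun_prop) _ _
    have h := intervalIntegral.integral_eq_sub_of_hasDerivAt (a := 0) (b := 2 * π)
      (fun x _ => hder x) (i1.sub i2)
    rw [intervalIntegral.integral_sub i1 i2, intervalIntegral.integral_const_mul] at h
    have hp : f (2 * π) v = f 0 v := by simpa using hper v 0
    have he : Complex.exp (-Complex.I * ((l : ℝ) * (2 * π : ℝ))) = 1 := by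
      rw [Complex.exp_eq_one_iff]
      exact ⟨-l, by push_cast; ring⟩
    rw [he, hp] at h
    simp only [Complex.ofReal_zero, mul_zero, Complex.exp_zero, sub_self] at h
    rw [intervalIntegral.integral_of_le two_pi_pos.le,
      intervalIntegral.integral_of_le two_pi_pos.le] at h
    simp only [spaceCoeff]
    rw [sub_eq_zero.1 h]
    ring
  rw [fHat_eq_lineFourier hf, fHat_eq_lineFourier hf', lineFourier, lineFourier,
    ← integral_const_mul]
  refine integral_congr_ae (Filter.Eventually.of_forall fun v => ?_)
  simp only [key]
  ring

lemma lineFourier_deriv {u : ℝ → ℂ} (hu : Integrable u) (hd : Differentiable ℝ u)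
    (hu' : Integrable (deriv u)) (ξ : ℝ) :
    lineFourier (deriv u) ξ = Complex.I * ξ * lineFourier u ξ := by
  rw [lineFourier_eq_fourier, lineFourier_eq_fourier, Real.fourier_deriv hu hd hu']
  simp only [smul_eq_mul]
  have : (π : ℂ) ≠ 0 := by exact_mod_cast pi_ne_zero
  push_cast
  field_simp

lemma fHat_pV {f : ℝ → ℝ → ℂ} (hf : Integrable (fun z : ℝ × ℝ => f z.1 z.2) μTR)
    (hd : ∀ x, Differentiable ℝ (f x))
    (hf' : Integrable (fun z : ℝ × ℝ => pV f z.1 z.2) μTR) (l : ℤ) (ξ : ℝ) :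
    fHat (pV f) l ξ = Complex.I * ξ * fHat f l ξ := by
  rw [fHat_eq_integral_lineFourier hf, fHat_eq_integral_lineFourier hf', mul_left_comm]
  congr 1
  rw [← integral_const_mul]
  refine integral_congr_ae ?_
  rw [μTR] at hf hf'
  filter_upwards [hf.prod_right_ae, hf'.prod_right_ae] with x h1 h2
  have : lineFourier (pV f x) ξ = Complex.I * ξ * lineFourier (f x) ξ :=
    lineFourier_deriv h1 (hd x) h2 ξ
  simp only [this]
  ring

lemma contDiff_pX {f : ℝ → ℝ → ℂ} {n : ℕ} (hf : ContDiff ℝ (n + 1 : ℕ) (Function.uncurry f)) :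
    ContDiff ℝ n (Function.uncurry (pX f)) := by
  have h : Function.uncurry (pX f) = fun z => fderiv ℝ (Function.uncurry f) z (1, 0) := by
    ext ⟨x, v⟩
    have h1 : HasFDerivAt (Function.uncurry f) (fderiv ℝ (Function.uncurry f) (x, v)) (x, v) :=
      (hf.differentiable (by simp) _).hasFDerivAt
    have h2 : HasDerivAt (fun x' : ℝ => (x', v)) ((1 : ℝ), (0 : ℝ)) x :=
      (hasDerivAt_id x).prodMk (hasDerivAt_const x v)
    exact (h1.comp_hasDerivAt x h2).deriv
  rw [h]
  exact (hf.fderiv_right (by simp)).clm_apply contDiff_const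

lemma contDiff_pV {f : ℝ → ℝ → ℂ} {n : ℕ} (hf : ContDiff ℝ (n + 1 : ℕ) (Function.uncurry f)) :
    ContDiff ℝ n (Function.uncurry (pV f)) := by
  have h : Function.uncurry (pV f) = fun z => fderiv ℝ (Function.uncurry f) z (0, 1) := by
    ext ⟨x, v⟩
    have h1 : HasFDerivAt (Function.uncurry f) (fderiv ℝ (Function.uncurry f) (x, v)) (x, v) :=
      (hf.differentiable (by simp) _).hasFDerivAt
    have h2 : HasDerivAt (fun v' : ℝ => (x, v')) ((0 : ℝ), (1 : ℝ)) v :=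
      (hasDerivAt_const v x).prodMk (hasDerivAt_id v)
    exact (h1.comp_hasDerivAt v h2).deriv
  rw [h]
  exact (hf.fderiv_right (by simp)).clm_apply contDiff_const

lemma periodic_pX {f : ℝ → ℝ → ℂ} (hper : ∀ v, Function.Periodic (fun x => f x v) (2 * π)) (v : ℝ) :
    Function.Periodic (fun x => pX f x v) (2 * π) := by
  intro x
  have h : (fun x' => f (x' + 2 * π) v) = fun x' => f x' v := funext fun x' => hper v x'
  simp only [pX]
  rw [← deriv_comp_add_const, h]

lemma continuous_slice_left {f : ℝ → ℝ → ℂ} (hf : Continuous (Function.uncurry f))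
    (v : ℝ) : Continuous fun x => f x v :=
  hf.comp (by fun_prop : Continuous fun x : ℝ => (x, v))

lemma fHat_iterate_pX {N d : ℕ} : ∀ {f : ℝ → ℝ → ℂ}, ContDiff ℝ d (Function.uncurry f) →
    (∀ v, Function.Periodic (fun x => f x v) (2 * π)) →
    (∀ i ≤ d, stripEnergy (N + 1) (pX^[i] f) ≠ ⊤) → ∀ l : ℤ,
    fHat (pX^[d] f) l = fun ξ => (Complex.I * l) ^ d * fHat f l ξ := by
  induction d with
  | zero => intros; simp
  | succ d ih =>
    intro f hf hper hE l
    have hf1 := contDiff_pX hf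
    have h0 := integrable_of_stripEnergy hf.continuous (hE 0 (by omega))
    have h1 := integrable_of_stripEnergy hf1.continuous (hE 1 (by omega))
    rw [Function.iterate_succ_apply, ih hf1 (periodic_pX hper) fun i hi => by
      simpa using hE (i + 1) (by omega)]
    ext ξ
    rw [fHat_pX h0 (fun v => ?_) (continuous_slice_left hf.continuous)
      (continuous_slice_left hf1.continuous) hper h1]
    · ring
    · have hc := hf.differentiable (by simp)
      exact hc.comp (by fun_prop : Differentiable ℝ fun x : ℝ => (x, v))

lemma contDiff_iterate_pX {d : ℕ} : ∀ {f : ℝ → ℝ → ℂ}, ContDiff ℝ d (Function.uncurry f) →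
    Continuous (Function.uncurry (pX^[d] f)) := by
  induction d with
  | zero => intro f hf; exact hf.continuous
  | succ d ih => intro f hf; exact ih (contDiff_pX hf)

lemma enorm_I : ‖Complex.I‖ₑ = 1 := by simp [enorm_eq_nnnorm]

lemma tsum_lintegral_fst_pow_mul_le {N d : ℕ} {f : ℝ → ℝ → ℂ}
    (hf : ContDiff ℝ d (Function.uncurry f))
    (hper : ∀ v, Function.Periodic (fun x => f x v) (2 * π))
    (hE : ∀ i ≤ d, stripEnergy (N + 1) (pX^[i] f) ≠ ⊤) {j : ℕ} (hj : j ≤ N + 1) :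
    ∑' l : ℤ, ∫⁻ ξ, (‖(l : ℂ)‖ₑ ^ d * ‖iteratedDeriv j (fHat f l) ξ‖ₑ) ^ 2 ≤
      ENNReal.ofReal (2 * π) * stripEnergy (N + 1) (pX^[d] f) := by
  refine le_trans (le_of_eq ?_) (tsum_lintegral_iteratedDeriv_fHat_le (contDiff_iterate_pX hf)
    (hE d le_rfl) hj)
  refine tsum_congr fun l => lintegral_congr fun ξ => ?_
  rw [fHat_iterate_pX hf hper hE, iteratedDeriv_const_mul_field]
  simp [enorm_mul, enorm_pow, enorm_I]

lemma ENNReal.add_sq_le_four_mul (a b : ℝ≥0∞) : (a + b) ^ 2 ≤ 4 * (a ^ 2 + b ^ 2) := by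
  wlog h : a ≤ b generalizing a b
  · rw [add_comm a, add_comm (a ^ 2)]; exact this b a (le_of_not_ge h)
  calc (a + b) ^ 2 ≤ (b + b) ^ 2 := by gcongr
    _ = 4 * b ^ 2 := by ring
    _ ≤ _ := by gcongr; exact le_add_self

lemma measurable_iteratedDeriv_of_continuous {F : ℝ → ℂ} (hF : Continuous F) (j : ℕ) :
    Measurable (iteratedDeriv j F) := by
  cases j with
  | zero => simpa using hF.measurable
  | succ j => rw [iteratedDeriv_succ]; exact measurable_deriv _

lemma measurable_iteratedDeriv_fHat {f : ℝ → ℝ → ℂ}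
    (hf : Integrable (fun z : ℝ × ℝ => f z.1 z.2) μTR)
    (l : ℤ) (j : ℕ) : Measurable (iteratedDeriv j (fHat f l)) := by
  refine measurable_iteratedDeriv_of_continuous ?_ j
  rw [fHat_eq_lineFourier hf]
  refine continuous_lineFourier ?_
  have h : Integrable (fun z : ℝ × ℝ => f z.1 z.2 * Complex.exp (-Complex.I * ((l : ℝ) * z.1)))
      μTR := by
    simpa using integrable_mul_cexp_strip hf l 0
  exact h.integral_prod_right.const_mul _

lemma enorm_snd_mul_iteratedDeriv_le {N : ℕ} {f : ℝ → ℝ → ℂ}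
    (hf : ContDiff ℝ 1 (Function.uncurry f)) (h0 : stripEnergy (N + 1) f ≠ ⊤)
    (h1 : stripEnergy (N + 1) (pV f) ≠ ⊤) {j : ℕ} (hj : j ≤ N + 1) (l : ℤ) :
    ∀ᵐ ξ : ℝ, ‖ξ‖ₑ * ‖iteratedDeriv j (fHat f l) ξ‖ₑ ≤
      ‖iteratedDeriv j (fHat (pV f) l) ξ‖ₑ +
        (N + 1 : ℕ) * ‖iteratedDeriv (j - 1) (fHat f l) ξ‖ₑ := by
  have hf1 : ContDiff ℝ (0 : ℕ) (Function.uncurry (pV f)) := contDiff_pV (by simpa using hf)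
  have e : fHat (pV f) l = fun ξ : ℝ => -Complex.I * (fHat f l ξ * (0 - ξ)) := by
    ext ξ
    rw [fHat_pV (integrable_of_stripEnergy hf.continuous h0) (fun x => ?_)
      (integrable_of_stripEnergy hf1.continuous h1)]
    · ring
    · exact (hf.differentiable (by simp)).comp (by fun_prop : Differentiable ℝ fun v : ℝ => (x, v))
  filter_upwards [ae_iteratedDeriv_mul_affine (aeDiffOrder_fHat hf.continuous h0 l) 0 hj]
    with ξ h
  rw [e, iteratedDeriv_const_mul_field, h]
  have hb : (j : ℝ≥0∞) ≤ (N + 1 : ℕ) := by exact_mod_cast hj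
  refine le_trans (le_of_eq ?_) ((enorm_sub_le (E := ℂ)
    (a := -(ξ : ℂ) * iteratedDeriv j (fHat f l) ξ + -(j * iteratedDeriv (j - 1) (fHat f l) ξ))
    (b := -(j * iteratedDeriv (j - 1) (fHat f l) ξ))).trans (add_le_add (le_of_eq ?_) ?_))
  · rw [add_sub_cancel_right, enorm_mul, enorm_neg]
    simp [enorm_eq_nnnorm]
  · rw [enorm_mul]
    simp only [enorm_neg]
    rw [enorm_I, one_mul]
    congr 1
    ring
  · rw [enorm_neg, enorm_mul]
    gcongr
    refine le_trans (le_of_eq ?_) hb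
    simp [enorm_eq_nnnorm]

lemma exists_tsum_lintegral_snd_pow_mul_le (N d : ℕ) : ∃ C : ℝ≥0∞, C ≠ ⊤ ∧
    ∀ f : ℝ → ℝ → ℂ, ContDiff ℝ d (Function.uncurry f) →
    (∀ q ≤ d, stripEnergy (N + 1) (pV^[q] f) ≠ ⊤) → ∀ j ≤ N + 1,
    ∑' l : ℤ, ∫⁻ ξ : ℝ, (‖ξ‖ₑ ^ d * ‖iteratedDeriv j (fHat f l) ξ‖ₑ) ^ 2 ≤
      C * ∑ q ∈ Finset.range (d + 1), stripEnergy (N + 1) (pV^[q] f) := by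
  induction d with
  | zero =>
    refine ⟨ENNReal.ofReal (2 * π), ENNReal.ofReal_ne_top, fun f hf hE j hj => ?_⟩
    simpa using tsum_lintegral_iteratedDeriv_fHat_le hf.continuous (hE 0 le_rfl) hj
  | succ d ih =>
    obtain ⟨C, hC, ih⟩ := ih
    refine ⟨4 * (C + (N + 1 : ℕ) ^ 2 * C), by finiteness, fun f hf hE j hj => ?_⟩
    have hf1 := contDiff_pV hf
    have h0 := hE 0 (by omega)
    have h1 := hE 1 (by omega)
    have hfd : ContDiff ℝ d (Function.uncurry f) := hf.of_le (by exact_mod_cast Nat.le_succ d)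
    have hfo : ContDiff ℝ 1 (Function.uncurry f) := hf.of_le (by exact_mod_cast Nat.le_add_left 1 d)
    have A1 := ih (pV f) hf1 (fun q hq => by simpa using hE (q + 1) (by omega)) j hj
    have A2 := ih f hfd (fun q hq => hE q (by omega)) (j - 1) (by omega)
    have B1 : ∑ q ∈ Finset.range (d + 1), stripEnergy (N + 1) (pV^[q] (pV f)) ≤
        ∑ q ∈ Finset.range (d + 1 + 1), stripEnergy (N + 1) (pV^[q] f) := by
      rw [Finset.sum_range_succ' _ (d + 1)]
      exact le_self_add
    have B2 : ∑ q ∈ Finset.range (d + 1), stripEnergy (N + 1) (pV^[q] f) ≤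
        ∑ q ∈ Finset.range (d + 1 + 1), stripEnergy (N + 1) (pV^[q] f) := by
      rw [Finset.sum_range_succ _ (d + 1)]
      exact le_self_add
    set E := ∑ q ∈ Finset.range (d + 1 + 1), stripEnergy (N + 1) (pV^[q] f)
    have hm : ∀ l : ℤ, Measurable fun ξ : ℝ =>
        (‖ξ‖ₑ ^ d * ‖iteratedDeriv j (fHat (pV f) l) ξ‖ₑ) ^ 2 := fun l => by
      have := measurable_iteratedDeriv_fHat (integrable_of_stripEnergy hf1.continuous h1) l j
      fun_prop
    have key : ∀ l : ℤ, ∫⁻ ξ : ℝ, (‖ξ‖ₑ ^ (d + 1) * ‖iteratedDeriv j (fHat f l) ξ‖ₑ) ^ 2 ≤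
        4 * (∫⁻ ξ : ℝ, (‖ξ‖ₑ ^ d * ‖iteratedDeriv j (fHat (pV f) l) ξ‖ₑ) ^ 2) +
        4 * (N + 1 : ℕ) ^ 2 *
          ∫⁻ ξ : ℝ, (‖ξ‖ₑ ^ d * ‖iteratedDeriv (j - 1) (fHat f l) ξ‖ₑ) ^ 2 := fun l => by
      rw [← lintegral_const_mul' _ _ (by finiteness), ← lintegral_const_mul' _ _ (by finiteness),
        ← lintegral_add_left ((hm l).const_mul 4)]
      refine lintegral_mono_ae ?_
      filter_upwards [enorm_snd_mul_iteratedDeriv_le hfo h0 h1 hj l] with ξ h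
      calc _ = (‖ξ‖ₑ ^ d * (‖ξ‖ₑ * ‖iteratedDeriv j (fHat f l) ξ‖ₑ)) ^ 2 := by ring
        _ ≤ (‖ξ‖ₑ ^ d * (‖iteratedDeriv j (fHat (pV f) l) ξ‖ₑ +
              (N + 1 : ℕ) * ‖iteratedDeriv (j - 1) (fHat f l) ξ‖ₑ)) ^ 2 := by gcongr
        _ ≤ _ := by
          rw [mul_add]
          exact (ENNReal.add_sq_le_four_mul _ _).trans (le_of_eq (by ring))
    calc _ ≤ _ := ENNReal.tsum_le_tsum key
      _ ≤ 4 * (C * E) + 4 * (N + 1 : ℕ) ^ 2 * (C * E) := by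
        rw [ENNReal.tsum_add, ENNReal.tsum_mul_left, ENNReal.tsum_mul_left]
        gcongr
        · exact A1.trans (by gcongr)
        · exact A2.trans (by gcongr)
      _ = _ := by ring

/-- The elementary weight comparable to `(1 + l² + ξ²)^{1/2}`. -/
def freqWeight (l : ℤ) (ξ : ℝ) : ℝ := 1 + |(l : ℝ)| + |ξ|

lemma one_le_freqWeight (l : ℤ) (ξ : ℝ) : 1 ≤ freqWeight l ξ := by
  have := abs_nonneg (l : ℝ)
  have := abs_nonneg ξ
  unfold freqWeight
  linarith

lemma measurable_freqWeight (l : ℤ) : Measurable (freqWeight l) := by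
  unfold freqWeight
  fun_prop

lemma freqWeight_pow_le (l : ℤ) (ξ : ℝ) (d : ℕ) :
    freqWeight l ξ ^ d ≤ 3 ^ d * (1 + |(l : ℝ)| ^ d + |ξ| ^ d) := by
  have ha := abs_nonneg (l : ℝ)
  have hb := abs_nonneg ξ
  set a := |(l : ℝ)|
  set b := |ξ|
  have key : ∀ t, 0 ≤ t → 1 ≤ t → a ≤ t → b ≤ t → (1 + a + b) ^ d ≤ 3 ^ d * t ^ d := by
    intro t _ h1 h2 h3
    rw [← mul_pow]
    exact pow_le_pow_left₀ (by positivity) (by linarith) _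
  have hpa : 0 ≤ a ^ d := by positivity
  have hpb : 0 ≤ b ^ d := by positivity
  have h3 : (0 : ℝ) < 3 ^ d := by positivity
  unfold freqWeight
  rcases le_total a 1 with h | h <;> rcases le_total b 1 with h' | h' <;>
    rcases le_total a b with h'' | h''
  all_goals
    first
    | refine (key 1 (by linarith) (by linarith) (by linarith) (by linarith)).trans ?_
      rw [one_pow]
      exact mul_le_mul_of_nonneg_left (by linarith) h3.le
    | refine (key a (by linarith) (by linarith) (by linarith) (by linarith)).trans ?_
      exact mul_le_mul_of_nonneg_left (by linarith) h3.le
    | refine (key b (by linarith) (by linarith) (by linarith) (by linarith)).trans ?_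
      exact mul_le_mul_of_nonneg_left (by linarith) h3.le

/-- The weighted `L²` norm (squared) of `∂_ξ^j ĥ` with weight `(1 + |l| + |ξ|)^d`. -/
def freqEnergy (d j : ℕ) (h : ℝ → ℝ → ℂ) : ℝ≥0∞ :=
  ∑' l : ℤ, ∫⁻ ξ, (‖freqWeight l ξ‖ₑ ^ d * ‖iteratedDeriv j (fHat h l) ξ‖ₑ) ^ 2

lemma stripEnergy_eq_ofReal {N p q : ℕ} {h : ℝ → ℝ → ℂ}
    (hi : Integrable (wInt ((N : ℕ) : ℝ) p q h) μTR) :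
    stripEnergy N (pX^[p] (pV^[q] h)) = ENNReal.ofReal (∫ z, wInt ((N : ℕ) : ℝ) p q h z ∂μTR) := by
  rw [ofReal_integral_eq_lintegral_ofReal hi]
  · refine lintegral_congr fun z => ?_
    rw [wInt, ENNReal.ofReal_mul (by positivity), Real.rpow_natCast,
      ENNReal.ofReal_pow (norm_nonneg _), ofReal_norm]
  · exact Filter.Eventually.of_forall fun z => by simp only [wInt, Pi.zero_apply]; positivity

lemma integral_wInt_nonneg (m0 : ℝ) (p q : ℕ) (h : ℝ → ℝ → ℂ) :
    0 ≤ ∫ z, wInt m0 p q h z ∂μTR :=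
  integral_nonneg fun z => by simp only [wInt, Pi.zero_apply]; positivity

lemma integral_wInt_le_HnormSq (m0 : ℝ) {p q n : ℕ} (hpq : p + q ≤ n) (h : ℝ → ℝ → ℂ) :
    ∫ z, wInt m0 p q h z ∂μTR ≤ HnormSq m0 n h := by
  have h1 : ∫ z, wInt m0 p q h z ∂μTR ≤
      ∑ q ∈ Finset.range (n + 1 - p), ∫ z, wInt m0 p q h z ∂μTR :=
    Finset.single_le_sum (f := fun q => ∫ z, wInt m0 p q h z ∂μTR)
      (fun q _ => integral_wInt_nonneg m0 p q h) (Finset.mem_range.2 (by omega))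
  refine h1.trans ?_
  exact Finset.single_le_sum (f := fun p => ∑ q ∈ Finset.range (n + 1 - p),
    ∫ z, wInt m0 p q h z ∂μTR)
    (fun p _ => Finset.sum_nonneg fun q _ => integral_wInt_nonneg m0 p q h)
    (Finset.mem_range.2 (by omega))

lemma HnormSq_nonneg (m0 : ℝ) (n : ℕ) (h : ℝ → ℝ → ℂ) : 0 ≤ HnormSq m0 n h :=
  Finset.sum_nonneg fun p _ => Finset.sum_nonneg fun q _ => integral_wInt_nonneg m0 p q h

lemma MemH.stripEnergy_le {N n d p q : ℕ} {h : ℝ → ℝ → ℂ} (hh : MemH ((N : ℕ) : ℝ) n h)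
    (hd : d ≤ n) (hpq : p + q ≤ d) :
    stripEnergy N (pX^[p] (pV^[q] h)) ≤ ENNReal.ofReal (HnormSq ((N : ℕ) : ℝ) d h) := by
  rw [stripEnergy_eq_ofReal (hh.2.2 p q (by omega))]
  exact ENNReal.ofReal_le_ofReal (integral_wInt_le_HnormSq _ hpq h)

lemma exists_freqEnergy_le (N d : ℕ) : ∃ C : ℝ≥0∞, C ≠ ⊤ ∧
    ∀ (n : ℕ) (h : ℝ → ℝ → ℂ), MemH ((N + 1 : ℕ) : ℝ) n h → d ≤ n → ∀ j ≤ N + 1,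
      freqEnergy d j h ≤ C * ENNReal.ofReal (HnormSq ((N + 1 : ℕ) : ℝ) d h) := by
  obtain ⟨C, hC, hv⟩ := exists_tsum_lintegral_snd_pow_mul_le N d
  refine ⟨(3 ^ d) ^ 2 * 4 * (4 * (ENNReal.ofReal (2 * π) + ENNReal.ofReal (2 * π)) +
    C * (d + 1 : ℕ)), by finiteness, fun n h hh hd j hj => ?_⟩
  have hcd : ContDiff ℝ d (Function.uncurry h) := hh.1.of_le (by exact_mod_cast hd)
  set E := ENNReal.ofReal (HnormSq ((N + 1 : ℕ) : ℝ) d h) with hE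
  have hEtop : E ≠ ⊤ := ENNReal.ofReal_ne_top
  have hX : ∀ i ≤ d, stripEnergy (N + 1) (pX^[i] h) ≤ E := fun i hi =>
    hh.stripEnergy_le (p := i) (q := 0) hd (by omega)
  have hV : ∀ i ≤ d, stripEnergy (N + 1) (pV^[i] h) ≤ E := fun i hi =>
    hh.stripEnergy_le (p := 0) (q := i) hd (by omega)
  have h0E : stripEnergy (N + 1) h ≤ E := by simpa using hX 0 (by omega)
  have t0 := tsum_lintegral_iteratedDeriv_fHat_le hcd.continuous
    (ne_top_of_le_ne_top hEtop h0E) hj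
  have tX := tsum_lintegral_fst_pow_mul_le hcd hh.2.1
    (fun i hi => ne_top_of_le_ne_top hEtop (hX i hi)) hj
  have tV := hv h hcd (fun i hi => ne_top_of_le_ne_top hEtop (hV i hi)) j hj
  have hm : ∀ l : ℤ, Measurable (iteratedDeriv j (fHat h l)) := fun l =>
    measurable_iteratedDeriv_fHat (integrable_of_stripEnergy hcd.continuous
      (ne_top_of_le_ne_top hEtop h0E)) l j
  have hw : ∀ (l : ℤ) (ξ : ℝ), ‖freqWeight l ξ‖ₑ ^ d ≤
      3 ^ d * (1 + ‖(l : ℂ)‖ₑ ^ d + ‖ξ‖ₑ ^ d) := fun l ξ => by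
    have h1 := ENNReal.ofReal_le_ofReal (freqWeight_pow_le l ξ d)
    have h0 := one_le_freqWeight l ξ
    rw [ENNReal.ofReal_pow (by linarith), ENNReal.ofReal_mul (by positivity),
      ENNReal.ofReal_add (by positivity) (by positivity),
      ENNReal.ofReal_add (by positivity) (by positivity), ENNReal.ofReal_pow (by positivity),
      ENNReal.ofReal_pow (by positivity), ENNReal.ofReal_pow (by positivity)] at h1
    rw [Real.enorm_of_nonneg (by linarith), ← ofReal_norm (l : ℂ), Real.enorm_eq_ofReal_abs,
      Complex.norm_intCast]
    simpa using h1
  have key : ∀ l : ℤ,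
      ∫⁻ ξ, (‖freqWeight l ξ‖ₑ ^ d * ‖iteratedDeriv j (fHat h l) ξ‖ₑ) ^ 2 ≤
      (3 ^ d) ^ 2 * 4 * (4 * ((∫⁻ ξ, ‖iteratedDeriv j (fHat h l) ξ‖ₑ ^ 2) +
        ∫⁻ ξ, (‖(l : ℂ)‖ₑ ^ d * ‖iteratedDeriv j (fHat h l) ξ‖ₑ) ^ 2) +
        ∫⁻ ξ : ℝ, (‖ξ‖ₑ ^ d * ‖iteratedDeriv j (fHat h l) ξ‖ₑ) ^ 2) := fun l => by
    have hml := hm l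
    rw [← lintegral_add_left (by fun_prop), ← lintegral_const_mul' _ _ (by finiteness),
      ← lintegral_add_left (by fun_prop), ← lintegral_const_mul' _ _ (by finiteness)]
    refine lintegral_mono fun ξ => ?_
    set a := ‖iteratedDeriv j (fHat h l) ξ‖ₑ
    calc _ ≤ (3 ^ d * (1 + ‖(l : ℂ)‖ₑ ^ d + ‖ξ‖ₑ ^ d) * a) ^ 2 := by gcongr; exact hw l ξ
      _ = (3 ^ d) ^ 2 * ((a + ‖(l : ℂ)‖ₑ ^ d * a) + ‖ξ‖ₑ ^ d * a) ^ 2 := by ring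
      _ ≤ (3 ^ d) ^ 2 * (4 * (4 * (a ^ 2 + (‖(l : ℂ)‖ₑ ^ d * a) ^ 2) + (‖ξ‖ₑ ^ d * a) ^ 2)) := by
        refine mul_le_mul_right ((ENNReal.add_sq_le_four_mul _ _).trans ?_) _
        gcongr
        exact ENNReal.add_sq_le_four_mul _ _
      _ = _ := by ring
  rw [freqEnergy]
  refine (ENNReal.tsum_le_tsum key).trans ?_
  rw [ENNReal.tsum_mul_left, ENNReal.tsum_add, ENNReal.tsum_mul_left, ENNReal.tsum_add,
    mul_assoc _ _ E]
  refine mul_le_mul_right ?_ _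
  rw [add_mul, mul_assoc, add_mul]
  gcongr
  · exact t0.trans (by gcongr)
  · exact tX.trans (by gcongr; exact hX d le_rfl)
  · refine tV.trans ?_
    rw [mul_assoc]
    gcongr
    refine (Finset.sum_le_card_nsmul _ _ E fun q hq => hV q ?_).trans (le_of_eq ?_)
    · have := Finset.mem_range.1 hq; omega
    · rw [Finset.card_range, nsmul_eq_mul]

lemma tsum_lintegral_translate (W : ℤ → ℝ → ℝ≥0∞) (k : ℤ) (s : ℝ) :
    ∑' n : ℤ, ∫⁻ ξ, W (n - k) (ξ - s) = ∑' l : ℤ, ∫⁻ ξ, W l ξ := by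
  rw [← (Equiv.subRight k).tsum_eq fun l => ∫⁻ ξ, W l ξ]
  refine tsum_congr fun n => ?_
  exact lintegral_sub_right_eq_self (fun ξ => W (n - k) ξ) s

lemma L2F_le_sqrt {u : ℤ → ℝ → ℂ} {K : ℝ≥0∞} (hK : K ≠ ⊤)
    (h : ∑' n, ∫⁻ ξ, ‖u n ξ‖ₑ ^ 2 ≤ K) : L2F u ≤ Real.sqrt K.toReal := by
  refine Real.sqrt_le_sqrt ?_
  have hle : ∀ n, ∫ ξ, ‖u n ξ‖ ^ 2 ≤ (∫⁻ ξ, ‖u n ξ‖ₑ ^ 2).toReal := fun n => by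
    have hn : ∫⁻ ξ, ‖u n ξ‖ₑ ^ 2 ≠ ⊤ := ne_top_of_le_ne_top hK ((ENNReal.le_tsum n).trans h)
    by_cases hi : Integrable fun ξ => ‖u n ξ‖ ^ 2
    · rw [integral_eq_lintegral_of_nonneg_ae
        (Filter.Eventually.of_forall fun _ => by positivity) hi.1]
      refine le_of_eq ?_
      congr 1
      refine lintegral_congr fun ξ => ?_
      rw [ENNReal.ofReal_pow (norm_nonneg _), ofReal_norm]
    · rw [integral_undef hi]; positivity
  have hs : Summable fun n => (∫⁻ ξ, ‖u n ξ‖ₑ ^ 2).toReal :=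
    ENNReal.summable_toReal (ne_top_of_le_ne_top hK h)
  have hs' : Summable fun n => ∫ ξ, ‖u n ξ‖ ^ 2 :=
    Summable.of_nonneg_of_le (fun n => integral_nonneg fun _ => by positivity) hle hs
  refine (hs'.tsum_le_tsum hle hs).trans ?_
  rw [← ENNReal.tsum_toReal_eq fun n => ne_top_of_le_ne_top hK ((ENNReal.le_tsum n).trans h)]
  exact ENNReal.toReal_mono hK h

/-- A majorant on the Fourier side: two polynomial weights times two consecutive derivatives. -/
def freqMajorant (P Q : ℝ) (b b' m : ℕ) (h : ℝ → ℝ → ℂ) (l : ℤ) (ξ : ℝ) : ℝ :=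
  (P * freqWeight l ξ ^ b + Q * freqWeight l ξ ^ b') *
    (‖iteratedDeriv m (fHat h l) ξ‖ + ‖iteratedDeriv (m - 1) (fHat h l) ξ‖)

lemma lintegral_add_sq_le {f g : ℝ → ℝ≥0∞} (hf : Measurable f) :
    ∫⁻ ξ, (f ξ + g ξ) ^ 2 ≤ 4 * ((∫⁻ ξ, f ξ ^ 2) + ∫⁻ ξ, g ξ ^ 2) := by
  rw [← lintegral_add_left (hf.pow_const 2), ← lintegral_const_mul' _ _ (by finiteness)]
  exact lintegral_mono fun ξ => ENNReal.add_sq_le_four_mul _ _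

lemma tsum_lintegral_add_sq_le {f g : ℤ → ℝ → ℝ≥0∞} (hf : ∀ n, Measurable (f n)) :
    ∑' n, ∫⁻ ξ, (f n ξ + g n ξ) ^ 2 ≤
      4 * ((∑' n, ∫⁻ ξ, f n ξ ^ 2) + ∑' n, ∫⁻ ξ, g n ξ ^ 2) := by
  rw [← ENNReal.tsum_add, ← ENNReal.tsum_mul_left]
  exact ENNReal.tsum_le_tsum fun n => lintegral_add_sq_le (hf n)

lemma tsum_lintegral_const_mul_sq (c : ℝ≥0∞) (hc : c ≠ ⊤) (f : ℤ → ℝ → ℝ≥0∞) :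
    ∑' n, ∫⁻ ξ, (c * f n ξ) ^ 2 = c ^ 2 * ∑' n, ∫⁻ ξ, f n ξ ^ 2 := by
  rw [← ENNReal.tsum_mul_left]
  refine tsum_congr fun n => ?_
  rw [← lintegral_const_mul' _ _ (by finiteness)]
  exact lintegral_congr fun ξ => mul_pow _ _ _

lemma enorm_freqMajorant_le {P Q : ℝ} (b b' m : ℕ) (h : ℝ → ℝ → ℂ) (l : ℤ) (ξ : ℝ) :
    ‖freqMajorant P Q b b' m h l ξ‖ₑ ≤
      (‖P‖ₑ * (‖freqWeight l ξ‖ₑ ^ b * ‖iteratedDeriv m (fHat h l) ξ‖ₑ) +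
        ‖P‖ₑ * (‖freqWeight l ξ‖ₑ ^ b * ‖iteratedDeriv (m - 1) (fHat h l) ξ‖ₑ)) +
      (‖Q‖ₑ * (‖freqWeight l ξ‖ₑ ^ b' * ‖iteratedDeriv m (fHat h l) ξ‖ₑ) +
        ‖Q‖ₑ * (‖freqWeight l ξ‖ₑ ^ b' * ‖iteratedDeriv (m - 1) (fHat h l) ξ‖ₑ)) := by
  rw [freqMajorant, enorm_mul]
  refine (mul_le_mul' (enorm_add_le _ _) (enorm_add_le _ _)).trans (le_of_eq ?_)
  simp only [enorm_mul, enorm_pow, enorm_norm]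
  ring

lemma exists_tsum_lintegral_freqMajorant_le (N b b' : ℕ) : ∃ C : ℝ≥0∞, C ≠ ⊤ ∧
    ∀ (n : ℕ) (h : ℝ → ℝ → ℂ), MemH ((N + 1 : ℕ) : ℝ) n h → b ≤ n → b' ≤ n →
    ∀ (P Q : ℝ), ∀ m ≤ N + 1,
      ∑' l, ∫⁻ ξ, ‖freqMajorant P Q b b' m h l ξ‖ₑ ^ 2 ≤
        C * (‖P‖ₑ ^ 2 * ENNReal.ofReal (HnormSq ((N + 1 : ℕ) : ℝ) b h) +
          ‖Q‖ₑ ^ 2 * ENNReal.ofReal (HnormSq ((N + 1 : ℕ) : ℝ) b' h)) := by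
  obtain ⟨C, hC, hb⟩ := exists_freqEnergy_le N b
  obtain ⟨C', hC', hb'⟩ := exists_freqEnergy_le N b'
  refine ⟨32 * (C + C'), by finiteness, fun n h hh hbn hbn' P Q m hm => ?_⟩
  have h0 : stripEnergy (N + 1) h ≠ ⊤ := ne_top_of_le_ne_top ENNReal.ofReal_ne_top
    (hh.stripEnergy_le (p := 0) (q := 0) le_rfl (Nat.zero_le n))
  have hmeas : ∀ (l : ℤ) (j : ℕ), Measurable (iteratedDeriv j (fHat h l)) := fun l j =>
    measurable_iteratedDeriv_fHat (integrable_of_stripEnergy hh.1.continuous h0) l j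
  have hmw : ∀ (R : ℝ) (d j : ℕ) (l : ℤ), Measurable fun ξ =>
      ‖R‖ₑ * (‖freqWeight l ξ‖ₑ ^ d * ‖iteratedDeriv j (fHat h l) ξ‖ₑ) := fun R d j l => by
    have h1 := hmeas l j
    have h2 := measurable_freqWeight l
    fun_prop
  have step : ∀ (R : ℝ) (d : ℕ), ∑' l, ∫⁻ ξ,
      (‖R‖ₑ * (‖freqWeight l ξ‖ₑ ^ d * ‖iteratedDeriv m (fHat h l) ξ‖ₑ) +
        ‖R‖ₑ * (‖freqWeight l ξ‖ₑ ^ d * ‖iteratedDeriv (m - 1) (fHat h l) ξ‖ₑ)) ^ 2 ≤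
      4 * (‖R‖ₑ ^ 2 * (freqEnergy d m h + freqEnergy d (m - 1) h)) := fun R d => by
    refine (tsum_lintegral_add_sq_le fun l => hmw R d m l).trans (le_of_eq ?_)
    rw [tsum_lintegral_const_mul_sq _ (by finiteness),
      tsum_lintegral_const_mul_sq _ (by finiteness),
      ← mul_add, freqEnergy, freqEnergy]
  calc _ ≤ _ := ENNReal.tsum_le_tsum fun l => lintegral_mono fun ξ =>
        pow_le_pow_left' (enorm_freqMajorant_le b b' m h l ξ) 2
    _ ≤ _ := tsum_lintegral_add_sq_le fun l => (hmw P b m l).add (hmw P b (m - 1) l)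
    _ ≤ 4 * (4 * (‖P‖ₑ ^ 2 * (freqEnergy b m h + freqEnergy b (m - 1) h)) +
          4 * (‖Q‖ₑ ^ 2 * (freqEnergy b' m h + freqEnergy b' (m - 1) h))) := by
      gcongr
      · exact step P b
      · exact step Q b'
    _ ≤ 4 * (4 * (‖P‖ₑ ^ 2 * (C * ENNReal.ofReal (HnormSq ((N + 1 : ℕ) : ℝ) b h) +
            C * ENNReal.ofReal (HnormSq ((N + 1 : ℕ) : ℝ) b h))) +
          4 * (‖Q‖ₑ ^ 2 * (C' * ENNReal.ofReal (HnormSq ((N + 1 : ℕ) : ℝ) b' h) +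
            C' * ENNReal.ofReal (HnormSq ((N + 1 : ℕ) : ℝ) b' h)))) := by
      gcongr
      · exact hb n h hh hbn m hm
      · exact hb n h hh hbn (m - 1) (by omega)
      · exact hb' n h hh hbn' m hm
      · exact hb' n h hh hbn' (m - 1) (by omega)
    _ = 32 * (C * (‖P‖ₑ ^ 2 * ENNReal.ofReal (HnormSq ((N + 1 : ℕ) : ℝ) b h)) +
          C' * (‖Q‖ₑ ^ 2 * ENNReal.ofReal (HnormSq ((N + 1 : ℕ) : ℝ) b' h))) := by ring
    _ ≤ 32 * ((C + C') * (‖P‖ₑ ^ 2 * ENNReal.ofReal (HnormSq ((N + 1 : ℕ) : ℝ) b h)) +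
          (C + C') * (‖Q‖ₑ ^ 2 * ENNReal.ofReal (HnormSq ((N + 1 : ℕ) : ℝ) b' h))) := by
      gcongr
      · exact le_self_add
      · exact le_add_self
    _ = _ := by ring

lemma measurable_freqMajorant {N n : ℕ} {h : ℝ → ℝ → ℂ} (hh : MemH ((N + 1 : ℕ) : ℝ) n h)
    (P Q : ℝ) (b b' m : ℕ) (l : ℤ) : Measurable (freqMajorant P Q b b' m h l) := by
  have h0 : stripEnergy (N + 1) h ≠ ⊤ := ne_top_of_le_ne_top ENNReal.ofReal_ne_top
    (hh.stripEnergy_le (p := 0) (q := 0) le_rfl (Nat.zero_le n))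
  have hmeas : ∀ j, Measurable (iteratedDeriv j (fHat h l)) := fun j =>
    measurable_iteratedDeriv_fHat (integrable_of_stripEnergy hh.1.continuous h0) l j
  have h1 := hmeas m
  have h2 := hmeas (m - 1)
  have h3 := measurable_freqWeight l
  unfold freqMajorant
  fun_prop

lemma exists_L2F_le_of_majorant (N b b' : ℕ) : ∃ C > 0,
    ∀ (n : ℕ) (h : ℝ → ℝ → ℂ), MemH ((N + 1 : ℕ) : ℝ) n h → b ≤ n → b' ≤ n →
    ∀ P Q : ℝ, 0 ≤ P → 0 ≤ Q → ∀ m ≤ N + 1, ∀ (k₁ k₂ : ℤ) (s₁ s₂ : ℝ) (u : ℤ → ℝ → ℂ),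
    (∀ n, ∀ᵐ ξ, ‖u n ξ‖ ≤ freqMajorant P Q b b' m h (n - k₁) (ξ - s₁) +
      freqMajorant P Q b b' m h (n - k₂) (ξ - s₂)) →
    L2F u ≤ C * (P * Hnorm ((N + 1 : ℕ) : ℝ) b h + Q * Hnorm ((N + 1 : ℕ) : ℝ) b' h) := by
  obtain ⟨C, hC, hM⟩ := exists_tsum_lintegral_freqMajorant_le N b b'
  refine ⟨Real.sqrt (8 * C.toReal) + 1, by positivity,
    fun n h hh hb hb' P Q hP hQ m hm k₁ k₂ s₁ s₂ u hu => ?_⟩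
  have hM := hM n h hh hb hb' P Q m hm
  set X := HnormSq ((N + 1 : ℕ) : ℝ) b h with hX
  set Y := HnormSq ((N + 1 : ℕ) : ℝ) b' h with hY
  have hX0 : 0 ≤ X := HnormSq_nonneg _ _ _
  have hY0 : 0 ≤ Y := HnormSq_nonneg _ _ _
  have hle : ∑' n, ∫⁻ ξ, ‖u n ξ‖ₑ ^ 2 ≤
      8 * (C * (‖P‖ₑ ^ 2 * ENNReal.ofReal X + ‖Q‖ₑ ^ 2 * ENNReal.ofReal Y)) := by
    calc _ ≤ ∑' n, ∫⁻ ξ, (‖freqMajorant P Q b b' m h (n - k₁) (ξ - s₁)‖ₑ +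
          ‖freqMajorant P Q b b' m h (n - k₂) (ξ - s₂)‖ₑ) ^ 2 := by
          refine ENNReal.tsum_le_tsum fun n => lintegral_mono_ae ?_
          filter_upwards [hu n] with ξ hξ
          refine pow_le_pow_left' (le_trans ?_ (enorm_add_le _ _)) 2
          exact enorm_le_iff_norm_le.2 (hξ.trans (Real.le_norm_self _))
      _ ≤ _ := tsum_lintegral_add_sq_le fun n => by
          have := measurable_freqMajorant hh P Q b b' m (n - k₁)
          fun_prop
      _ = 8 * ∑' l, ∫⁻ ξ, ‖freqMajorant P Q b b' m h l ξ‖ₑ ^ 2 := by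
          rw [tsum_lintegral_translate (fun l ξ => ‖freqMajorant P Q b b' m h l ξ‖ₑ ^ 2),
            tsum_lintegral_translate (fun l ξ => ‖freqMajorant P Q b b' m h l ξ‖ₑ ^ 2)]
          ring
      _ ≤ _ := by gcongr
  refine (L2F_le_sqrt (by finiteness) hle).trans ?_
  have e : (8 * (C * (‖P‖ₑ ^ 2 * ENNReal.ofReal X + ‖Q‖ₑ ^ 2 * ENNReal.ofReal Y))).toReal =
      8 * C.toReal * (P ^ 2 * X + Q ^ 2 * Y) := by
    rw [ENNReal.toReal_mul, ENNReal.toReal_mul, ENNReal.toReal_add (by finiteness) (by finiteness)]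
    simp [hX0, hY0, mul_assoc]
  rw [e, Real.sqrt_mul (by positivity)]
  have hx : Hnorm ((N + 1 : ℕ) : ℝ) b h = Real.sqrt X := rfl
  have hy : Hnorm ((N + 1 : ℕ) : ℝ) b' h = Real.sqrt Y := rfl
  rw [hx, hy]
  refine mul_le_mul (by linarith) ?_ (Real.sqrt_nonneg _) (by positivity)
  rw [Real.sqrt_le_left (by positivity)]
  have h1 := Real.sq_sqrt hX0
  have h2 := Real.sq_sqrt hY0
  have h3 : 0 ≤ P * Real.sqrt X * (Q * Real.sqrt Y) := by positivity
  nlinarith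

lemma one_le_jap (σ : ℝ) : 1 ≤ jap σ := by
  rw [jap, Real.one_le_sqrt]
  nlinarith [sq_nonneg σ]

lemma abs_le_jap (σ : ℝ) : |σ| ≤ jap σ := by
  rw [jap]
  exact Real.abs_le_sqrt (by linarith)

lemma max_pow_le_add {a b : ℝ} (ha : 0 ≤ a) (hb : 0 ≤ b) (n : ℕ) :
    max a b ^ n ≤ a ^ n + b ^ n := by
  have h1 : 0 ≤ a ^ n := by positivity
  have h2 : 0 ≤ b ^ n := by positivity
  rcases max_choice a b with h | h <;> rw [h] <;> linarith

lemma abs_pow_mul_pow_le {n ξ X : ℝ} (hX : 1 ≤ X) (hn : |n| ≤ X) (hξ : |ξ| ≤ 2 * X)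
    {p q γ : ℕ} (hpq : p + q ≤ γ) : |n ^ p * ξ ^ q| ≤ 2 ^ γ * X ^ γ := by
  rw [abs_mul, abs_pow, abs_pow]
  calc |n| ^ p * |ξ| ^ q ≤ X ^ p * (2 * X) ^ q := by gcongr
    _ = 2 ^ q * X ^ (p + q) := by rw [mul_pow, pow_add]; ring
    _ ≤ 2 ^ γ * X ^ γ := by
      gcongr
      · norm_num
      · omega

lemma abs_pow_sub_pow_le_mul {a b A X : ℝ} (hA : |a - b| ≤ A) (ha : |a| ≤ X)
    (hb : |b| ≤ X) (p : ℕ) : |a ^ p - b ^ p| ≤ p * (A * X ^ (p - 1)) := by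
  have hA0 : 0 ≤ A := (abs_nonneg _).trans hA
  calc _ ≤ |a - b| * p * max |a| |b| ^ (p - 1) := abs_pow_sub_pow_le a b p
    _ ≤ A * p * X ^ (p - 1) := by
      gcongr
      exact max_le ha hb
    _ = _ := by ring

lemma abs_pow_mul_pow_sub_le {n l ξ η A X : ℝ} (hX : 1 ≤ X) (hn : |n| ≤ X) (hl : |l| ≤ X)
    (hξ : |ξ| ≤ 2 * X) (hη : |η| ≤ X) (hnl : |n - l| ≤ A) (hξη : |ξ - η| ≤ A)
    {p q γ : ℕ} (hpq : p + q ≤ γ) :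
    |n ^ p * ξ ^ q - l ^ p * η ^ q| ≤ γ * 2 ^ γ * (A * X ^ (γ - 1)) := by
  have hA0 : 0 ≤ A := (abs_nonneg _).trans hnl
  have h1 : |(n ^ p - l ^ p) * ξ ^ q| ≤ p * (2 ^ γ * (A * X ^ (γ - 1))) := by
    rcases Nat.eq_zero_or_pos p with rfl | hp
    · simp
    rw [abs_mul, abs_pow]
    calc _ ≤ p * (A * X ^ (p - 1)) * (2 * X) ^ q := by
          gcongr
          exact abs_pow_sub_pow_le_mul hnl hn hl p
      _ = p * (2 ^ q * (A * X ^ (p - 1 + q))) := by rw [mul_pow, pow_add]; ring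
      _ ≤ _ := by
          gcongr
          · norm_num
          · omega
          · omega
  have h2 : |l ^ p * (ξ ^ q - η ^ q)| ≤ q * (2 ^ γ * (A * X ^ (γ - 1))) := by
    rcases Nat.eq_zero_or_pos q with rfl | hq
    · simp
    rw [abs_mul, abs_pow]
    calc _ ≤ X ^ p * (q * (A * (2 * X) ^ (q - 1))) := by
          gcongr
          exact abs_pow_sub_pow_le_mul hξη hξ (by linarith) q
      _ = q * (2 ^ (q - 1) * (A * X ^ (p + (q - 1)))) := by rw [mul_pow, pow_add]; ring
      _ ≤ _ := by
          gcongr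
          · norm_num
          · omega
          · omega
  have e : n ^ p * ξ ^ q - l ^ p * η ^ q = (n ^ p - l ^ p) * ξ ^ q + l ^ p * (ξ ^ q - η ^ q) := by
    ring
  rw [e]
  refine (abs_add_le _ _).trans ((add_le_add h1 h2).trans ?_)
  rw [← add_mul, mul_assoc]
  gcongr
  exact_mod_cast hpq

/-- The frequencies before and after a shift by `(k, kσ)`, compared with `⟨σ⟩` and the weight of
the shifted frequency. -/
lemma shifted_frequency_bounds {σ : ℝ} {n k : ℤ} (hk : |(k : ℝ)| = 1) (ξ : ℝ) :
    let B := freqWeight (n - k) (ξ - k * σ)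
    |(n : ℝ)| ≤ B ∧ |(n : ℝ) - k| ≤ B ∧ |ξ| ≤ 2 * max (jap σ) B ∧ |ξ - k * σ| ≤ B ∧
      |(n : ℝ) - (n - k)| ≤ jap σ ∧ |ξ - (ξ - k * σ)| ≤ jap σ ∧
      |n * σ - ξ| ≤ jap σ * B := by
  intro B
  have hB : B = 1 + |(n : ℝ) - k| + |ξ - k * σ| := by simp only [B, freqWeight]; push_cast; rfl
  have hkσ : |(k : ℝ) * σ| ≤ jap σ := by rw [abs_mul, hk, one_mul]; exact abs_le_jap σ
  have h1 := one_le_jap σ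
  have hl := abs_nonneg ((n : ℝ) - k)
  have hη := abs_nonneg (ξ - k * σ)
  have hn : |(n : ℝ)| ≤ |(n : ℝ) - k| + 1 := by
    calc |(n : ℝ)| = |((n : ℝ) - k) + k| := by ring_nf
      _ ≤ _ := by rw [← hk]; exact abs_add_le _ _
  have hξ : |ξ| ≤ |ξ - k * σ| + jap σ := by
    calc |ξ| = |(ξ - k * σ) + k * σ| := by ring_nf
      _ ≤ _ := (abs_add_le _ _).trans (by linarith)
  refine ⟨by linarith, by linarith, ?_, by linarith, ?_, ?_, ?_⟩
  · have := le_max_left (jap σ) B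
    have := le_max_right (jap σ) B
    linarith
  · rw [sub_sub_cancel, hk]; exact h1
  · rw [sub_sub_cancel]; exact hkσ
  · calc |n * σ - ξ| = |((n : ℝ) - k) * σ - (ξ - k * σ)| := by ring_nf
      _ ≤ |((n : ℝ) - k) * σ| + |ξ - k * σ| := abs_sub _ _
      _ ≤ |(n : ℝ) - k| * jap σ + jap σ * |ξ - k * σ| := by
        rw [abs_mul]
        gcongr
        · exact abs_le_jap σ
        · exact le_mul_of_one_le_left hη h1
      _ ≤ jap σ * B := by rw [hB]; nlinarith

lemma max_pow_le_of_one_le {A B : ℝ} (hA : 1 ≤ A) (hB : 1 ≤ B) (γ : ℕ) :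
    max A B ^ γ ≤ A ^ (γ + 1) * B ^ 1 + A ^ 2 * B ^ γ := by
  refine (max_pow_le_add (by linarith) (by linarith) γ).trans (add_le_add ?_ ?_)
  · calc A ^ γ ≤ A ^ (γ + 1) := pow_le_pow_right₀ hA (by omega)
      _ ≤ _ := le_mul_of_one_le_right (by positivity) (by simpa using hB)
  · exact le_mul_of_one_le_left (by positivity) (one_le_pow₀ hA)

lemma max_pow_mul_le {A B : ℝ} (hA : 1 ≤ A) (hB : 1 ≤ B) (γ : ℕ) :
    max A B ^ γ * (A * B) ≤ A ^ (γ + 1) * B ^ 1 + A ^ 2 * B ^ (γ + 1) := by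
  calc _ ≤ (A ^ γ + B ^ γ) * (A * B) := by
        gcongr
        exact max_pow_le_add (by linarith) (by linarith) γ
    _ = A ^ (γ + 1) * B ^ 1 + A * B ^ (γ + 1) := by ring
    _ ≤ _ := by
        gcongr
        exact le_self_pow₀ hA (by norm_num)

lemma mul_max_pow_pred_mul_le {A B : ℝ} (hA : 1 ≤ A) (hB : 1 ≤ B) (γ : ℕ) :
    γ * (A * max A B ^ (γ - 1)) * (A * B) ≤ γ * (A ^ (γ + 1) * B ^ 1 + A ^ 2 * B ^ γ) := by
  rcases γ with _ | γ
  · simp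
  simp only [Nat.add_sub_cancel]
  calc _ ≤ ((γ + 1 : ℕ) : ℝ) * (A * (A ^ γ + B ^ γ)) * (A * B) := by
        gcongr
        exact max_pow_le_add (by linarith) (by linarith) γ
    _ = _ := by ring

/-- The symbol of the shifted transport term is dominated by the two admissible weights. -/
lemma symbol_bounds {σ : ℝ} {n k : ℤ} (hk : |(k : ℝ)| = 1) (ξ : ℝ) {p q γ : ℕ}
    (hpq : p + q ≤ γ) :
    let A := jap σ
    let B := freqWeight (n - k) (ξ - k * σ)
    |(n : ℝ) ^ p * ξ ^ q| ≤ 2 ^ γ * (A ^ (γ + 1) * B ^ 1 + A ^ 2 * B ^ γ) ∧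
    |(n : ℝ) ^ p * ξ ^ q| * |n * σ - ξ| ≤
      2 ^ γ * (A ^ (γ + 1) * B ^ 1 + A ^ 2 * B ^ (γ + 1)) ∧
    |(n : ℝ) ^ p * ξ ^ q - ((n : ℝ) - k) ^ p * (ξ - k * σ) ^ q| * |n * σ - ξ| ≤
      γ * 2 ^ γ * (A ^ (γ + 1) * B ^ 1 + A ^ 2 * B ^ γ) := by
  intro A B
  have hA : 1 ≤ A := one_le_jap σ
  have hB : 1 ≤ B := one_le_freqWeight _ _
  obtain ⟨b1, b2, b3, b4, b5, b6, b7⟩ := shifted_frequency_bounds (σ := σ) (n := n) hk ξ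
  have hBX : B ≤ max A B := le_max_right A B
  have hX : 1 ≤ max A B := hB.trans hBX
  have m1 := abs_pow_mul_pow_le hX (b1.trans hBX) b3 hpq
  have m2 := abs_pow_mul_pow_sub_le hX (b1.trans hBX) (b2.trans hBX) b3 (b4.trans hBX) b5 b6 hpq
  refine ⟨m1.trans ?_, (mul_le_mul m1 b7 (abs_nonneg _) (by positivity)).trans ?_,
    (mul_le_mul m2 b7 (abs_nonneg _) (by positivity)).trans ?_⟩
  · gcongr
    exact max_pow_le_of_one_le hA hB γ
  · rw [mul_assoc]
    gcongr
    exact max_pow_mul_le hA hB γ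
  · have h := mul_max_pow_pred_mul_le hA hB γ
    calc _ = 2 ^ γ * (γ * (A * max A B ^ (γ - 1)) * (A * B)) := by ring
      _ ≤ 2 ^ γ * (γ * (A ^ (γ + 1) * B ^ 1 + A ^ 2 * B ^ γ)) := by gcongr
      _ = _ := by ring

/-- The coefficient `k pₖ ζₖ(σ)` of the transport operator. -/
def transportCoeff (g : ℝ → ℝ → ℂ) (σ : ℝ) (k : ℤ) : ℂ :=
  (k : ℂ) * pcoef k * fHat g k ((k : ℝ) * σ)

lemma norm_transportCoeff_le (g : ℝ → ℝ → ℂ) (σ : ℝ) {k : ℤ} (hk : k = 1 ∨ k = -1) :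
    ‖transportCoeff g σ k‖ ≤ max ‖fHat g 1 σ‖ ‖fHat g (-1) (-σ)‖ := by
  rcases hk with rfl | rfl
  · refine le_trans ?_ (le_max_left _ _)
    have := norm_nonneg (fHat g 1 σ)
    simp [transportCoeff, pcoef]
    linarith
  · refine le_trans ?_ (le_max_right _ _)
    have := norm_nonneg (fHat g (-1) (-σ))
    simp [transportCoeff, pcoef]
    linarith

lemma FL_eq (g h : ℝ → ℝ → ℂ) (σ : ℝ) (n : ℤ) :
    FL g h σ n = fun ξ : ℝ =>
      (transportCoeff g σ 1 * fHat h (n - 1) (ξ - ((1 : ℤ) : ℝ) * σ) +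
        transportCoeff g σ (-1) * fHat h (n - -1) (ξ - ((-1 : ℤ) : ℝ) * σ)) *
        (((n * σ : ℝ) : ℂ) - ξ) := by
  ext ξ
  rw [FL, Finset.sum_pair (by decide), transportCoeff, transportCoeff, ← add_mul]
  push_cast
  rfl

lemma ae_iteratedDeriv_FL {N n₀ : ℕ} {h : ℝ → ℝ → ℂ} (hh : MemH ((N + 1 : ℕ) : ℝ) n₀ h)
    (g : ℝ → ℝ → ℂ) (σ : ℝ) (n : ℤ) {m : ℕ} (hm : m ≤ N + 1) :
    ∀ᵐ ξ : ℝ, iteratedDeriv m (FL g h σ n) ξ =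
      (transportCoeff g σ 1 * iteratedDeriv m (fHat h (n - 1)) (ξ - ((1 : ℤ) : ℝ) * σ) +
        transportCoeff g σ (-1) *
          iteratedDeriv m (fHat h (n - -1)) (ξ - ((-1 : ℤ) : ℝ) * σ)) *
        (((n * σ : ℝ) : ℂ) - ξ) -
      m * (transportCoeff g σ 1 *
          iteratedDeriv (m - 1) (fHat h (n - 1)) (ξ - ((1 : ℤ) : ℝ) * σ) +
        transportCoeff g σ (-1) *
          iteratedDeriv (m - 1) (fHat h (n - -1)) (ξ - ((-1 : ℤ) : ℝ) * σ)) := by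
  have h0 : stripEnergy (N + 1) h ≠ ⊤ := ne_top_of_le_ne_top ENNReal.ofReal_ne_top
    (hh.stripEnergy_le (p := 0) (q := 0) le_rfl (Nat.zero_le n₀))
  have hd := fun l => aeDiffOrder_fHat hh.1.continuous h0 l
  have hc := fun j (hj : j ≤ N + 1) => ae_iteratedDeriv_translate_comb (hd (n - 1)) (hd (n - -1))
    (transportCoeff g σ 1) (transportCoeff g σ (-1)) (((1 : ℤ) : ℝ) * σ) (((-1 : ℤ) : ℝ) * σ) hj
  rw [FL_eq]
  filter_upwards [ae_iteratedDeriv_mul_affine ((hd (n - 1)).translate_comb (hd (n - -1))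
    (transportCoeff g σ 1) (transportCoeff g σ (-1)) (((1 : ℤ) : ℝ) * σ) (((-1 : ℤ) : ℝ) * σ))
    ((n * σ : ℝ) : ℂ) hm, hc m hm, hc (m - 1) (by omega)] with ξ e1 e2 e3
  rw [e1, e2, e3]

lemma norm_mul_comb_le {a F G : ℂ} {x y Z R : ℝ} (ha : ‖a‖ ≤ Z) (hx : |x| ≤ R) (hy : |y| ≤ R) :
    ‖a * (x * F - y * G)‖ ≤ Z * R * (‖F‖ + ‖G‖) := by
  have hZ : 0 ≤ Z := (norm_nonneg a).trans ha
  have hR : 0 ≤ R := (abs_nonneg x).trans hx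
  rw [norm_mul, mul_assoc]
  gcongr
  refine (norm_sub_le _ _).trans ?_
  rw [norm_mul, norm_mul, Complex.norm_real, Complex.norm_real, norm_eq_abs, norm_eq_abs, mul_add]
  gcongr

lemma norm_commutator_term_le {g h : ℝ → ℝ → ℂ} {σ : ℝ} {n k : ℤ} (hk : k = 1 ∨ k = -1) (ξ : ℝ)
    {p q m γ m0 : ℕ} (hpq : p + q ≤ γ) (hm : m ≤ m0) (F G : ℤ → ℝ → ℂ)
    (hF : F = fun l => iteratedDeriv m (fHat h l))
    (hG : G = fun l => iteratedDeriv (m - 1) (fHat h l)) :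
    ‖transportCoeff g σ k *
      ((((n : ℝ) ^ p * ξ ^ q - ((n : ℝ) - k) ^ p * (ξ - k * σ) ^ q) * (n * σ - ξ) : ℝ) *
          F (n - k) (ξ - k * σ) -
        (m * ((n : ℝ) ^ p * ξ ^ q) : ℝ) * G (n - k) (ξ - k * σ))‖ ≤
      freqMajorant ((γ + m0 + 1) * 2 ^ γ * mzeta g σ (γ + 1)) ((γ + m0 + 1) * 2 ^ γ * mzeta g σ 2)
        1 γ m h (n - k) (ξ - k * σ) ∧
    ‖transportCoeff g σ k *
      (((n : ℝ) ^ p * ξ ^ q * (n * σ - ξ) : ℝ) * F (n - k) (ξ - k * σ) -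
        (m * ((n : ℝ) ^ p * ξ ^ q) : ℝ) * G (n - k) (ξ - k * σ))‖ ≤
      freqMajorant ((γ + m0 + 1) * 2 ^ γ * mzeta g σ (γ + 1)) ((γ + m0 + 1) * 2 ^ γ * mzeta g σ 2)
        1 (γ + 1) m h (n - k) (ξ - k * σ) := by
  have hk1 : |(k : ℝ)| = 1 := by rcases hk with rfl | rfl <;> simp
  obtain ⟨s1, s2, s3⟩ := symbol_bounds (σ := σ) (n := n) hk1 ξ hpq
  have ha := norm_transportCoeff_le g σ hk
  set Z := max ‖fHat g 1 σ‖ ‖fHat g (-1) (-σ)‖ with hZ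
  set A := jap σ with hA
  have hA1 : 1 ≤ A := one_le_jap σ
  have hB1 := one_le_freqWeight (n - k) (ξ - k * σ)
  set B := freqWeight (n - k) (ξ - k * σ) with hB
  have hmm : (m : ℝ) ≤ m0 := by exact_mod_cast hm
  have h2 : (0 : ℝ) < 2 ^ γ := by positivity
  have hR : 0 ≤ 2 ^ γ * (A ^ (γ + 1) * B ^ 1 + A ^ 2 * B ^ γ) := by positivity
  have hRR : 2 ^ γ * (A ^ (γ + 1) * B ^ 1 + A ^ 2 * B ^ γ) ≤
      2 ^ γ * (A ^ (γ + 1) * B ^ 1 + A ^ 2 * B ^ (γ + 1)) := by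
    gcongr
    omega
  have hmul : |(m : ℝ) * ((n : ℝ) ^ p * ξ ^ q)| ≤
      m0 * (2 ^ γ * (A ^ (γ + 1) * B ^ 1 + A ^ 2 * B ^ γ)) := by
    rw [abs_mul, Nat.abs_cast]
    gcongr
  have hγ : (0 : ℝ) ≤ γ := by positivity
  have hm0 : (0 : ℝ) ≤ m0 := by positivity
  constructor
  · refine (norm_mul_comb_le (R := (γ + m0 + 1) * (2 ^ γ * (A ^ (γ + 1) * B ^ 1 + A ^ 2 * B ^ γ)))
      ha ?_ ?_).trans (le_of_eq ?_)
    · rw [abs_mul]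
      exact s3.trans (by nlinarith)
    · exact hmul.trans (by nlinarith)
    · simp only [freqMajorant, mzeta, ← hZ, ← hA, ← hB, hF, hG]
      ring
  · refine (norm_mul_comb_le
      (R := (γ + m0 + 1) * (2 ^ γ * (A ^ (γ + 1) * B ^ 1 + A ^ 2 * B ^ (γ + 1))))
      ha ?_ ?_).trans (le_of_eq ?_)
    · rw [abs_mul]
      exact s2.trans (by nlinarith)
    · exact hmul.trans (by nlinarith)
    · simp only [freqMajorant, mzeta, ← hZ, ← hA, ← hB, hF, hG]
      ring

end

/-- **Lemma (commutator estimates).** For integers `γ ≥ 0` and `m₀ ≥ 1` there is a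
constant `C` (depending only on `γ`, `m₀`) such that for all `p + q ≤ γ`, `m ≤ m₀`, all
`σ ≥ 0` and all `g, h` in the relevant spaces:
(i) `‖[D^{m,p,q}, L_σ[g]]h‖_{L²} ≤ C(m_{σ,γ+1}(ζ)‖h‖_{ℋ¹} + m_{σ,2}(ζ)‖h‖_{ℋ^γ})`;
(ii) `‖D^{m,p,q}(L_σ[g]h)‖_{L²} ≤ C(m_{σ,γ+1}(ζ)‖h‖_{ℋ¹} + m_{σ,2}(ζ)‖h‖_{ℋ^{γ+1}})`. -/
theorem commutator_estimates (γ m0 : ℕ) (hm0 : 1 ≤ m0) :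
    ∃ C > 0, ∀ p q m : ℕ, p + q ≤ γ → m ≤ m0 → ∀ σ : ℝ, 0 ≤ σ →
      ∀ g h : ℝ → ℝ → ℂ, MemH (m0 : ℝ) (γ + 1) h → MemH (m0 : ℝ) 2 g →
        L2F (fun n ξ => DF p q m (FL g h σ) n ξ - FLD g h σ p q m n ξ) ≤
            C * (mzeta g σ (γ + 1) * Hnorm (m0 : ℝ) 1 h +
              mzeta g σ 2 * Hnorm (m0 : ℝ) γ h) ∧
        L2F (DF p q m (FL g h σ)) ≤
            C * (mzeta g σ (γ + 1) * Hnorm (m0 : ℝ) 1 h +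
              mzeta g σ 2 * Hnorm (m0 : ℝ) (γ + 1) h) := by
  obtain ⟨N, rfl⟩ : ∃ N, m0 = N + 1 := ⟨m0 - 1, by omega⟩
  obtain ⟨C₁, hC₁, H₁⟩ := exists_L2F_le_of_majorant N 1 γ
  obtain ⟨C₂, hC₂, H₂⟩ := exists_L2F_le_of_majorant N 1 (γ + 1)
  set K : ℝ := (γ + (N + 1 : ℕ) + 1) * 2 ^ γ with hK
  have hKpos : 0 < K := by positivity
  refine ⟨(C₁ + C₂) * K, by positivity, fun p q m hpq hm σ _ g h hh _ => ?_⟩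
  have hz : ∀ j, 0 ≤ mzeta g σ j := fun j =>
    mul_nonneg (pow_nonneg (Real.sqrt_nonneg _) _) ((norm_nonneg _).trans (le_max_left _ _))
  have hH : ∀ j, 0 ≤ Hnorm ((N + 1 : ℕ) : ℝ) j h := fun j => Real.sqrt_nonneg _
  have hP := mul_nonneg hKpos.le (hz (γ + 1))
  have hQ := mul_nonneg hKpos.le (hz 2)
  have conclude : ∀ {x c X : ℝ}, 0 ≤ X → c ≤ C₁ + C₂ → x ≤ c * (K * X) → x ≤ (C₁ + C₂) * K * X :=
    fun hX hc hx => by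
      refine hx.trans ?_
      rw [mul_assoc _ K]
      exact mul_le_mul_of_nonneg_right hc (mul_nonneg hKpos.le hX)
  constructor
  · refine conclude (add_nonneg (mul_nonneg (hz _) (hH _)) (mul_nonneg (hz _) (hH _)))
      (c := C₁) (by linarith) ?_
    rw [mul_add K, ← mul_assoc K, ← mul_assoc K]
    refine H₁ (γ + 1) h hh (by omega) (by omega) _ _ hP hQ m hm 1 (-1) (((1 : ℤ) : ℝ) * σ)
      (((-1 : ℤ) : ℝ) * σ) _ fun n => ?_
    filter_upwards [ae_iteratedDeriv_FL hh g σ n hm] with ξ e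
    have t1 := (norm_commutator_term_le (g := g) (h := h) (σ := σ) (n := n) (k := 1)
      (Or.inl rfl) ξ hpq hm _ _ rfl rfl).1
    have t2 := (norm_commutator_term_le (g := g) (h := h) (σ := σ) (n := n) (k := -1)
      (Or.inr rfl) ξ hpq hm _ _ rfl rfl).1
    refine le_trans (le_of_eq ?_) ((norm_add_le _ _).trans (add_le_add t1 t2))
    congr 1
    rw [DF, e, FLD, Finset.sum_pair (by decide), ← transportCoeff, ← transportCoeff]
    push_cast
    ring
  · refine conclude (add_nonneg (mul_nonneg (hz _) (hH _)) (mul_nonneg (hz _) (hH _)))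
      (c := C₂) (by linarith) ?_
    rw [mul_add K, ← mul_assoc K, ← mul_assoc K]
    refine H₂ (γ + 1) h hh (by omega) (by omega) _ _ hP hQ m hm 1 (-1) (((1 : ℤ) : ℝ) * σ)
      (((-1 : ℤ) : ℝ) * σ) _ fun n => ?_
    filter_upwards [ae_iteratedDeriv_FL hh g σ n hm] with ξ e
    have t1 := (norm_commutator_term_le (g := g) (h := h) (σ := σ) (n := n) (k := 1)
      (Or.inl rfl) ξ hpq hm _ _ rfl rfl).2
    have t2 := (norm_commutator_term_le (g := g) (h := h) (σ := σ) (n := n) (k := -1)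
      (Or.inr rfl) ξ hpq hm _ _ rfl rfl).2
    refine le_trans (le_of_eq ?_) ((norm_add_le _ _).trans (add_le_add t1 t2))
    congr 1
    rw [DF, e]
    push_cast
    ring
end
end
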